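/- arXiv:2102.11699 — 4 statements merged into one kernel-verified Lean document; each statement's English description precedes it below -/
import Mathlib

section
/- Let d > 1 be a squarefree integer and let p ≥ 5 be a prime with p ∤ d. If p is d-regular, then the equation x^p + y^p = z^p has no non-trivial solutions with x, y, z ∈ ℚ(√d). -/
open IntermediateField

/-- A prime `p` is `d`-regular if `p` does not divide the class number of the number field
`ℚ(√d, ζ_p)`, formalized here by quantifying over all number fields generated over `ℚ` by a
square root of `d` and a primitive `p`-th root of unity. -/
def IsRegularFor (d : ℤ) (p : ℕ) : Prop :=
  ∀ (L : Type) [Field L] [NumberField L] (s ζ : L),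
    s ^ 2 = (d : L) → IsPrimitiveRoot ζ p →
    IntermediateField.adjoin ℚ ({s, ζ} : Set L) = ⊤ →
    ¬ (p ∣ NumberField.classNumber L)

section CyclicModule

open Module

theorem AddSubgroup.index_range_nsmul_eq_card_ker_of_finite {T : Type*} [AddCommGroup T] [Finite T]
    (n : ℕ) :
    (nsmulAddMonoidHom (α := T) n).range.index = Nat.card (nsmulAddMonoidHom (α := T) n).ker := by
  set f := nsmulAddMonoidHom (α := T) n
  have h1 := f.ker.card_mul_index
  have h2 := f.range.card_mul_index
  rw [AddSubgroup.index_ker] at h1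
  have h3 : 0 < Nat.card f.range := Nat.card_pos
  rw [← h2, mul_comm] at h1
  exact (Nat.eq_of_mul_eq_mul_left h3 h1).symm

/-- For a finitely generated abelian group `M` and `n ≠ 0`, the quotient `M / nM` has
`n ^ rank M * |M[n]|` elements. -/
theorem AddSubgroup.index_range_nsmul_eq_pow_mul_card_ker {M : Type*} [AddCommGroup M]
    [Module.Finite ℤ M] {n : ℕ} (hn : n ≠ 0) :
    (nsmulAddMonoidHom (α := M) n).range.index =
      n ^ finrank ℤ M * Nat.card (nsmulAddMonoidHom (α := M) n).ker := by
  let T := Submodule.torsion ℤ M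
  let F := M ⧸ T
  have : Finite T := Module.finite_of_fg_torsion T Submodule.torsion_isTorsion
  have : Module.Free ℤ F := inferInstance
  obtain ⟨f, hf⟩ := Module.projective_lifting_property T.mkQ LinearMap.id T.mkQ_surjective
  have e : M ≃+ T × F := ((lequivProdOfRightSplitExact (j := T.subtype) (g := T.mkQ)
    T.injective_subtype
    (by rw [Submodule.range_subtype, Submodule.ker_mkQ]) hf).symm).toAddEquiv
  have hrange : (nsmulAddMonoidHom (α := T × F) n).range =
      (nsmulAddMonoidHom (α := T) n).range.prod (nsmulAddMonoidHom (α := F) n).range := by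
    ext ⟨a, b⟩
    simp only [AddMonoidHom.mem_range, AddSubgroup.mem_prod, nsmulAddMonoidHom_apply, Prod.ext_iff,
      Prod.exists, Prod.smul_mk]
    exact ⟨fun ⟨c, d, h1, h2⟩ => ⟨⟨c, h1⟩, ⟨d, h2⟩⟩, fun ⟨⟨c, h1⟩, ⟨d, h2⟩⟩ => ⟨c, d, h1, h2⟩⟩
  have hidx : (nsmulAddMonoidHom (α := M) n).range.index =
      (nsmulAddMonoidHom (α := T × F) n).range.index := by
    rw [← AddSubgroup.index_map_equiv _ e, AddEquiv.map_range_nsmulAddMonoidHom]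
  have hfr : finrank ℤ M = finrank ℤ F := by
    have h1 := T.finrank_quotient_add_finrank
    have h2 : finrank ℤ T = 0 := by
      rw [Module.finrank_eq_zero_iff_isTorsion]
      exact Submodule.torsion_isTorsion
    change finrank ℤ M = finrank ℤ (M ⧸ T)
    omega
  have hker : Nat.card (nsmulAddMonoidHom (α := M) n).ker =
      Nat.card (nsmulAddMonoidHom (α := T) n).ker := by
    refine Nat.card_congr ⟨fun x => ⟨⟨x.1, ?_⟩, ?_⟩, fun x => ⟨x.1.1, ?_⟩, ?_, ?_⟩
    · have := x.2
      rw [AddMonoidHom.mem_ker, nsmulAddMonoidHom_apply] at this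
      rw [Submodule.mem_torsion_iff]
      refine ⟨⟨(n : ℤ), mem_nonZeroDivisors_of_ne_zero (by exact_mod_cast hn)⟩, ?_⟩
      change (n : ℤ) • x.1 = 0
      simpa using this
    · have := x.2
      rw [AddMonoidHom.mem_ker, nsmulAddMonoidHom_apply] at this ⊢
      ext
      simpa using this
    · have := x.2
      rw [AddMonoidHom.mem_ker, nsmulAddMonoidHom_apply] at this ⊢
      simpa using congrArg Subtype.val this
    · intro x; rfl
    · intro x; rfl
  rw [hidx, hrange, AddSubgroup.index_prod, AddSubgroup.index_range_nsmul F n,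
    AddSubgroup.index_range_nsmul_eq_card_ker_of_finite, hfr, hker, mul_comm]

theorem Module.End.index_range_pow_dvd {M : Type*} [AddCommGroup M] (f : Module.End ℤ M) (j : ℕ) :
    (LinearMap.range (f ^ j)).toAddSubgroup.index ∣
      (LinearMap.range f).toAddSubgroup.index ^ j := by
  induction j with
  | zero =>
    have : LinearMap.range (1 : Module.End ℤ M) = ⊤ := LinearMap.range_id
    simp [this]
  | succ j ih =>
    have h : (LinearMap.range (f ^ (j + 1))).toAddSubgroup =
        (LinearMap.range (f ^ j)).toAddSubgroup.map f.toAddMonoidHom := by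
      ext x
      simp [pow_succ']
    rw [h, AddSubgroup.index_map, pow_succ]
    exact mul_dvd_mul ((AddSubgroup.index_dvd_of_le le_sup_left).trans ih) (by rfl)

theorem Polynomial.exists_X_sub_one_pow_eq (p : ℕ) [hp : Fact p.Prime] :
    ∃ g : Polynomial ℤ, (Polynomial.X - 1 : Polynomial ℤ) ^ (p - 1) =
      ∑ i ∈ Finset.range p, Polynomial.X ^ i + (p : Polynomial ℤ) * g := by
  open Polynomial in
  have h : C (p : ℤ) ∣ ((X - 1) ^ (p - 1) - ∑ i ∈ Finset.range p, X ^ i : ℤ[X]) := by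
    rw [Polynomial.C_dvd_iff_dvd_coeff]
    intro i
    rw [← ZMod.intCast_zmod_eq_zero_iff_dvd]
    have : map (Int.castRingHom (ZMod p)) ((X - 1) ^ (p - 1) - ∑ i ∈ Finset.range p, X ^ i) = 0 := by
      have hne : (X - 1 : (ZMod p)[X]) ≠ 0 := X_sub_C_ne_zero (1 : ZMod p)
      apply mul_left_cancel₀ hne
      simp only [Polynomial.map_sub, Polynomial.map_pow, Polynomial.map_X, Polynomial.map_one,
        Polynomial.map_sum, mul_sub, mul_zero]
      rw [mul_geom_sum, ← pow_succ', Nat.sub_add_cancel hp.out.one_le, sub_pow_char, one_pow,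
        sub_self]
    have := congrArg (fun q => coeff q i) this
    rwa [coeff_map, coeff_zero, eq_intCast] at this
  obtain ⟨g, hg⟩ := h
  exact ⟨g, by rw [← sub_eq_iff_eq_add', hg]; simp⟩

theorem exists_norm_eq_zero_not_mem_range {A : Type*} [AddCommGroup A] [Module.Finite ℤ A]
    (p : ℕ) [hp : Fact p.Prime] (σ : Module.End ℤ A) (hσ : σ ^ p = 1) (n : ℕ)
    (hB : p ^ finrank ℤ (LinearMap.ker (σ - 1)) *
      Nat.card (nsmulAddMonoidHom (α := LinearMap.ker (σ - 1)) p).ker = p ^ n)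
    (hA : finrank ℤ A = finrank ℤ (LinearMap.ker (σ - 1)) + n * (p - 1))
    (w : A) (hw : σ w ≠ w) (hpw : σ (p • w) = p • w) :
    ∃ η : A, ∑ i ∈ Finset.range p, (σ ^ i) η = 0 ∧ ∀ u : A, σ u - u ≠ η := by
  by_contra! hcon
  set B := LinearMap.ker (σ - 1) with hBdef
  have memB : ∀ a, a ∈ B ↔ σ a = a := fun a => by
    simp [hBdef, LinearMap.mem_ker, sub_eq_zero]
  let f : Module.End ℤ (A ⧸ B) := B.mapQ B (σ - 1) fun b hb => by
    rw [Submodule.mem_comap, show (σ - 1) b = 0 from hb]; exact B.zero_mem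
  let N : A →ₗ[ℤ] A := ∑ i ∈ Finset.range p, σ ^ i
  have hNapp : ∀ a, N a = ∑ i ∈ Finset.range p, (σ ^ i) a := fun a => by simp [N]
  have hNB : ∀ a, N a ∈ B := fun a => by
    have : (σ - 1) * N = 0 := by
      simp only [N]
      rw [mul_geom_sum, hσ, sub_self]
    exact congrArg (fun g => g a) this
  -- `f ^ (p - 1)` is divisible by `p`
  have hfp : (LinearMap.range (f ^ (p - 1))).toAddSubgroup ≤
      (nsmulAddMonoidHom (α := A ⧸ B) p).range := by
    obtain ⟨g, hg⟩ := Polynomial.exists_X_sub_one_pow_eq p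
    have hg' := congrArg (Polynomial.aeval σ) hg
    simp only [map_pow, map_sub, map_one, Polynomial.aeval_X, map_add, map_sum, map_mul,
      map_natCast] at hg'
    rintro _ ⟨m, rfl⟩
    obtain ⟨a, rfl⟩ := B.mkQ_surjective m
    have hf : ∀ j, (f ^ j) (B.mkQ a) = B.mkQ (((σ - 1) ^ j) a) := by
      intro j
      induction j with
      | zero => simp
      | succ j ih => rw [pow_succ', pow_succ', Module.End.mul_apply, ih]; rfl
    rw [hf, hg']
    refine ⟨B.mkQ ((Polynomial.aeval σ g) a), ?_⟩
    have h1 : B.mkQ (N a) = 0 := by simpa using hNB a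
    have h2 : ((p : Module.End ℤ A) * (Polynomial.aeval σ g)) a = p • ((Polynomial.aeval σ g) a) := by
      simp
    rw [LinearMap.add_apply, map_add, h2, map_nsmul]
    change _ = B.mkQ (N a) + _
    rw [h1, zero_add]
    rfl
  -- the norm embeds `A / (B + (σ - 1) A)` into `B / pB`
  have hfB : (LinearMap.range f).toAddSubgroup.index ∣ p ^ n := by
    rw [← hB, ← AddSubgroup.index_range_nsmul_eq_pow_mul_card_ker hp.out.ne_zero]
    let N' : A →+ B := (N.codRestrict B hNB).toAddMonoidHom
    have h1 : ((nsmulAddMonoidHom (α := B) p).range.comap N').index ∣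
        (nsmulAddMonoidHom (α := B) p).range.index := by
      rw [AddSubgroup.index_comap]
      exact AddSubgroup.relIndex_dvd_index_of_normal _ _
    refine dvd_trans ?_ h1
    have h2 : (LinearMap.range f).toAddSubgroup.index =
        ((LinearMap.range f).toAddSubgroup.comap B.mkQ.toAddMonoidHom).index :=
      (AddSubgroup.index_comap_of_surjective _ B.mkQ_surjective).symm
    rw [h2]
    apply AddSubgroup.index_dvd_of_le
    rintro a ⟨b, hb⟩
    have hb' : N a = p • (b : A) := (congrArg Subtype.val hb).symm
    have hNb : N (b : A) = p • (b : A) := by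
      have : ∀ i, (σ ^ i) (b : A) = b := by
        intro i
        induction i with
        | zero => simp
        | succ i ih => rw [pow_succ', Module.End.mul_apply, ih, (memB _).1 b.2]
      rw [hNapp]
      simp [this]
    obtain ⟨u, hu⟩ := hcon (a - b) (by rw [← hNapp, map_sub, hb', hNb, sub_self])
    refine ⟨B.mkQ u, ?_⟩
    change B.mkQ ((σ - 1) u) = B.mkQ a
    have : (σ - 1) u = a - b := hu
    rw [this, map_sub, sub_eq_self]
    simp
  have hdvd : (nsmulAddMonoidHom (α := A ⧸ B) p).range.index ∣ p ^ (n * (p - 1)) := by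
    refine (AddSubgroup.index_dvd_of_le hfp).trans ((f.index_range_pow_dvd _).trans ?_)
    rw [pow_mul]
    exact pow_dvd_pow_of_dvd hfB _
  have hrk : finrank ℤ (A ⧸ B) = n * (p - 1) := by
    have := B.finrank_quotient_add_finrank
    omega
  rw [AddSubgroup.index_range_nsmul_eq_pow_mul_card_ker hp.out.ne_zero, hrk] at hdvd
  have hone : Nat.card (nsmulAddMonoidHom (α := A ⧸ B) p).ker = 1 := by
    have hpos : 0 < p ^ (n * (p - 1)) := pow_pos hp.out.pos _
    exact Nat.dvd_one.1 (Nat.dvd_of_mul_dvd_mul_left hpos (by rwa [mul_one]))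
  have hsub := (Nat.card_eq_one_iff_unique.1 hone).1
  have hmem : B.mkQ w ∈ (nsmulAddMonoidHom (α := A ⧸ B) p).ker := by
    rw [AddMonoidHom.mem_ker, nsmulAddMonoidHom_apply, ← map_nsmul]
    rw [Submodule.mkQ_apply, Submodule.Quotient.mk_eq_zero, memB]
    exact hpw
  have := congrArg Subtype.val (hsub.elim ⟨B.mkQ w, hmem⟩ 0)
  have h0 : B.mkQ w = 0 := this
  rw [Submodule.mkQ_apply, Submodule.Quotient.mk_eq_zero, memB] at h0
  exact hw h0

end CyclicModule

section UnitRank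

open Module NumberField

section UnitsInCyclicExtension

variable {F E : Type*} [Field F] [NumberField F] [Field E] [NumberField E] [Algebra F E]

/-- The action of an automorphism on the unit group, written additively. -/
noncomputable def unitsEnd (σ : Gal(E/F)) : Module.End ℤ (Additive (𝓞 E)ˣ) :=
  (MonoidHom.toAdditive (Units.map
    (galRestrict (𝓞 F) F E (𝓞 E) σ : 𝓞 E →* 𝓞 E))).toIntLinearMap

theorem coe_unitsEnd (σ : Gal(E/F)) (u : Additive (𝓞 E)ˣ) :
    (((unitsEnd σ u).toMul : 𝓞 E) : E) = σ ((u.toMul : 𝓞 E) : E) :=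
  algebraMap_galRestrict_apply (𝓞 F) σ (u.toMul : 𝓞 E)

theorem coe_unitsEnd_pow (σ : Gal(E/F)) (i : ℕ) (u : Additive (𝓞 E)ˣ) :
    ((((unitsEnd σ ^ i) u).toMul : 𝓞 E) : E) = (σ ^ i) ((u.toMul : 𝓞 E) : E) := by
  induction i with
  | zero => simp
  | succ i ih => rw [pow_succ', Module.End.mul_apply, coe_unitsEnd, ih, pow_succ']; rfl

theorem additive_units_ext {E : Type*} [Field E] {u v : Additive (𝓞 E)ˣ}
    (h : ((u.toMul : 𝓞 E) : E) = ((v.toMul : 𝓞 E) : E)) : u = v :=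
  Additive.toMul.injective (Units.ext (RingOfIntegers.ext h))

theorem mem_range_algebraMap_of_fixed [IsGalois F E] {σ : Gal(E/F)}
    (hσ : ∀ τ, τ ∈ Subgroup.zpowers σ) {x : E} (hx : σ x = x) :
    x ∈ Set.range (algebraMap F E) := by
  have h : ∀ τ : Gal(E/F), τ x = x := by
    intro τ
    have : Subgroup.zpowers σ ≤ MulAction.stabilizer Gal(E/F) x := by
      rw [Subgroup.zpowers_le]
      exact hx
    exact this (hσ τ)
  exact (IsGalois.mem_range_algebraMap_iff_fixed x).2 h

theorem exists_unit_of_fixed [IsGalois F E] {σ : Gal(E/F)}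
    (hσ : ∀ τ, τ ∈ Subgroup.zpowers σ) {u : (𝓞 E)ˣ} (hu : σ ((u : 𝓞 E) : E) = ((u : 𝓞 E) : E)) :
    ∃ v : (𝓞 F)ˣ, algebraMap F E ((v : 𝓞 F) : F) = ((u : 𝓞 E) : E) := by
  have aux : ∀ u : (𝓞 E)ˣ, σ ((u : 𝓞 E) : E) = ((u : 𝓞 E) : E) →
      ∃ v : 𝓞 F, algebraMap F E (v : F) = ((u : 𝓞 E) : E) := by
    intro u hu
    obtain ⟨x, hx⟩ := mem_range_algebraMap_of_fixed hσ hu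
    have hinteg : IsIntegral ℤ x := by
      rw [← isIntegral_algebraMap_iff (algebraMap F E).injective, hx]
      exact (u : 𝓞 E).2
    exact ⟨⟨x, hinteg⟩, hx⟩
  obtain ⟨v, hv⟩ := aux u hu
  have hui : σ (((u⁻¹ : (𝓞 E)ˣ) : 𝓞 E) : E) = (((u⁻¹ : (𝓞 E)ˣ) : 𝓞 E) : E) := by
    have h1 : (((u⁻¹ : (𝓞 E)ˣ) : 𝓞 E) : E) = (((u : 𝓞 E) : E))⁻¹ := by
      apply eq_inv_of_mul_eq_one_left
      rw [← map_mul, Units.inv_mul, map_one]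
    rw [h1, map_inv₀, hu]
  obtain ⟨v', hv'⟩ := aux u⁻¹ hui
  have hvv : v * v' = 1 := by
    apply RingOfIntegers.ext
    apply (algebraMap F E).injective
    change algebraMap F E ((v : F) * (v' : F)) = algebraMap F E 1
    rw [map_mul, hv, hv', ← map_mul, Units.mul_inv, map_one, map_one]
  exact ⟨⟨v, v', hvv, by rw [mul_comm, hvv]⟩, hv⟩

theorem prod_gal_eq_prod_range {F E : Type*} [Field F] [Field E] [Algebra F E]
    {M : Type*} [CommMonoid M] [FiniteDimensional F E] {σ : Gal(E/F)}
    (hσ : ∀ τ, τ ∈ Subgroup.zpowers σ) (f : Gal(E/F) → M) :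
    ∏ τ : Gal(E/F), f τ = ∏ i ∈ Finset.range (orderOf σ), f (σ ^ i) := by
  classical
  rw [← IsCyclic.image_range_orderOf hσ, Finset.prod_image]
  intro a ha b hb h
  exact pow_injOn_Iio_orderOf (by simpa using ha) (by simpa using hb) h

theorem rank_units_add_one {K : Type*} [Field K] [NumberField K] {ζ : K} {p : ℕ} (hp : 2 < p)
    (hζ : IsPrimitiveRoot ζ p) : 2 * (Units.rank K + 1) = finrank ℚ K := by
  have h1 := NumberField.InfinitePlace.IsPrimitiveRoot.nrRealPlaces_eq_zero_of_two_lt hp hζ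
  have h2 := InfinitePlace.card_add_two_mul_card_eq_rank K
  have h3 := InfinitePlace.card_eq_nrRealPlaces_add_nrComplexPlaces K
  have h4 : 0 < finrank ℚ K := Module.finrank_pos
  have h5 : Units.rank K = Fintype.card (InfinitePlace K) - 1 := rfl
  omega

theorem exists_unit_norm_one_not_coboundary [IsGalois F E] {p : ℕ} [hp : Fact p.Prime] (hp2 : p ≠ 2)
    {ζ : F} (hζ : IsPrimitiveRoot ζ p) (hfr : finrank F E = p) {σ : Gal(E/F)}
    (hσ : ∀ τ, τ ∈ Subgroup.zpowers σ) (w : (𝓞 E)ˣ)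
    (hw : σ ((w : 𝓞 E) : E) ≠ ((w : 𝓞 E) : E))
    (hwp : σ (((w : 𝓞 E) : E) ^ p) = ((w : 𝓞 E) : E) ^ p) :
    ∃ η : (𝓞 E)ˣ, Algebra.norm F ((η : 𝓞 E) : E) = 1 ∧
      ∀ u : (𝓞 E)ˣ, ((η : 𝓞 E) : E) * σ ((u : 𝓞 E) : E) ≠ ((u : 𝓞 E) : E) := by
  have : NeZero p := ⟨hp.out.ne_zero⟩
  have hcard : Nat.card Gal(E/F) = p := by rw [IsGalois.card_aut_eq_finrank, hfr]
  have horder : orderOf σ = p := by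
    rw [orderOf_eq_card_of_forall_mem_zpowers hσ, hcard]
  set S := unitsEnd σ with hS
  have hSp : S ^ p = 1 := by
    refine LinearMap.ext fun u => additive_units_ext ?_
    rw [coe_unitsEnd_pow, ← horder, pow_orderOf_eq_one]
    rfl
  have hker : ∀ u : Additive (𝓞 E)ˣ, u ∈ LinearMap.ker (S - 1) ↔
      σ ((u.toMul : 𝓞 E) : E) = ((u.toMul : 𝓞 E) : E) := by
    intro u
    rw [LinearMap.mem_ker, LinearMap.sub_apply, sub_eq_zero, ← coe_unitsEnd]
    exact ⟨fun h => by rw [h]; rfl, fun h => additive_units_ext h⟩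
  let i : Additive (𝓞 F)ˣ →ₗ[ℤ] LinearMap.ker (S - 1) :=
    LinearMap.codRestrict _ (MonoidHom.toAdditive (Units.map
      (algebraMap (𝓞 F) (𝓞 E) : 𝓞 F →* 𝓞 E))).toIntLinearMap fun v => by
        rw [hker]
        exact σ.commutes ((v.toMul : 𝓞 F) : F)
  have hi : ∀ v : Additive (𝓞 F)ˣ, (((i v : Additive (𝓞 E)ˣ).toMul : 𝓞 E) : E) =
      algebraMap F E ((v.toMul : 𝓞 F) : F) := fun v => rfl
  have hibij : Function.Bijective i := by
    constructor
    · intro v v' h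
      have h1 := (hi v).symm.trans ((congrArg
        (fun t : LinearMap.ker (S - 1) => (((t : Additive (𝓞 E)ˣ).toMul : 𝓞 E) : E)) h).trans (hi v'))
      exact additive_units_ext ((algebraMap F E).injective h1)
    · rintro ⟨u, hu⟩
      obtain ⟨v, hv⟩ := exists_unit_of_fixed hσ ((hker u).1 hu)
      exact ⟨Additive.ofMul v, Subtype.ext (additive_units_ext hv)⟩
  let e : Additive (𝓞 F)ˣ ≃ₗ[ℤ] LinearMap.ker (S - 1) := LinearEquiv.ofBijective i hibij
  -- ranks
  have hp3 : 2 < p := lt_of_le_of_ne hp.out.two_le hp2.symm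
  have hrF := rank_units_add_one hp3 hζ
  have hrE := rank_units_add_one hp3 (hζ.map_of_injective (algebraMap F E).injective)
  rw [← finrank_mul_finrank ℚ F E, hfr, ← hrF] at hrE
  have hfrB : finrank ℤ (LinearMap.ker (S - 1)) = Units.rank F := by
    rw [← e.finrank_eq, Units.finrank_eq]
  have hcardB : Nat.card (nsmulAddMonoidHom (α := LinearMap.ker (S - 1)) p).ker = p := by
    refine Eq.trans ?_ (hζ.toInteger_isPrimitiveRoot).card_rootsOfUnity
    refine (Nat.card_congr ((Additive.ofMul.trans e.toEquiv).subtypeEquiv fun v => ?_)).symm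
    rw [mem_rootsOfUnity, AddMonoidHom.mem_ker, nsmulAddMonoidHom_apply]
    change v ^ p = 1 ↔ p • e (Additive.ofMul v) = 0
    rw [← map_nsmul, EmbeddingLike.map_eq_zero_iff]
    rfl
  have hSw : S (Additive.ofMul w) ≠ Additive.ofMul w := by
    intro h
    apply hw
    have := congrArg (fun t : Additive (𝓞 E)ˣ => ((t.toMul : 𝓞 E) : E)) h
    simpa [coe_unitsEnd, hS] using this
  obtain ⟨η, hη, hη'⟩ := exists_norm_eq_zero_not_mem_range p S hSp (Units.rank F + 1)
    (by rw [hfrB, hcardB, pow_succ]) (by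
      rw [hfrB, Units.finrank_eq]
      obtain ⟨q, rfl⟩ : ∃ q, p = q + 1 := ⟨p - 1, by omega⟩
      rw [Nat.add_sub_cancel]
      nlinarith) (Additive.ofMul w)
    hSw
    (additive_units_ext (by
      rw [coe_unitsEnd]
      simpa using hwp))
  refine ⟨(-η).toMul, ?_, fun u hu => hη' (Additive.ofMul u) ?_⟩
  · apply (algebraMap F E).injective
    rw [Algebra.norm_eq_prod_automorphisms, prod_gal_eq_prod_range hσ, horder, map_one]
    have h := congrArg (fun t : Additive (𝓞 E)ˣ => (((-t).toMul : 𝓞 E) : E)) hη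
    rw [← Finset.sum_neg_distrib] at h
    simp only [toMul_sum, Units.coe_prod, map_prod, neg_zero, toMul_zero, Units.val_one,
      map_one, ← map_neg, coe_unitsEnd_pow, hS] at h
    exact h
  · rw [sub_eq_iff_eq_add, ← neg_add_eq_iff_eq_add]
    apply additive_units_ext
    change (((-η).toMul : 𝓞 E) : E) * (((S (Additive.ofMul u)).toMul : 𝓞 E) : E) = _
    rw [hS, coe_unitsEnd]
    exact hu
end UnitsInCyclicExtension

end UnitRank

section UnramifiedExtension

open Module NumberField

section Invariant

open Polynomial in
/-- If `x - g • x` is a unit for every `g ≠ 1`, then every `G`-stable ideal is generated by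
invariant elements. -/
theorem Ideal.le_map_comap_of_smul_mem {A B G : Type*} [CommRing A] [CommRing B] [Algebra A B]
    [Group G] [Fintype G] [MulSemiringAction G B] [Algebra.IsInvariant A B G] (x : B)
    (hx : ∀ g : G, g ≠ 1 → IsUnit (x - g • x)) (J : Ideal B)
    (hJ : ∀ (g : G), ∀ y ∈ J, g • y ∈ J) :
    J ≤ (J.comap (algebraMap A B)).map (algebraMap A B) := by
  classical
  intro y hy
  choose! v hv using fun g hg => (hx g hg).exists_left_inv
  let P : B[X] := ∏ g ∈ Finset.univ.erase (1 : G), (C (v g) * (X - C (g • x)))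
  have hP1 : P.eval x = 1 := by
    rw [eval_prod]
    refine Finset.prod_eq_one fun g hg => ?_
    simpa using hv g (Finset.ne_of_mem_erase hg)
  have hP2 : ∀ g : G, g ≠ 1 → P.eval (g • x) = 0 := by
    intro g hg
    rw [eval_prod]
    exact Finset.prod_eq_zero (Finset.mem_erase.2 ⟨hg, Finset.mem_univ g⟩) (by simp)
  have key : y = ∑ k ∈ Finset.range (P.natDegree + 1), P.coeff k * ∑ g : G, g • (y * x ^ k) := by
    simp_rw [Finset.mul_sum]
    rw [Finset.sum_comm]
    have h : ∀ g : G, ∑ k ∈ Finset.range (P.natDegree + 1), P.coeff k * g • (y * x ^ k) =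
        g • y * P.eval (g • x) := by
      intro g
      rw [eval_eq_sum_range, Finset.mul_sum]
      refine Finset.sum_congr rfl fun k _ => ?_
      rw [smul_mul', smul_pow']
      ring
    simp_rw [h]
    rw [Finset.sum_eq_single (1 : G) (fun g _ hg => by rw [hP2 g hg, mul_zero]) (by simp)]
    rw [one_smul, one_smul, hP1, mul_one]
  rw [key]
  refine Ideal.sum_mem _ fun k _ => Ideal.mul_mem_left _ _ ?_
  obtain ⟨a, ha⟩ := Algebra.IsInvariant.isInvariant (A := A) (G := G) (∑ g : G, g • (y * x ^ k))
    (fun h => by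
      rw [Finset.smul_sum]
      simp_rw [smul_smul]
      exact Fintype.sum_equiv (Equiv.mulLeft h) _ _ fun _ => rfl)
  rw [← ha]
  refine Ideal.mem_map_of_mem _ (Ideal.mem_comap.2 ?_)
  rw [ha]
  exact Ideal.sum_mem _ fun g _ => hJ g _ (Ideal.mul_mem_right _ _ hy)

end Invariant


section Unramified

variable {F E : Type} [Field F] [NumberField F] [Field E] [NumberField E] [Algebra F E]

theorem false_of_unramified_kummer [IsGalois F E] {p : ℕ} [hp : Fact p.Prime] (hp2 : p ≠ 2)
    (hcl : ¬ p ∣ classNumber F)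
    {ζ : F} (hζ : IsPrimitiveRoot ζ p) (hfr : finrank F E = p) {σ : Gal(E/F)}
    (hσ : ∀ τ, τ ∈ Subgroup.zpowers σ) (w : (𝓞 E)ˣ)
    (hw : σ ((w : 𝓞 E) : E) ≠ ((w : 𝓞 E) : E))
    (hwp : σ (((w : 𝓞 E) : E) ^ p) = ((w : 𝓞 E) : E) ^ p)
    (x : 𝓞 E) (hx : ∀ τ : Gal(E/F), τ ≠ 1 → IsUnit (x - τ • x)) : False := by
  obtain ⟨η, hη1, hη2⟩ := exists_unit_norm_one_not_coboundary hp2 hζ hfr hσ w hw hwp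
  have : IsCyclic Gal(E/F) := ⟨σ, hσ⟩
  obtain ⟨α, hα0, hα⟩ := groupCohomology.exists_mul_galRestrict_of_norm_eq_one
    (A := 𝓞 F) (B := 𝓞 E) hσ hη1
  have hα' : ((η : 𝓞 E) : E) * σ (α : E) = (α : E) := by
    have := congrArg (algebraMap (𝓞 E) E) hα
    rwa [map_mul, algebraMap_galRestrict_apply] at this
  set J : Ideal (𝓞 E) := Ideal.span {α} with hJ
  have hσα : σ • α = ((η⁻¹ : (𝓞 E)ˣ) : 𝓞 E) * α := by
    rw [eq_comm, Units.inv_mul_eq_iff_eq_mul]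
    exact RingOfIntegers.ext hα'.symm
  have hσJ : ∀ y ∈ J, σ • y ∈ J := by
    intro y hy
    obtain ⟨c, rfl⟩ := Ideal.mem_span_singleton'.1 hy
    rw [smul_mul', hσα]
    exact Ideal.mem_span_singleton'.2 ⟨(σ • c) * ((η⁻¹ : (𝓞 E)ˣ) : 𝓞 E), by ring⟩
  have hGJ : ∀ (τ : Gal(E/F)), ∀ y ∈ J, τ • y ∈ J := by
    intro τ
    obtain ⟨n, rfl⟩ := (mem_powers_iff_mem_zpowers (x := σ)).2 (hσ τ)
    induction n with
    | zero => intro y hy; simpa using hy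
    | succ n ih =>
      intro y hy
      change σ ^ (n + 1) • y ∈ J
      rw [pow_succ, mul_smul]
      exact ih _ (hσJ y hy)
  have hJle := Ideal.le_map_comap_of_smul_mem (A := 𝓞 F) x hx J hGJ
  set I : Ideal (𝓞 F) := J.comap (algebraMap (𝓞 F) (𝓞 E)) with hI
  have hJI : I.map (algebraMap (𝓞 F) (𝓞 E)) = J := le_antisymm Ideal.map_comap_le hJle
  have hI0 : I ≠ ⊥ := by
    intro h
    rw [h, Ideal.map_bot] at hJI
    exact hα0 (Ideal.span_singleton_eq_bot.1 hJI.symm)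
  have hIp : (I ^ p).IsPrincipal := by
    have h1 := Ideal.relNorm_algebraMap (R := 𝓞 F) (𝓞 E) I
    rw [hJI, hJ, Ideal.relNorm_singleton] at h1
    exact ⟨_, by rw [← hfr, IsFractionRing.finrank_eq (𝓞 F) F (𝓞 E) E, ← h1]⟩
  obtain ⟨⟨a, ha⟩⟩ := Ideal.IsPrincipal.of_isPrincipal_pow_of_coprime
    ((Nat.Prime.coprime_iff_not_dvd hp.out).2 hcl) hIp
  rw [Ideal.submodule_span_eq] at ha
  rw [ha, Ideal.map_span, Set.image_singleton, hJ, Ideal.span_singleton_eq_span_singleton] at hJI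
  obtain ⟨u, hu⟩ := hJI
  apply hη2 u
  have ha0 : algebraMap (𝓞 F) (𝓞 E) a ≠ 0 := by
    intro h
    rw [h, zero_mul] at hu
    exact hα0 hu.symm
  have ha0' : algebraMap F E (a : F) ≠ 0 := fun h => ha0 (RingOfIntegers.ext h)
  have hu' : algebraMap F E (a : F) * ((u : 𝓞 E) : E) = (α : E) := by
    rw [← hu]; rfl
  rw [← hu', map_mul, σ.commutes] at hα'
  exact mul_left_cancel₀ ha0' (by linear_combination hα')

end Unramified

end UnramifiedExtension

section KummersLemma

open Module NumberField

section KummerLemma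

open Polynomial in
/-- If `l ^ (p - 1) ∣ p` and `w ^ p ≡ a ^ p` modulo `l ^ p`, then `(w - a) / l` is integral. -/
theorem isIntegral_div_of_pow_sub_pow {A E : Type*} [CommRing A] [Field E] [Algebra A E]
    {p : ℕ} (hp : p.Prime) {l a ε : A} (hl0 : algebraMap A E l ≠ 0)
    (hl : l ^ (p - 1) ∣ (p : A)) (hε : l ^ p ∣ a ^ p - ε) {w : E}
    (hw : w ^ p = algebraMap A E ε) :
    IsIntegral A ((w - algebraMap A E a) / algebraMap A E l) := by
  have hex : ∀ k : Fin p, ∃ e : A,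
      l ^ p * e = if (k : ℕ) = 0 then a ^ p - ε else l ^ (k : ℕ) * a ^ (p - k) * (p.choose k) := by
    intro k
    split_ifs with hk
    · obtain ⟨e, he⟩ := hε
      exact ⟨e, he.symm⟩
    · have h1 : (p : A) ∣ (p.choose k : A) :=
        Nat.cast_dvd_cast (hp.dvd_choose_self hk k.2)
      have h2 : l ^ p ∣ l ^ (k : ℕ) * (p.choose k : A) := by
        calc l ^ p ∣ l ^ (k : ℕ) * l ^ (p - 1) := by
              rw [← pow_add]; exact pow_dvd_pow _ (by omega)
          _ ∣ _ := mul_dvd_mul_left _ (hl.trans h1)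
      obtain ⟨e, he⟩ := h2
      exact ⟨e * a ^ (p - k), by linear_combination (-(a ^ (p - (k : ℕ)))) * he⟩
  choose e he using hex
  set x := (w - algebraMap A E a) / algebraMap A E l with hx
  have hxw : algebraMap A E l * x + algebraMap A E a = w := by
    rw [hx]; field_simp; ring
  refine ⟨X ^ p + ∑ k : Fin p, C (e k) * X ^ (k : ℕ), monic_X_pow_add (degree_sum_fin_lt e), ?_⟩
  have hlp : algebraMap A E l ^ p ≠ 0 := pow_ne_zero _ hl0
  apply mul_left_cancel₀ hlp
  rw [mul_zero, eval₂_add, eval₂_X_pow, eval₂_finsetSum, mul_add, Finset.mul_sum]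
  simp only [eval₂_mul, eval₂_C, eval₂_X_pow]
  have h1 : ∀ k : Fin p, algebraMap A E l ^ p * (algebraMap A E (e k) * x ^ (k : ℕ)) =
      (fun k : ℕ => (algebraMap A E l * x) ^ k * algebraMap A E a ^ (p - k) * (p.choose k : E) -
        if k = 0 then algebraMap A E ε else 0) (k : ℕ) := by
    intro k
    have := congrArg (algebraMap A E) (he k)
    rw [map_mul, map_pow] at this
    rw [← mul_assoc, this]
    dsimp only
    split_ifs with hk
    · simp [hk]
    · simp [mul_pow]; ring
  rw [Finset.sum_congr rfl fun k _ => h1 k, Fin.sum_univ_eq_sum_range (fun k : ℕ =>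
    (algebraMap A E l * x) ^ k * algebraMap A E a ^ (p - k) * (p.choose k : E) -
        if k = 0 then algebraMap A E ε else 0), Finset.sum_sub_distrib]
  have h2 := add_pow (algebraMap A E l * x) (algebraMap A E a) p
  rw [hxw, hw, Finset.sum_range_succ] at h2
  have h3 : ∑ k ∈ Finset.range p, (if k = 0 then algebraMap A E ε else 0) = algebraMap A E ε := by
    rw [Finset.sum_ite_eq' (Finset.range p) 0 (fun _ => algebraMap A E ε),
      if_pos (Finset.mem_range.2 hp.pos)]
  rw [h3]
  simp only [Nat.sub_self, pow_zero, Nat.choose_self, Nat.cast_one, mul_one, mul_pow] at h2 ⊢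
  linear_combination -h2

open Polynomial in
/-- Kummer's lemma on `p`-th powers. -/
theorem exists_pow_eq_of_unit_congr {L : Type} [Field L] [NumberField L] {p : ℕ}
    [hp : Fact p.Prime] (hp2 : p ≠ 2) (hcl : ¬ p ∣ classNumber L) {ζ : L}
    (hζ : IsPrimitiveRoot ζ p) (ε : (𝓞 L)ˣ) (a : 𝓞 L)
    (h : (hζ.toInteger - 1) ^ p ∣ a ^ p - (ε : 𝓞 L)) : ∃ b : L, b ^ p = ((ε : 𝓞 L) : L) := by
  by_contra! hne
  have H : Irreducible (X ^ p - C ((ε : 𝓞 L) : L)) := X_pow_sub_C_irreducible_of_prime hp.out hne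
  have hprim : (primitiveRoots p L).Nonempty := ⟨ζ, (mem_primitiveRoots hp.out.pos).2 hζ⟩
  let E := (X ^ p - C ((ε : 𝓞 L) : L)).SplittingField
  have : NumberField E := NumberField.of_module_finite L E
  have : NeZero p := ⟨hp.out.ne_zero⟩
  have : IsGalois L E := isGalois_of_isSplittingField_X_pow_sub_C hprim H E
  have hfr : finrank L E = p := finrank_of_isSplittingField_X_pow_sub_C hprim H E
  obtain ⟨σ, hσ⟩ := isCyclic_of_isSplittingField_X_pow_sub_C hprim H E
  obtain ⟨w, hw⟩ : ∃ w : E, w ^ p = algebraMap L E ((ε : 𝓞 L) : L) :=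
    ⟨_, rootOfSplitsXPowSubC_pow _ E⟩
  have hw' : w ^ p = algebraMap (𝓞 L) E (ε : 𝓞 L) := hw
  have hwint : IsIntegral ℤ w := by
    refine IsIntegral.of_pow hp.out.pos ?_
    rw [hw]
    exact (RingOfIntegers.isIntegral_coe (ε : 𝓞 L)).map (algebraMap L E |>.toIntAlgHom)
  let wi : 𝓞 E := ⟨w, hwint⟩
  have hwi : IsUnit wi := by
    rw [← isUnit_pow_iff hp.out.ne_zero]
    have : wi ^ p = algebraMap (𝓞 L) (𝓞 E) ε := RingOfIntegers.ext hw
    rw [this]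
    exact ε.isUnit.map _
  obtain ⟨wu, hwu⟩ := hwi
  have hwuw : ((wu : 𝓞 E) : E) = w := by rw [hwu]; rfl
  have hw0 : w ≠ 0 := by
    rw [← hwuw]
    exact RingOfIntegers.coe_ne_zero_iff.2 wu.ne_zero
  -- the action on `w`
  have hact : ∀ τ : Gal(E/L), τ ≠ 1 → ∃ j : ℕ, j.Coprime p ∧ τ w = algebraMap L E (ζ ^ j) * w := by
    intro τ hτ
    have h1 := autEquivRootsOfUnity_smul hprim H E hw τ
    set r := autEquivRootsOfUnity hprim H E τ with hr
    have hr1 : r ≠ 1 := by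
      rw [hr]
      exact fun h => hτ ((EmbeddingLike.map_eq_one_iff).1 h)
    have hrp : ((r : Lˣ) : L) ^ p = 1 := by
      have := r.2
      rw [mem_rootsOfUnity] at this
      rw [← Units.val_pow_eq_pow_val, this, Units.val_one]
    obtain ⟨j, hj, hj'⟩ := hζ.eq_pow_of_pow_eq_one hrp
    refine ⟨j, ?_, ?_⟩
    · rw [Nat.coprime_comm, Nat.Prime.coprime_iff_not_dvd hp.out]
      intro hd
      have : j = 0 := Nat.eq_zero_of_dvd_of_lt hd hj
      rw [this, pow_zero] at hj'
      exact hr1 (Subtype.ext (Units.ext hj'.symm))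
    · rw [← h1, hj']
      exact Algebra.smul_def ((r : Lˣ) : L) w
  have hl0 : algebraMap (𝓞 L) E (hζ.toInteger - 1) ≠ 0 := by
    intro h0
    have h1 : hζ.toInteger - 1 = 0 := by
      apply FaithfulSMul.algebraMap_injective (𝓞 L) E
      rw [h0, map_zero]
    have h2 := congrArg (algebraMap (𝓞 L) L) (sub_eq_zero.1 h1)
    exact hζ.ne_one hp.out.one_lt (h2.trans (map_one _))
  have hxint := isIntegral_div_of_pow_sub_pow hp.out hl0
    (IsCyclotomicExtension.Rat.associated_zeta_sub_one_pow_prime p hζ).dvd h hw'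
  set x0 := (w - algebraMap (𝓞 L) E a) / algebraMap (𝓞 L) E (hζ.toInteger - 1) with hx0
  let x : 𝓞 E := ⟨x0, isIntegral_trans x0 hxint⟩
  have hσ1 : σ ≠ 1 := by
    rintro rfl
    have h1 : Nat.card Gal(E/L) = p := by rw [IsGalois.card_aut_eq_finrank, hfr]
    have h2 := orderOf_eq_card_of_forall_mem_zpowers hσ
    rw [h1, orderOf_one] at h2
    exact hp.out.ne_one h2.symm
  refine false_of_unramified_kummer hp2 hcl hζ hfr hσ wu ?_ ?_ x fun τ hτ => ?_
  · rw [hwuw]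
    obtain ⟨j, hj, hj'⟩ := hact σ hσ1
    rw [hj']
    intro h1
    have h2 := mul_right_cancel₀ hw0 (h1.trans (one_mul w).symm)
    rw [← map_one (algebraMap L E)] at h2
    have h3 := (hζ.pow_eq_one_iff_dvd j).1 ((algebraMap L E).injective h2)
    exact (Nat.Prime.coprime_iff_not_dvd hp.out).1 hj.symm h3
  · rw [hwuw, hw, σ.commutes]
  · obtain ⟨j, hj, hj'⟩ := hact τ hτ
    obtain ⟨v, hv⟩ := hζ.toInteger_isPrimitiveRoot.associated_sub_one_pow_sub_one_of_coprime hj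
    have : x - τ • x = -(wi * algebraMap (𝓞 L) (𝓞 E) v) := by
      apply RingOfIntegers.ext
      change x0 - τ x0 = -(w * algebraMap (𝓞 L) E v)
      have h3 : algebraMap L E (ζ ^ j) = algebraMap (𝓞 L) E (hζ.toInteger ^ j) := rfl
      have h4 : ∀ b : 𝓞 L, τ (algebraMap (𝓞 L) E b) = algebraMap (𝓞 L) E b :=
        fun b => τ.commutes (b : L)
      have h5 := congrArg (algebraMap (𝓞 L) E) hv
      rw [map_mul, map_sub _ (_ ^ _)] at h5
      rw [hx0, map_div₀, map_sub τ, h4, h4, hj', h3]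
      rw [← sub_div, div_eq_iff hl0]
      rw [map_one] at h5
      linear_combination w * h5
    rw [this, IsUnit.neg_iff]
    exact IsUnit.mul (hwu ▸ wu.isUnit) (v.isUnit.map _)

end KummerLemma

end KummersLemma

section Order

open IsDedekindDomain WithZero

namespace IsDedekindDomain.HeightOneSpectrum

variable {R K : Type*} [CommRing R] [IsDedekindDomain R] [Field K] [Algebra R K]
  [IsFractionRing R K] (v : HeightOneSpectrum R)

/-- The additive order of an element of the fraction field at a height one prime,
with junk value `0` at `0`. -/
noncomputable def ord (x : K) : ℤ := -log (v.valuation K x)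

/-- The element `x` vanishes to order at least `n` at `v`. -/
def LeOrd (n : ℤ) (x : K) : Prop := v.valuation K x ≤ exp (-n)

theorem valuation_eq_exp_neg_ord {x : K} (hx : x ≠ 0) : v.valuation K x = exp (-v.ord x) := by
  rw [ord, neg_neg, exp_log ((Valuation.ne_zero_iff _).2 hx)]

theorem leOrd_iff {n : ℤ} {x : K} (hx : x ≠ 0) : v.LeOrd n x ↔ n ≤ v.ord x := by
  rw [LeOrd, valuation_eq_exp_neg_ord v hx, exp_le_exp, neg_le_neg_iff]

theorem leOrd_zero (n : ℤ) : v.LeOrd n (0 : K) := by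
  rw [LeOrd, map_zero]
  exact zero_le

theorem leOrd_ord (x : K) : v.LeOrd (v.ord x) x := by
  rcases eq_or_ne x 0 with rfl | hx
  · exact v.leOrd_zero _
  · exact (v.leOrd_iff hx).2 le_rfl

theorem ord_one : v.ord (1 : K) = 0 := by simp [ord]

theorem ord_neg (x : K) : v.ord (-x) = v.ord x := by simp [ord, Valuation.map_neg]

theorem ord_mul {x y : K} (hx : x ≠ 0) (hy : y ≠ 0) : v.ord (x * y) = v.ord x + v.ord y := by
  rw [ord, map_mul, log_mul ((Valuation.ne_zero_iff _).2 hx) ((Valuation.ne_zero_iff _).2 hy),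
    ord, ord, neg_add]

theorem ord_pow (x : K) (n : ℕ) : v.ord (x ^ n) = n * v.ord x := by
  rw [ord, map_pow, log_pow, ord, nsmul_eq_mul, mul_neg]

theorem ord_inv (x : K) : v.ord x⁻¹ = -v.ord x := by
  rw [ord, map_inv₀, log_inv, ord]

theorem ord_zpow (x : K) (n : ℤ) : v.ord (x ^ n) = n * v.ord x := by
  rw [ord, map_zpow₀, log_zpow, ord, smul_eq_mul, mul_neg]

theorem ord_div {x y : K} (hx : x ≠ 0) (hy : y ≠ 0) : v.ord (x / y) = v.ord x - v.ord y := by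
  rw [div_eq_mul_inv, ord_mul v hx (inv_ne_zero hy), ord_inv, sub_eq_add_neg]

theorem ord_prod {ι : Type*} (s : Finset ι) (f : ι → K) (h : ∀ i ∈ s, f i ≠ 0) :
    v.ord (∏ i ∈ s, f i) = ∑ i ∈ s, v.ord (f i) := by
  classical
  induction s using Finset.induction_on with
  | empty => simpa using v.ord_one
  | insert a s ha ih =>
    rw [Finset.prod_insert ha, Finset.sum_insert ha, ord_mul v (h a (Finset.mem_insert_self a s))
      (Finset.prod_ne_zero_iff.2 fun i hi => h i (Finset.mem_insert_of_mem hi)),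
      ih fun i hi => h i (Finset.mem_insert_of_mem hi)]

variable {v}

theorem LeOrd.mono {m n : ℤ} {x : K} (h : v.LeOrd n x) (hmn : m ≤ n) : v.LeOrd m x :=
  le_trans h (exp_le_exp.2 (neg_le_neg hmn))

theorem LeOrd.add {n : ℤ} {x y : K} (hx : v.LeOrd n x) (hy : v.LeOrd n y) : v.LeOrd n (x + y) :=
  (Valuation.map_add _ _ _).trans (max_le hx hy)

theorem LeOrd.neg {n : ℤ} {x : K} (hx : v.LeOrd n x) : v.LeOrd n (-x) := by
  rwa [LeOrd, Valuation.map_neg]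

theorem LeOrd.sub {n : ℤ} {x y : K} (hx : v.LeOrd n x) (hy : v.LeOrd n y) : v.LeOrd n (x - y) :=
  sub_eq_add_neg x y ▸ hx.add hy.neg

theorem LeOrd.sum {ι : Type*} {s : Finset ι} {f : ι → K} {n : ℤ} (h : ∀ i ∈ s, v.LeOrd n (f i)) :
    v.LeOrd n (∑ i ∈ s, f i) :=
  Finset.sum_induction f (v.LeOrd n) (fun _ _ => LeOrd.add) (v.leOrd_zero n) h

theorem LeOrd.mul {m n : ℤ} {x y : K} (hx : v.LeOrd m x) (hy : v.LeOrd n y) :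
    v.LeOrd (m + n) (x * y) := by
  rw [LeOrd, map_mul, neg_add, exp_add]
  exact mul_le_mul' hx hy

theorem LeOrd.pow {m : ℤ} {x : K} (hx : v.LeOrd m x) (n : ℕ) : v.LeOrd (n * m) (x ^ n) := by
  rw [LeOrd, map_pow, ← mul_neg, ← nsmul_eq_mul, exp_nsmul]
  exact pow_le_pow_left' hx n

theorem leOrd_of_le_ord {n : ℤ} {x : K} (h : n ≤ v.ord x) : v.LeOrd n x :=
  (v.leOrd_ord x).mono h

theorem ne_zero_of_not_leOrd {n : ℤ} {x : K} (h : ¬ v.LeOrd n x) : x ≠ 0 := by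
  rintro rfl
  exact h (v.leOrd_zero n)

theorem ord_eq_of_leOrd_of_not {n : ℤ} {x : K} (h : v.LeOrd n x) (h' : ¬ v.LeOrd (n + 1) x) :
    v.ord x = n := by
  have hx := ne_zero_of_not_leOrd h'
  rw [leOrd_iff v hx] at h h'
  omega

theorem not_leOrd_of_ord_lt {n : ℤ} {x : K} (hx : x ≠ 0) (h : v.ord x < n) : ¬ v.LeOrd n x := by
  rw [leOrd_iff v hx]
  omega

theorem not_leOrd_add {n : ℤ} {x y : K} (hx : ¬ v.LeOrd n x) (hy : v.LeOrd n y) :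
    ¬ v.LeOrd n (x + y) := fun h => hx (by simpa using h.sub hy)

theorem ord_add_eq_of_leOrd {x y : K} (hx : x ≠ 0) (hy : v.LeOrd (v.ord x + 1) y) :
    v.ord (x + y) = v.ord x :=
  ord_eq_of_leOrd_of_not ((v.leOrd_ord x).add (hy.mono (by omega)))
    (not_leOrd_add (not_leOrd_of_ord_lt hx (by omega)) hy)

variable (v)

theorem leOrd_algebraMap (r : R) : v.LeOrd 0 (algebraMap R K r) := by
  rw [LeOrd, neg_zero, exp_zero]
  exact v.valuation_le_one r

theorem ord_algebraMap_unit (u : Rˣ) : v.ord (algebraMap R K u) = 0 := by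
  have hu : (algebraMap R K u) ≠ 0 := (u.isUnit.map (algebraMap R K)).ne_zero
  have h1 := (v.leOrd_iff hu).1 (v.leOrd_algebraMap (u : R))
  have hu' : (algebraMap R K (u⁻¹ : Rˣ)) ≠ 0 := ((u⁻¹).isUnit.map (algebraMap R K)).ne_zero
  have h2 := (v.leOrd_iff hu').1 (v.leOrd_algebraMap ((u⁻¹ : Rˣ) : R))
  have h3 : v.ord ((algebraMap R K u) * (algebraMap R K (u⁻¹ : Rˣ))) = 0 := by
    rw [← map_mul, Units.mul_inv, map_one, ord_one]
  rw [ord_mul v hu hu'] at h3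
  omega

variable (K) in
theorem exists_ord_eq_one : ∃ x : K, x ≠ 0 ∧ v.ord x = 1 := by
  obtain ⟨π, hπ⟩ := v.valuation_exists_uniformizer K
  have h0 : π ≠ 0 := by
    rintro rfl
    rw [map_zero] at hπ
    exact exp_ne_zero hπ.symm
  refine ⟨π, h0, ?_⟩
  rw [ord, hπ, log_exp, neg_neg]

theorem exists_algebraMap_eq_of_leOrd {x : K} (h : ∀ v : HeightOneSpectrum R, v.LeOrd 0 x) :
    ∃ r : R, algebraMap R K r = x := by
  refine mem_integers_of_valuation_le_one K x fun v => ?_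
  have := h v
  rwa [LeOrd, neg_zero, exp_zero] at this

theorem exists_unit_eq_of_ord_eq_zero {x : K} (hx : x ≠ 0)
    (h : ∀ v : HeightOneSpectrum R, v.ord x = 0) : ∃ u : Rˣ, algebraMap R K u = x := by
  obtain ⟨r, hr⟩ := exists_algebraMap_eq_of_leOrd (R := R) (x := x) fun v => leOrd_of_le_ord (h v).ge
  obtain ⟨s, hs⟩ := exists_algebraMap_eq_of_leOrd (R := R) (x := x⁻¹) fun v =>
    leOrd_of_le_ord (by rw [ord_inv, h v, neg_zero])
  have hrs : r * s = 1 := by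
    apply IsFractionRing.injective R K
    rw [map_mul, hr, hs, map_one, mul_inv_cancel₀ hx]
  exact ⟨⟨r, s, hrs, by rw [mul_comm, hrs]⟩, hr⟩

theorem ord_algebraMap_eq_count {r : R} (hr : r ≠ 0) : v.ord (algebraMap R K r) =
    (Associates.mk v.asIdeal).count (Associates.mk (Ideal.span {r})).factors := by
  rw [ord, valuation_of_algebraMap, intValuation_if_neg v hr, log_exp, neg_neg]

theorem finite_ord_ne_zero {x : K} (hx : x ≠ 0) : {v : HeightOneSpectrum R | v.ord x ≠ 0}.Finite := by
  obtain ⟨a, b, hb, rfl⟩ := IsFractionRing.div_surjective (A := R) x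
  have hb0 : b ≠ 0 := nonZeroDivisors.ne_zero hb
  have ha0 : a ≠ 0 := by
    rintro rfl
    simp at hx
  have inj := IsFractionRing.injective R K
  have fin : ∀ r : R, r ≠ 0 → {v : HeightOneSpectrum R | v.ord (algebraMap R K r) ≠ 0}.Finite := by
    intro r hr
    have := Associates.finite_factors (I := Ideal.span {r}) (by simpa using hr)
    rw [Filter.eventually_cofinite] at this
    refine this.subset fun v hv => ?_
    simpa [ord_algebraMap_eq_count v hr] using hv
  refine ((fin a ha0).union (fin b hb0)).subset fun v hv => ?_
  by_contra hc
  simp only [Set.mem_union, Set.mem_ofPred_eq, not_or, not_not] at hc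
  apply hv
  rw [ord_div v (by simpa using ha0) (by simpa using hb0), hc.1, hc.2, sub_zero]

theorem exists_unit_mul_pow {R K : Type*} [CommRing R] [IsDedekindDomain R] [Field K] [Algebra R K]
    [IsFractionRing R K] [Fintype (ClassGroup R)] {p : ℕ} (hp0 : p ≠ 0)
    (hp : p.Coprime (Fintype.card (ClassGroup R))) {t : K} (ht : t ≠ 0)
    (h : ∀ v : HeightOneSpectrum R, (p : ℤ) ∣ v.ord t) :
    ∃ (u : Rˣ) (s : K), s ≠ 0 ∧ t = algebraMap R K u * s ^ p := by
  obtain ⟨a, b, hb, rfl⟩ := IsFractionRing.div_surjective (A := R) t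
  have hb0 : b ≠ 0 := nonZeroDivisors.ne_zero hb
  have ha0 : a ≠ 0 := by
    rintro rfl
    simp at ht
  have ha0' : algebraMap R K a ≠ 0 := by simpa using ha0
  have hb0' : algebraMap R K b ≠ 0 := by simpa using hb0
  obtain ⟨q, rfl⟩ : ∃ q, p = q + 1 := ⟨p - 1, by omega⟩
  set r : R := a * b ^ q with hr
  have hr0 : r ≠ 0 := mul_ne_zero ha0 (pow_ne_zero _ hb0)
  have hrt : algebraMap R K r = algebraMap R K a / algebraMap R K b * algebraMap R K b ^ (q + 1) := by
    rw [hr, map_mul, map_pow, pow_succ]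
    field_simp
  have hdvd : ∀ v : HeightOneSpectrum R, (q + 1) ∣
      (Associates.mk v.asIdeal).count (Associates.mk (Ideal.span {r})).factors := by
    intro v
    rw [← Int.natCast_dvd_natCast, ← ord_algebraMap_eq_count (K := K) v hr0, hrt,
      ord_mul v ht (pow_ne_zero _ hb0'), ord_pow]
    exact dvd_add (h v) (dvd_mul_right _ _)
  have hI0 : Ideal.span {r} ≠ 0 := by simpa using hr0
  have hfin := Associates.finite_factors hI0
  rw [Filter.eventually_cofinite] at hfin
  obtain ⟨J, hJ⟩ : ∃ J : Ideal R, J ^ (q + 1) = Ideal.span {r} := by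
    refine ⟨∏ᶠ v : HeightOneSpectrum R, v.asIdeal ^
      ((Associates.mk v.asIdeal).count (Associates.mk (Ideal.span {r})).factors / (q + 1)), ?_⟩
    refine Eq.trans ?_ (Ideal.finprod_heightOneSpectrum_factorization hI0)
    rw [finprod_pow]
    · refine finprod_congr fun v => ?_
      rw [← pow_mul, Nat.div_mul_cancel (hdvd v)]
      rfl
    · refine hfin.subset fun v hv hc => hv ?_
      have hc' : (Associates.mk v.asIdeal).count (Associates.mk (Ideal.span {r})).factors = 0 := by
        exact_mod_cast hc
      simp only [hc', Nat.zero_div, pow_zero]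
  have hJp : J.IsPrincipal := Ideal.IsPrincipal.of_isPrincipal_pow_of_coprime hp
    (hJ ▸ ⟨r, rfl⟩)
  obtain ⟨c, rfl⟩ := hJp
  rw [Ideal.submodule_span_eq, Ideal.span_singleton_pow,
    Ideal.span_singleton_eq_span_singleton] at hJ
  obtain ⟨u, hu⟩ := hJ
  have hc0 : c ≠ 0 := by
    rintro rfl
    rw [zero_pow (by omega), zero_mul] at hu
    exact hr0 hu.symm
  refine ⟨u, algebraMap R K c / algebraMap R K b, div_ne_zero (by simpa using hc0) hb0', ?_⟩
  have := congrArg (algebraMap R K) hu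
  rw [hrt, map_mul, map_pow] at this
  rw [div_pow, mul_div_assoc', eq_div_iff (pow_ne_zero _ hb0'), ← this, mul_comm]

end IsDedekindDomain.HeightOneSpectrum

end Order

section OrderLemmas

open Module NumberField IsDedekindDomain HeightOneSpectrum IntermediateField

section Local

variable {L : Type} [Field L] [NumberField L] (v : HeightOneSpectrum (𝓞 L))

/-- The order at `v` of a polynomial expression of degree `< n` in `π`, with coefficients whose
orders are multiples of `n * ord π`, is the minimum of the orders of its terms. -/
theorem exists_ord_sum_eq {k : Subfield L} {π : L} (hπ : 0 < v.ord π) {n : ℕ}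
    (hk : ∀ x ∈ k, x ≠ 0 → (n * v.ord π) ∣ v.ord x) {f : ℕ → L} (hf : ∀ i, f i ∈ k)
    (hx : ∑ i ∈ Finset.range n, f i * π ^ i ≠ 0) :
    ∃ j < n, f j ≠ 0 ∧ v.ord (∑ i ∈ Finset.range n, f i * π ^ i) = v.ord (f j) + j * v.ord π ∧
      ∀ i < n, f i ≠ 0 → v.ord (f j) + j * v.ord π ≤ v.ord (f i) + i * v.ord π := by
  classical
  have hπ0 : π ≠ 0 := by
    rintro rfl
    simp [ord] at hπ
  set s := (Finset.range n).filter fun i => f i ≠ 0 with hs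
  have hsne : s.Nonempty := by
    by_contra hc
    rw [Finset.not_nonempty_iff_eq_empty] at hc
    apply hx
    refine Finset.sum_eq_zero fun i hi => ?_
    have : i ∉ s := by simp [hc]
    rw [hs, Finset.mem_filter] at this
    have : f i = 0 := by
      by_contra h
      exact this ⟨hi, h⟩
    rw [this, zero_mul]
  obtain ⟨j, hjs, hj⟩ := s.exists_min_image (fun i => v.ord (f i) + i * v.ord π) hsne
  have hjs' := hjs
  rw [hs, Finset.mem_filter, Finset.mem_range] at hjs'
  have hord : ∀ i, f i ≠ 0 → v.ord (f i * π ^ i) = v.ord (f i) + i * v.ord π := by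
    intro i hi
    rw [ord_mul v hi (pow_ne_zero _ hπ0), ord_pow]
  have hmin : ∀ i < n, f i ≠ 0 → v.ord (f j) + j * v.ord π ≤ v.ord (f i) + i * v.ord π :=
    fun i hi hi0 => hj i (by rw [hs, Finset.mem_filter, Finset.mem_range]; exact ⟨hi, hi0⟩)
  refine ⟨j, hjs'.1, hjs'.2, ?_, hmin⟩
  rw [← Finset.add_sum_erase _ _ (Finset.mem_range.2 hjs'.1), ← hord j hjs'.2]
  refine ord_add_eq_of_leOrd (mul_ne_zero hjs'.2 (pow_ne_zero _ hπ0)) (LeOrd.sum fun i hi => ?_)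
  rw [Finset.mem_erase, Finset.mem_range] at hi
  by_cases hi0 : f i = 0
  · rw [hi0, zero_mul]
    exact v.leOrd_zero _
  rw [leOrd_iff v (mul_ne_zero hi0 (pow_ne_zero _ hπ0)), hord i hi0, hord j hjs'.2]
  refine lt_of_le_of_ne (hmin i hi.2 hi0) fun he => hi.1 ?_
  obtain ⟨c, hc⟩ := hk _ (hf i) hi0
  obtain ⟨e, he'⟩ := hk _ (hf j) hjs'.2
  rw [hc, he'] at he
  have h1 : (n : ℤ) * (e - c) = i - j := by
    apply mul_right_cancel₀ hπ.ne'
    linear_combination he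
  have h2 : e - c = 0 := by
    rcases lt_trichotomy (e - c) 0 with h | h | h
    · have : (n : ℤ) * (e - c) ≤ -n := by nlinarith
      omega
    · exact h
    · have : (n : ℤ) ≤ (n : ℤ) * (e - c) := by nlinarith
      omega
  rw [h2] at h1
  omega

/-- The order of an integer at a prime above `p`. -/
theorem ord_prime_dvd_ord_intCast {p : ℕ} (hp : p.Prime) (hv : v.LeOrd 1 (p : L)) {m : ℤ}
    (hm : m ≠ 0) : v.ord (p : L) ∣ v.ord (m : L) := by
  obtain ⟨m', hmm', hm'⟩ := (Int.finiteMultiplicity_iff (a := p) (b := m)).2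
    ⟨by simpa using hp.ne_one, hm⟩ |>.exists_eq_pow_mul_and_not_dvd
  have hm'0 : m' ≠ 0 := by
    rintro rfl
    simp at hm'
  rw [hmm']
  have hcop : IsCoprime (p : ℤ) m' :=
    (Nat.prime_iff_prime_int.1 hp).coprime_iff_not_dvd.2 hm'
  have hinteg : ∀ z : ℤ, v.LeOrd 0 (z : L) := fun z => by
    simpa using v.leOrd_algebraMap (K := L) (z : 𝓞 L)
  have h0 : v.ord (m' : L) = 0 := by
    refine ord_eq_of_leOrd_of_not (hinteg m') fun hc => ?_
    obtain ⟨a, b, hab⟩ := hcop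
    have h1 : v.LeOrd (0 + 1) ((a : L) * (p : L) + (b : L) * (m' : L)) :=
      ((hinteg a).mul hv).add ((hinteg b).mul (by simpa using hc))
    have h2 : ((a : L) * (p : L) + (b : L) * (m' : L)) = 1 := by
      exact_mod_cast congrArg (Int.cast : ℤ → L) hab
    rw [h2, leOrd_iff v one_ne_zero, ord_one] at h1
    omega
  push_cast
  rw [ord_mul v (pow_ne_zero _ (by exact_mod_cast hp.ne_zero)) (by exact_mod_cast hm'0), h0,
    ord_pow, add_zero]
  exact dvd_mul_left _ _

theorem exists_rat_of_mem_adjoin_sqrt {K : Type} [Field K] [CharZero K] {d : ℤ} {s : K}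
    (hs : s ^ 2 = (d : K)) {x : K} (hx : x ∈ ℚ⟮s⟯) : ∃ a b : ℚ, x = (a : K) + (b : K) * s := by
  have hinteg : IsIntegral ℚ s := by
    refine IsIntegral.of_pow two_pos ?_
    rw [hs, ← map_intCast (algebraMap ℚ K)]
    exact isIntegral_algebraMap
  rw [← mem_toSubalgebra, adjoin_simple_toSubalgebra_of_isAlgebraic hinteg.isAlgebraic] at hx
  induction hx using Algebra.adjoin_induction with
  | mem y hy => exact ⟨0, 1, by rw [Set.mem_singleton_iff.1 hy]; simp⟩
  | algebraMap r => exact ⟨r, 0, by simp⟩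
  | add y z _ _ hy hz =>
    obtain ⟨a, b, rfl⟩ := hy
    obtain ⟨a', b', rfl⟩ := hz
    exact ⟨a + a', b + b', by push_cast; ring⟩
  | mul y z _ _ hy hz =>
    obtain ⟨a, b, rfl⟩ := hy
    obtain ⟨a', b', rfl⟩ := hz
    exact ⟨a * a' + b * b' * d, a * b' + b * a', by push_cast; linear_combination (b * b' : K) * hs⟩

/-- A prime `p` not dividing `2 d` is unramified in `ℚ(√d)`. -/
theorem ord_prime_dvd_ord_of_mem_adjoin_sqrt {d : ℤ} {s : L} (hs : s ^ 2 = (d : L)) {p : ℕ}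
    (hp : p.Prime) (hp2 : p ≠ 2) (hpd : ¬ (p : ℤ) ∣ d) (hv : v.LeOrd 1 (p : L)) {x : L}
    (hx : x ∈ ℚ⟮s⟯) (hx0 : x ≠ 0) : v.ord (p : L) ∣ v.ord x := by
  obtain ⟨a, b, rfl⟩ := exists_rat_of_mem_adjoin_sqrt hs hx
  have hinteg : ∀ z : ℤ, v.LeOrd 0 (z : L) := fun z => by
    simpa using v.leOrd_algebraMap (K := L) (z : 𝓞 L)
  have hs0 : v.LeOrd 0 s := by
    have : IsIntegral ℤ s := IsIntegral.of_pow two_pos (hs ▸ isIntegral_algebraMap (x := d))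
    exact v.leOrd_algebraMap (⟨s, this⟩ : 𝓞 L)
  -- clear denominators
  obtain ⟨N, A, B, hN, hNx⟩ : ∃ N A B : ℤ, N ≠ 0 ∧ (N : L) * (a + b * s) = A + B * s := by
    refine ⟨a.den * b.den, a.num * b.den, b.num * a.den, by simp, ?_⟩
    have h1 : (a.den : L) ≠ 0 := by simp
    have h2 : (b.den : L) ≠ 0 := by simp
    rw [Rat.cast_def a, Rat.cast_def b]
    push_cast
    field_simp
  have hN' : (N : L) ≠ 0 := by exact_mod_cast hN
  have hAB0 : (A : L) + B * s ≠ 0 := hNx ▸ mul_ne_zero hN' hx0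
  have hg : 0 < Int.gcd A B := by
    rw [Nat.pos_iff_ne_zero, Ne, Int.gcd_eq_zero_iff]
    rintro ⟨rfl, rfl⟩
    simp at hAB0
  obtain ⟨A', hA'⟩ := Int.gcd_dvd_left A B
  obtain ⟨B', hB'⟩ := Int.gcd_dvd_right A B
  set g := Int.gcd A B with hgdef
  have hcop : ∀ hA : (p : ℤ) ∣ A', ¬ (p : ℤ) ∣ B' := by
    intro hA hB
    have h1 : ((g : ℤ) * p) ∣ Int.gcd A B := by
      refine Int.dvd_coe_gcd ?_ ?_
      · rw [hA']; exact mul_dvd_mul_left _ hA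
      · rw [hB']; exact mul_dvd_mul_left _ hB
    rw [← hgdef] at h1
    have h2 : g * p ∣ g := by exact_mod_cast h1
    have h3 := Nat.le_of_dvd hg h2
    have := hp.two_le
    nlinarith
  have hAB : (A : L) + B * s = (g : L) * (A' + B' * s) := by
    have e1 : (A : L) = g * A' := by exact_mod_cast congrArg (Int.cast : ℤ → L) hA'
    have e2 : (B : L) = g * B' := by exact_mod_cast congrArg (Int.cast : ℤ → L) hB'
    rw [e1, e2]; ring
  have hg' : (g : L) ≠ 0 := by exact_mod_cast hg.ne'
  have hy0 : (A' : L) + B' * s ≠ 0 := by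
    intro h
    rw [hAB, h, mul_zero] at hAB0
    exact hAB0 rfl
  have hordx : v.ord ((a : L) + b * s) = v.ord ((g : ℤ) : L) + v.ord ((A' : L) + B' * s) - v.ord (N : L) := by
    have := congrArg v.ord (hNx.trans hAB)
    rw [ord_mul v hN' hx0, ord_mul v hg' hy0] at this
    rw [Int.cast_natCast]
    omega
  rw [hordx]
  refine dvd_sub (dvd_add (ord_prime_dvd_ord_intCast v hp hv (by exact_mod_cast hg.ne')) ?_)
    (ord_prime_dvd_ord_intCast v hp hv hN)
  set y := (A' : L) + B' * s with hy
  set y' := (A' : L) - B' * s with hy'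
  have hyI : v.LeOrd 0 y := (hinteg _).add (by simpa using (hinteg B').mul hs0)
  have hyI' : v.LeOrd 0 y' := (hinteg _).sub (by simpa using (hinteg B').mul hs0)
  by_cases hy1 : v.LeOrd 1 y
  swap
  · rw [ord_eq_of_leOrd_of_not hyI (by simpa using hy1)]
    exact dvd_zero _
  have hnorm : y * y' = ((A' ^ 2 - d * B' ^ 2 : ℤ) : L) := by
    rw [hy, hy']
    push_cast
    linear_combination -(B' : L) ^ 2 * hs
  -- an integer of positive order is divisible by `p`
  have hpdvd : ∀ m : ℤ, v.LeOrd 1 (m : L) → (p : ℤ) ∣ m := by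
    intro m hm
    by_contra hc
    obtain ⟨a, b, hab⟩ := (Nat.prime_iff_prime_int.1 hp).coprime_iff_not_dvd.2 hc
    have h1 : v.LeOrd (0 + 1) ((a : L) * (p : L) + (b : L) * (m : L)) :=
      ((hinteg a).mul hv).add ((hinteg b).mul hm)
    have h2 : ((a : L) * (p : L) + (b : L) * (m : L)) = 1 := by
      exact_mod_cast congrArg (Int.cast : ℤ → L) hab
    rw [h2, leOrd_iff v one_ne_zero, ord_one] at h1
    omega
  have hpint : Prime (p : ℤ) := Nat.prime_iff_prime_int.1 hp
  have hN1 : (p : ℤ) ∣ A' ^ 2 - d * B' ^ 2 := hpdvd _ (by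
    rw [← hnorm]; simpa using hy1.mul hyI')
  have hpA : ¬ (p : ℤ) ∣ A' := by
    intro h
    have h1 : (p : ℤ) ∣ d * B' ^ 2 := by
      have := dvd_sub (dvd_pow h two_ne_zero) hN1
      rwa [sub_sub_cancel] at this
    exact hcop h (hpint.dvd_of_dvd_pow ((hpint.dvd_or_dvd h1).resolve_left hpd))
  have hy'1 : ¬ v.LeOrd 1 y' := by
    intro h
    have h1 : v.LeOrd 1 (((2 * A' : ℤ)) : L) := by
      have := hy1.add h
      rw [hy, hy'] at this
      convert this using 1
      push_cast; ring
    rcases hpint.dvd_or_dvd (hpdvd _ h1) with h2 | h2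
    · have h3 : p ∣ 2 := by exact_mod_cast h2
      exact hp2 ((Nat.prime_dvd_prime_iff_eq hp Nat.prime_two).1 h3)
    · exact hpA h2
  have hord' : v.ord y' = 0 := ord_eq_of_leOrd_of_not hyI' (by simpa using hy'1)
  have hy'0 : y' ≠ 0 := ne_zero_of_not_leOrd hy'1
  have h4 := congrArg v.ord hnorm
  rw [ord_mul v hy0 hy'0, hord', add_zero] at h4
  rw [h4]
  refine ord_prime_dvd_ord_intCast v hp hv ?_
  intro h
  rw [h, Int.cast_zero] at hnorm
  exact (mul_ne_zero hy0 hy'0) hnorm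

end Local

end OrderLemmas

section FermatFields

open Module NumberField IsDedekindDomain HeightOneSpectrum IntermediateField Polynomial

section FermatField

variable {L : Type} [Field L] [NumberField L]

/-- The field `L` is generated by a primitive `p`-th root of unity `ζ` over a totally real field `k`
unramified at `p`, its class number is prime to `p`, and `τ` is its complex conjugation. -/
structure IsFermatField (p : ℕ) (k : Subfield L) (ζ : L) (τ : L →+* L) : Prop where
  primitive : IsPrimitiveRoot ζ p
  conj_zeta : τ ζ = ζ⁻¹
  conj_of_mem : ∀ x ∈ k, τ x = x
  embed_conj : ∀ (φ : L →+* ℂ) (x : L), φ (τ x) = starRingEnd ℂ (φ x)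
  not_dvd_classNumber : ¬ p ∣ classNumber L
  ord_prime : ∀ v : HeightOneSpectrum (𝓞 L), v.LeOrd 1 (p : L) → v.ord (p : L) = (p - 1 : ℕ)
  ord_zeta_sub_one : ∀ v : HeightOneSpectrum (𝓞 L), v.LeOrd 1 (p : L) → v.ord (ζ - 1) = 1
  dvd_ord_of_mem : ∀ v : HeightOneSpectrum (𝓞 L), v.LeOrd 1 (p : L) → ∀ x ∈ k, x ≠ 0 →
    ((p - 1 : ℕ) : ℤ) ∣ v.ord x
  exists_leOrd_sub : ∀ v : HeightOneSpectrum (𝓞 L), v.LeOrd 1 (p : L) → ∀ x, v.LeOrd 0 x →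
    ∃ b ∈ k, v.LeOrd 1 (x - b)
  ord_conj : ∀ v : HeightOneSpectrum (𝓞 L), v.LeOrd 1 (p : L) → ∀ x, v.ord (τ x) = v.ord x

theorem exists_sum_range_of_adjoin_eq_top {s ζ : L} {p : ℕ} (hp : p.Prime)
    (hζ : IsPrimitiveRoot ζ p) (htop : IntermediateField.adjoin ℚ ({s, ζ} : Set L) = ⊤) (x : L) :
    ∃ f : ℕ → L, (∀ i, f i ∈ ℚ⟮s⟯) ∧ x = ∑ i ∈ Finset.range (p - 1), f i * (ζ - 1) ^ i := by
  have h1 : IntermediateField.adjoin ℚ⟮s⟯ ({ζ} : Set L) = ⊤ := by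
    have h2 := IntermediateField.adjoin_adjoin_left ℚ ({s} : Set L) {ζ}
    rw [Set.singleton_union, htop] at h2
    exact IntermediateField.restrictScalars_injective ℚ
      (h2.trans IntermediateField.restrictScalars_top.symm)
  have hx : x ∈ IntermediateField.adjoin ℚ⟮s⟯ ({ζ} : Set L) := h1 ▸ IntermediateField.mem_top
  rw [← mem_toSubalgebra, adjoin_simple_toSubalgebra_of_isAlgebraic
    (Algebra.IsAlgebraic.isAlgebraic ζ), Algebra.adjoin_singleton_eq_range_aeval] at hx
  obtain ⟨P, rfl⟩ := hx
  set q : ℚ⟮s⟯[X] := (cyclotomic p ℚ⟮s⟯).comp (X + C 1) with hq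
  have hqm : q.Monic := (cyclotomic.monic p _).comp_X_add_C 1
  have hqd : q.natDegree = p - 1 := by
    rw [hq, natDegree_comp, natDegree_X_add_C, mul_one, natDegree_cyclotomic,
      Nat.totient_prime hp]
  have hq0 : aeval (ζ - 1) q = 0 := by
    rw [hq, aeval_comp]
    have : aeval (ζ - 1) (X + C 1 : ℚ⟮s⟯[X]) = ζ := by simp
    rw [this, aeval_def, eval₂_eq_eval_map, map_cyclotomic]
    exact (hζ.isRoot_cyclotomic hp.pos)
  set r := (P.comp (X + C 1)) %ₘ q with hr
  have hrd : r.natDegree < p - 1 := by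
    rw [← hqd]
    refine natDegree_modByMonic_lt _ hqm fun h => ?_
    have := hqd
    rw [h, natDegree_one] at this
    have := hp.two_le
    omega
  refine ⟨fun i => (r.coeff i : L), fun i => (r.coeff i).2, ?_⟩
  have h2 : aeval (ζ - 1) r = aeval ζ P := by
    rw [hr, aeval_modByMonic_eq_self_of_root hq0]
    simp [aeval_comp]
  change aeval ζ P = _
  rw [← h2, aeval_eq_sum_range' hrd]
  rfl

/-- The field `ℚ(√d, ζ_p)`. -/
theorem isFermatField_of_adjoin_eq_top {d : ℤ} (hd : 0 < d) {s ζ : L} (hs : s ^ 2 = (d : L)) {p : ℕ}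
    (hp : p.Prime) (hp2 : p ≠ 2) (hpd : ¬ (p : ℤ) ∣ d) (hζ : IsPrimitiveRoot ζ p)
    (htop : IntermediateField.adjoin ℚ ({s, ζ} : Set L) = ⊤) (hcl : ¬ p ∣ classNumber L)
    (τ : L →ₐ[ℚ] L) (hτs : τ s = s) (hτζ : τ ζ = ζ⁻¹) :
    IsFermatField p (ℚ⟮s⟯.toSubfield) ζ τ := by
  have : Fact p.Prime := ⟨hp⟩
  have hp' := hp.two_le
  have hζ0 : ζ ≠ 0 := hζ.ne_zero hp.ne_zero
  have hl0 : ζ - 1 ≠ 0 := sub_ne_zero.2 (hζ.ne_one hp.one_lt)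
  have hfix : ∀ x ∈ ℚ⟮s⟯, τ x = x := by
    intro x hx
    obtain ⟨a, b, rfl⟩ := exists_rat_of_mem_adjoin_sqrt hs hx
    simp [hτs]
  have hord : ∀ v : HeightOneSpectrum (𝓞 L), v.ord (p : L) = (p - 1 : ℕ) * v.ord (ζ - 1) := by
    intro v
    obtain ⟨u, hu⟩ := IsCyclotomicExtension.Rat.associated_zeta_sub_one_pow_prime p hζ
    have h1 := congrArg (algebraMap (𝓞 L) L) hu
    rw [map_mul, map_pow, map_natCast] at h1
    have h2 : algebraMap (𝓞 L) L (hζ.toInteger - 1) = ζ - 1 := rfl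
    rw [h2] at h1
    rw [← h1, ord_mul v (pow_ne_zero _ hl0) (by simp), ord_algebraMap_unit, ord_pow, add_zero]
  have hpos : ∀ v : HeightOneSpectrum (𝓞 L), v.LeOrd 1 (p : L) → 0 < v.ord (ζ - 1) := by
    intro v hv
    rw [leOrd_iff v (by exact_mod_cast hp.ne_zero), hord v] at hv
    by_contra hc
    push Not at hc
    have : ((p - 1 : ℕ) : ℤ) * v.ord (ζ - 1) ≤ 0 := mul_nonpos_of_nonneg_of_nonpos (by simp) hc
    omega
  have hk : ∀ v : HeightOneSpectrum (𝓞 L), v.LeOrd 1 (p : L) → ∀ x ∈ ℚ⟮s⟯.toSubfield, x ≠ 0 →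
      ((p - 1 : ℕ) * v.ord (ζ - 1)) ∣ v.ord x := by
    intro v hv x hx hx0
    rw [← hord v]
    exact ord_prime_dvd_ord_of_mem_adjoin_sqrt v hs hp hp2 hpd hv hx hx0
  have hone : ∀ v : HeightOneSpectrum (𝓞 L), v.LeOrd 1 (p : L) → v.ord (ζ - 1) = 1 := by
    intro v hv
    obtain ⟨x, hx0, hx1⟩ := exists_ord_eq_one L v
    obtain ⟨f, hf, hfx⟩ := exists_sum_range_of_adjoin_eq_top hp hζ htop x
    rw [hfx] at hx0
    obtain ⟨j, -, hj0, hj, -⟩ := exists_ord_sum_eq v (hpos v hv) (hk v hv) hf hx0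
    rw [← hfx, hx1] at hj
    have h1 : v.ord (ζ - 1) ∣ 1 := by
      rw [hj]
      exact dvd_add ((dvd_mul_left _ _).trans (hk v hv _ (hf j) hj0)) (dvd_mul_left _ _)
    exact Int.eq_one_of_dvd_one (hpos v hv).le h1
  have hτl : τ (ζ - 1) = -ζ⁻¹ * (ζ - 1) := by
    rw [map_sub, hτζ, map_one]
    field_simp
    ring
  have hτlo : ∀ v : HeightOneSpectrum (𝓞 L), v.LeOrd 1 (p : L) → v.ord (τ (ζ - 1)) = 1 := by
    intro v hv
    rw [hτl, ord_mul v (neg_ne_zero.2 (inv_ne_zero hζ0)) hl0, ord_neg, ord_inv, hone v hv]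
    have h1 := congrArg v.ord hζ.pow_eq_one
    rw [ord_pow, ord_one] at h1
    have : v.ord ζ = 0 := by
      rcases mul_eq_zero.1 h1 with h | h
      · exact absurd (by exact_mod_cast h) hp.ne_zero
      · exact h
    omega
  refine ⟨hζ, hτζ, hfix, ?_, hcl, ?_, hone, ?_, ?_, ?_⟩
  · intro φ x
    have h1 : φ (τ s) = starRingEnd ℂ (φ s) := by
      rw [hτs]
      have h1 : φ s ^ 2 = (d : ℂ) := by rw [← map_pow, hs, map_intCast]
      have h2 : (d : ℂ) = ((Real.sqrt d : ℝ) : ℂ) ^ 2 := by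
        rw [← Complex.ofReal_pow, Real.sq_sqrt (by exact_mod_cast hd.le)]
        simp
      rw [h2] at h1
      rcases sq_eq_sq_iff_eq_or_eq_neg.1 h1 with h | h <;> rw [h] <;> simp
    have h2 : φ (τ ζ) = starRingEnd ℂ (φ ζ) := by
      rw [hτζ, map_inv₀, ← Complex.inv_eq_conj]
      refine Complex.norm_eq_one_of_pow_eq_one (n := p) ?_ hp.ne_zero
      rw [← map_pow, hζ.pow_eq_one, map_one]
    obtain ⟨f, hf, rfl⟩ := exists_sum_range_of_adjoin_eq_top hp hζ htop x
    change φ (τ _) = _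
    simp only [map_sum, map_mul, map_pow, map_sub, map_one, h2]
    refine Finset.sum_congr rfl fun i _ => ?_
    obtain ⟨a, b, hab⟩ := exists_rat_of_mem_adjoin_sqrt hs (hf i)
    rw [hab]
    simp [h1]
  · intro v hv
    rw [hord v, hone v hv, mul_one]
  · intro v hv x hx hx0
    have := hk v hv x hx hx0
    rwa [hone v hv, mul_one] at this
  · intro v hv x hx
    obtain ⟨f, hf, hfx⟩ := exists_sum_range_of_adjoin_eq_top hp hζ htop x
    by_cases hx0 : x = 0
    · exact ⟨0, zero_mem _, by simpa [hx0] using v.leOrd_zero 1⟩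
    have hx0' := hx0
    rw [hfx] at hx0'
    obtain ⟨j, -, hj0, hj, hmin⟩ := exists_ord_sum_eq v (hpos v hv) (hk v hv) hf hx0'
    rw [← hj, ← hfx] at hmin
    rw [leOrd_iff v hx0] at hx
    refine ⟨f 0, hf 0, ?_⟩
    have h1 : x - f 0 = ∑ i ∈ (Finset.range (p - 1)).erase 0, f i * (ζ - 1) ^ i := by
      rw [hfx, ← Finset.add_sum_erase _ _ (Finset.mem_range.2 (by omega : 0 < p - 1))]
      simp
    rw [h1]
    refine LeOrd.sum fun i hi => ?_
    rw [Finset.mem_erase, Finset.mem_range] at hi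
    by_cases hi0 : f i = 0
    · rw [hi0, zero_mul]
      exact v.leOrd_zero 1
    have h2 := hmin i hi.2 hi0
    obtain ⟨c, hc⟩ := hk v hv (f i) (hf i) hi0
    rw [hone v hv, mul_one] at h2 hc
    rw [leOrd_iff v (mul_ne_zero hi0 (pow_ne_zero _ hl0)), ord_mul v hi0 (pow_ne_zero _ hl0),
      ord_pow, hone v hv, mul_one]
    have : 0 ≤ c := by
      by_contra hc'
      have : ((p - 1 : ℕ) : ℤ) * c ≤ ((p - 1 : ℕ) : ℤ) * (-1) :=
        mul_le_mul_of_nonneg_left (by omega) (by simp)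
      omega
    have : 0 ≤ ((p - 1 : ℕ) : ℤ) * c := mul_nonneg (by simp) this
    omega
  · intro v hv x
    by_cases hx0 : x = 0
    · simp [hx0]
    obtain ⟨f, hf, hfx⟩ := exists_sum_range_of_adjoin_eq_top hp hζ htop x
    have hx0' := hx0
    rw [hfx] at hx0'
    have hτx : τ x = ∑ i ∈ Finset.range (p - 1), f i * (τ (ζ - 1)) ^ i := by
      rw [hfx, map_sum]
      refine Finset.sum_congr rfl fun i _ => ?_
      rw [map_mul, map_pow, hfix _ (hf i)]
    have hτx0 : τ x ≠ 0 := by simpa using hx0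
    rw [hτx] at hτx0
    obtain ⟨j, hjn, hj0, hj, hmin⟩ := exists_ord_sum_eq v (hpos v hv) (hk v hv) hf hx0'
    obtain ⟨j', hjn', hj0', hj', hmin'⟩ := exists_ord_sum_eq v (π := τ (ζ - 1))
      (by rw [hτlo v hv]; exact one_pos)
      (by have := hk v hv; rw [hone v hv] at this; rwa [hτlo v hv]) hf hτx0
    change v.ord (τ x) = v.ord x
    rw [hτx, hj', hfx, hj]
    have h1 := hmin j' hjn' hj0'
    have h2 := hmin' j hjn hj0
    rw [hone v hv] at h1 ⊢
    rw [hτlo v hv] at h2 ⊢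
    omega

end FermatField

end FermatFields

section Factorization

open Module NumberField IsDedekindDomain HeightOneSpectrum

section

variable {L : Type} [Field L] [NumberField L]

theorem ord_prime_eq_mul_ord_sub_one {p : ℕ} (hp : p.Prime) {ξ : L} (hξ : IsPrimitiveRoot ξ p)
    (v : HeightOneSpectrum (𝓞 L)) : v.ord (p : L) = (p - 1 : ℕ) * v.ord (ξ - 1) := by
  have : Fact p.Prime := ⟨hp⟩
  obtain ⟨u, hu⟩ := IsCyclotomicExtension.Rat.associated_zeta_sub_one_pow_prime p hξ
  have h1 := congrArg (algebraMap (𝓞 L) L) hu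
  rw [map_mul, map_pow, map_natCast] at h1
  have h2 : algebraMap (𝓞 L) L (hξ.toInteger - 1) = ξ - 1 := rfl
  rw [h2] at h1
  rw [← h1, ord_mul v (pow_ne_zero _ (sub_ne_zero.2 (hξ.ne_one hp.one_lt))) (by simp),
    ord_algebraMap_unit, ord_pow, add_zero]

theorem leOrd_natCast (v : HeightOneSpectrum (𝓞 L)) (n : ℕ) : v.LeOrd 0 (n : L) := by
  simpa using v.leOrd_algebraMap (K := L) (n : 𝓞 L)

theorem leOrd_intCast (v : HeightOneSpectrum (𝓞 L)) (n : ℤ) : v.LeOrd 0 (n : L) := by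
  simpa using v.leOrd_algebraMap (K := L) (n : 𝓞 L)

theorem ord_natCast_eq_zero {p : ℕ} (hp : p.Prime) {v : HeightOneSpectrum (𝓞 L)}
    (hv : v.LeOrd 1 (p : L)) {n : ℕ} (hn : ¬ p ∣ n) : v.ord (n : L) = 0 := by
  refine ord_eq_of_leOrd_of_not (leOrd_natCast v n) fun hc => ?_
  obtain ⟨a, b, hab⟩ := Nat.isCoprime_iff_coprime.2 ((Nat.Prime.coprime_iff_not_dvd hp).2 hn)
  have h1 : v.LeOrd (0 + 1) ((a : L) * (p : L) + (b : L) * (n : L)) :=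
    ((leOrd_intCast v a).mul hv).add ((leOrd_intCast v b).mul (by simpa using hc))
  have h2 : ((a : L) * (p : L) + (b : L) * (n : L)) = 1 := by
    exact_mod_cast congrArg (Int.cast : ℤ → L) hab
  rw [h2, leOrd_iff v one_ne_zero, ord_one] at h1
  omega

theorem ord_natCast_prime_eq_zero {p : ℕ} {v : HeightOneSpectrum (𝓞 L)}
    (hv : ¬ v.LeOrd 1 (p : L)) : v.ord (p : L) = 0 :=
  ord_eq_of_leOrd_of_not (leOrd_natCast v p) (by simpa using hv)

theorem ord_eq_zero_of_pow_eq_one {x : L} {n : ℕ} (hn : n ≠ 0) (hx : x ^ n = 1)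
    (v : HeightOneSpectrum (𝓞 L)) : v.ord x = 0 := by
  have h1 := congrArg v.ord hx
  rw [ord_pow, ord_one] at h1
  rcases mul_eq_zero.1 h1 with h | h
  · exact absurd (by exact_mod_cast h) hn
  · exact h

theorem exists_leOrd_one_prime (L : Type) [Field L] [NumberField L] {p : ℕ} (hp : p.Prime) :
    ∃ v : HeightOneSpectrum (𝓞 L), v.LeOrd 1 (p : L) := by
  by_contra hc
  push Not at hc
  have hp0 : (p : L) ≠ 0 := by exact_mod_cast hp.ne_zero
  obtain ⟨x, hx⟩ := exists_algebraMap_eq_of_leOrd (R := 𝓞 L) (x := (p : L)⁻¹) fun v => by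
    rw [leOrd_iff v (inv_ne_zero hp0), ord_inv, ord_natCast_prime_eq_zero (hc v), neg_zero]
  have h1 : IsIntegral ℤ ((p : ℚ)⁻¹) := by
    have h2 : IsIntegral ℤ (algebraMap ℚ L ((p : ℚ)⁻¹)) := by
      rw [map_inv₀, map_natCast, ← hx]
      exact x.2
    exact (isIntegral_algebraMap_iff (algebraMap ℚ L).injective).1 h2
  obtain ⟨n, hn⟩ := IsIntegrallyClosed.isIntegral_iff.1 h1
  have hp0' : (p : ℚ) ≠ 0 := by exact_mod_cast hp.ne_zero
  have h3 : (n : ℚ) * p = 1 := by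
    rw [show (n : ℚ) = (p : ℚ)⁻¹ from hn, inv_mul_cancel₀ hp0']
  have h4 : n * p = 1 := by exact_mod_cast h3
  have h5 : (p : ℤ) ∣ 1 := ⟨n, by rw [mul_comm]; exact h4.symm⟩
  exact hp.ne_one (by exact_mod_cast Int.eq_one_of_dvd_one (by simp) h5)

/-- At a prime above `p`, congruent integral elements have `p`-th powers congruent modulo
`p` times the modulus. -/
theorem leOrd_pow_sub_pow {p : ℕ} (hp : p.Prime) {v : HeightOneSpectrum (𝓞 L)}
    (hv : v.LeOrd ((p - 1 : ℕ) : ℤ) (p : L)) {a b : L} (hb : v.LeOrd 0 b)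
    (hab : v.LeOrd 1 (a - b)) : v.LeOrd p (a ^ p - b ^ p) := by
  have hab0 : v.LeOrd 0 (a - b) := hab.mono (by omega)
  have h1 := add_pow_prime_eq hp (a - b) b
  rw [sub_add_cancel] at h1
  rw [h1, add_sub_right_comm, add_sub_cancel_right]
  refine LeOrd.add ?_ ?_
  · simpa using hab.pow p
  · have hs : v.LeOrd 0 (∑ k ∈ Finset.Ioo 0 p,
        (a - b) ^ (k - 1) * b ^ (p - k - 1) * ((p.choose k / p : ℕ) : L)) := by
      refine LeOrd.sum fun i _ => ?_
      have := ((hab0.pow (i - 1)).mul (hb.pow (p - i - 1))).mul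
        (leOrd_natCast v (p.choose i / p))
      simpa using this
    refine (((hv.mul hab).mul hb).mul hs).mono ?_
    have := hp.pos
    push_cast [Nat.cast_sub this]
    omega

end

namespace IsFermatField

variable {L : Type} [Field L] [NumberField L] {p : ℕ} {k : Subfield L} {ζ : L} {τ : L →+* L}

theorem conj_conj (H : IsFermatField p k ζ τ) (x : L) : τ (τ x) = x := by
  let φ : L →+* ℂ := (IsAlgClosed.lift (R := ℚ) (S := L) (M := ℂ)).toRingHom
  apply φ.injective
  rw [H.embed_conj, H.embed_conj, Complex.conj_conj]

theorem zeta_ne_zero (H : IsFermatField p k ζ τ) (hp : p.Prime) : ζ ≠ 0 :=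
  H.primitive.ne_zero hp.ne_zero

theorem ord_zeta (H : IsFermatField p k ζ τ) (hp : p.Prime) (v : HeightOneSpectrum (𝓞 L)) :
    v.ord ζ = 0 :=
  ord_eq_zero_of_pow_eq_one hp.ne_zero H.primitive.pow_eq_one v

theorem leOrd_conj (H : IsFermatField p k ζ τ) {v : HeightOneSpectrum (𝓞 L)}
    (hv : v.LeOrd 1 (p : L)) {n : ℤ} {x : L} (hx : v.LeOrd n x) : v.LeOrd n (τ x) := by
  by_cases h0 : x = 0
  · rw [h0, map_zero]
    exact v.leOrd_zero n
  · rw [leOrd_iff v (by simpa using h0), H.ord_conj v hv]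
    exact (leOrd_iff v h0).1 hx

theorem leOrd_conj_sub (H : IsFermatField p k ζ τ) {v : HeightOneSpectrum (𝓞 L)}
    (hv : v.LeOrd 1 (p : L)) {x : L} (hx : v.LeOrd 0 x) : v.LeOrd 1 (τ x - x) := by
  obtain ⟨b, hb, hxb⟩ := H.exists_leOrd_sub v hv x hx
  have h1 := H.leOrd_conj hv hxb
  rw [map_sub, H.conj_of_mem b hb] at h1
  have := h1.sub hxb
  rwa [sub_sub_sub_cancel_right] at this

theorem ord_primitive_sub_one (H : IsFermatField p k ζ τ) (hp : p.Prime)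
    {v : HeightOneSpectrum (𝓞 L)} (hv : v.LeOrd 1 (p : L)) {ξ : L} (hξ : IsPrimitiveRoot ξ p) :
    v.ord (ξ - 1) = 1 := by
  have h1 := ord_prime_eq_mul_ord_sub_one hp hξ v
  rw [H.ord_prime v hv] at h1
  have := hp.two_le
  have h2 : ((p - 1 : ℕ) : ℤ) ≠ 0 := by omega
  exact (mul_left_cancel₀ h2 (by rw [mul_one]; exact h1)).symm

theorem _root_.ord_primitive_sub_one_of_not {p : ℕ} (hp : p.Prime)
    {v : HeightOneSpectrum (𝓞 L)} (hv : ¬ v.LeOrd 1 (p : L)) {ξ : L} (hξ : IsPrimitiveRoot ξ p) :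
    v.ord (ξ - 1) = 0 := by
  have h1 := ord_prime_eq_mul_ord_sub_one hp hξ v
  rw [ord_natCast_prime_eq_zero hv] at h1
  have := hp.two_le
  have h2 : ((p - 1 : ℕ) : ℤ) ≠ 0 := by omega
  exact (mul_eq_zero.1 h1.symm).resolve_left h2

/-- An element of `k` of positive order at a prime above `p` has order at least `p - 1`. -/
theorem leOrd_of_mem (H : IsFermatField p k ζ τ) {v : HeightOneSpectrum (𝓞 L)}
    (hv : v.LeOrd 1 (p : L)) {x : L} (hx : x ∈ k) (h : v.LeOrd 1 x) :
    v.LeOrd ((p - 1 : ℕ) : ℤ) x := by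
  by_cases h0 : x = 0
  · rw [h0]
    exact v.leOrd_zero _
  · rw [leOrd_iff v h0] at h ⊢
    exact Int.le_of_dvd (by omega) (H.dvd_ord_of_mem v hv x hx h0)

/-- A `p`-th power of a unit at a prime above `p` is congruent to a `p`-th power in `k`. -/
theorem exists_leOrd_pow_sub_pow (H : IsFermatField p k ζ τ) (hp : p.Prime)
    {v : HeightOneSpectrum (𝓞 L)} (hv : v.LeOrd 1 (p : L)) {x : L} (hx : v.LeOrd 0 x) :
    ∃ b ∈ k, v.LeOrd 0 b ∧ v.LeOrd 1 (x - b) ∧ v.LeOrd p (x ^ p - b ^ p) := by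
  obtain ⟨b, hb, hxb⟩ := H.exists_leOrd_sub v hv x hx
  have hb0 : v.LeOrd 0 b := by
    have := hx.sub (hxb.mono (by omega : (0 : ℤ) ≤ 1))
    rwa [sub_sub_cancel] at this
  refine ⟨b, hb, hb0, hxb, leOrd_pow_sub_pow hp ?_ hb0 hxb⟩
  exact leOrd_of_le_ord (H.ord_prime v hv).ge

theorem leOrd_zeta_pow_sub_one (H : IsFermatField p k ζ τ) (hp : p.Prime)
    {v : HeightOneSpectrum (𝓞 L)} (hv : v.LeOrd 1 (p : L)) (i : ℕ) : v.LeOrd 1 (ζ ^ i - 1) := by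
  have h1 : v.LeOrd 0 (∑ j ∈ Finset.range i, ζ ^ j) := LeOrd.sum fun j _ =>
    leOrd_of_le_ord (by rw [ord_pow, H.ord_zeta hp, mul_zero])
  have := h1.mul (leOrd_of_le_ord (H.ord_zeta_sub_one v hv).ge)
  rwa [geom_sum_mul, zero_add] at this

/-- Real elements have even order at the primes above `p`. -/
theorem even_ord_of_conj_eq (H : IsFermatField p k ζ τ) (hp : p.Prime) (hp2 : p ≠ 2)
    {v : HeightOneSpectrum (𝓞 L)} (hv : v.LeOrd 1 (p : L)) {x : L} (hx0 : x ≠ 0) (hx : τ x = x) :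
    Even (v.ord x) := by
  have hζ0 := H.zeta_ne_zero hp
  have hl0 : ζ - 1 ≠ 0 := sub_ne_zero.2 (H.primitive.ne_one hp.one_lt)
  by_contra hodd
  rw [Int.not_even_iff_odd] at hodd
  set n := v.ord x with hn
  set y := x / (ζ - 1) ^ n with hy
  have hy0 : y ≠ 0 := div_ne_zero hx0 (zpow_ne_zero _ hl0)
  have hyo : v.ord y = 0 := by
    rw [hy, ord_div v hx0 (zpow_ne_zero _ hl0), ord_zpow, H.ord_zeta_sub_one v hv]
    omega
  have hτl : τ (ζ - 1) = -ζ⁻¹ * (ζ - 1) := by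
    rw [map_sub, H.conj_zeta, map_one]
    field_simp
    ring
  have hτy : τ y = -(ζ ^ n * y) := by
    rw [hy, map_div₀, map_zpow₀, hτl, hx, mul_zpow, hodd.neg_zpow, inv_zpow]
    field_simp
  have h1 := H.leOrd_conj_sub hv (leOrd_of_le_ord hyo.ge)
  rw [hτy] at h1
  have h2 : v.LeOrd 1 (ζ ^ n + 1) := by
    have h3 : v.LeOrd 0 (-y⁻¹) := by
      rw [leOrd_iff v (neg_ne_zero.2 (inv_ne_zero hy0)), ord_neg, ord_inv]
      omega
    have := h3.mul h1
    rw [zero_add] at this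
    convert this using 1
    field_simp
    ring
  have h4 : v.LeOrd 1 (ζ ^ n - 1) := by
    have hn1 : (ζ ^ n) ^ p = 1 := by
      rw [← zpow_natCast, ← zpow_mul, mul_comm, zpow_mul, zpow_natCast, H.primitive.pow_eq_one,
        one_zpow]
    have : Fact p.Prime := ⟨hp⟩
    obtain ⟨i, -, hi⟩ := H.primitive.eq_pow_of_pow_eq_one hn1
    rw [← hi]
    exact H.leOrd_zeta_pow_sub_one hp hv i
  have h5 : v.LeOrd 1 ((2 : ℕ) : L) := by
    have := h2.sub h4
    convert this using 1
    push_cast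
    ring
  rw [leOrd_iff v (by norm_num), ord_natCast_eq_zero hp hv (n := 2)] at h5
  · omega
  · intro h
    exact hp2 ((Nat.prime_dvd_prime_iff_eq hp Nat.prime_two).1 h)

/-- `ζ` is not a `p`-th power. -/
theorem pow_ne_zeta (H : IsFermatField p k ζ τ) (hp : p.Prime) (hp5 : 5 ≤ p) (μ : L) :
    μ ^ p ≠ ζ := by
  intro hμ
  obtain ⟨v, hv⟩ := exists_leOrd_one_prime L hp
  have hμ0 : v.LeOrd 0 μ := by
    refine leOrd_of_le_ord (ord_eq_zero_of_pow_eq_one (n := p * p) ?_ ?_ v).ge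
    · exact mul_ne_zero hp.ne_zero hp.ne_zero
    · rw [pow_mul, hμ, H.primitive.pow_eq_one]
  obtain ⟨b, hb, -, -, h⟩ := H.exists_leOrd_pow_sub_pow hp hv hμ0
  rw [hμ] at h
  have hl := H.ord_zeta_sub_one v hv
  have hl0 : ζ - 1 ≠ 0 := sub_ne_zero.2 (H.primitive.ne_one hp.one_lt)
  have h1 : v.LeOrd 1 (b ^ p - 1) := by
    have := (leOrd_of_le_ord hl.ge).sub (h.mono (by omega : (1 : ℤ) ≤ p))
    convert this using 1
    ring
  have h2 := H.leOrd_of_mem hv (sub_mem (pow_mem hb p) (one_mem k)) h1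
  have h3 : v.LeOrd 2 (ζ - 1) := by
    have := (h.mono (by omega : (2 : ℤ) ≤ p)).add (h2.mono (by omega : (2 : ℤ) ≤ _))
    convert this using 1
    ring
  rw [leOrd_iff v hl0] at h3
  omega

theorem exists_pow_eq_zeta_pow_of_pow_eq_one (H : IsFermatField p k ζ τ) (hp : p.Prime)
    (hp5 : 5 ≤ p) {μ : L} {n : ℕ} (hn : n ≠ 0) (hμ : μ ^ n = 1) :
    ∃ m i : ℕ, ¬ p ∣ m ∧ i < p ∧ ζ ^ i = μ ^ m := by
  have : Fact p.Prime := ⟨hp⟩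
  have key : ∀ (a : ℕ) (ξ : L), ξ ^ p ^ a = 1 → ξ ^ p = 1 := by
    intro a
    induction a with
    | zero => intro ξ h; simp at h; simp [h]
    | succ a ih =>
      intro ξ h
      rw [pow_succ', pow_mul] at h
      have h1 := ih _ h
      obtain ⟨i, -, hi⟩ := H.primitive.eq_pow_of_pow_eq_one h1
      by_cases hpi : p ∣ i
      · rw [← hi, H.primitive.pow_eq_one_iff_dvd]
        exact hpi
      · exfalso
        obtain ⟨m, -, hm⟩ := Nat.exists_mul_mod_eq_one_of_coprime
          ((Nat.Prime.coprime_iff_not_dvd hp).2 hpi).symm hp.one_lt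
        refine H.pow_ne_zeta hp hp5 (ξ ^ m) ?_
        rw [← pow_mul, mul_comm, pow_mul, ← hi, ← pow_mul,
          ← Nat.div_add_mod (i * m) p, hm, pow_add, pow_mul, H.primitive.pow_eq_one]
        simp
  obtain ⟨a, m, hm, hnm⟩ := Nat.exists_eq_pow_mul_and_not_dvd hn p hp.ne_one
  have h1 : (μ ^ m) ^ p = 1 := key a _ (by rw [← pow_mul, mul_comm, ← hnm, hμ])
  obtain ⟨i, hip, hi⟩ := H.primitive.eq_pow_of_pow_eq_one h1
  exact ⟨m, i, hm, hip, hi⟩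

theorem exists_eq_zeta_pow_mul_pow_of_pow_eq_one (H : IsFermatField p k ζ τ) (hp : p.Prime)
    (hp5 : 5 ≤ p) {μ : L} {n : ℕ} (hn : n ≠ 0) (hμ : μ ^ n = 1) :
    ∃ (j : ℕ) (ν : L), ν ≠ 0 ∧ μ = ζ ^ j * ν ^ p := by
  have hμ0 : μ ≠ 0 := by
    rintro rfl
    rw [zero_pow hn] at hμ
    exact zero_ne_one hμ
  obtain ⟨m, i, hm, -, hi⟩ := H.exists_pow_eq_zeta_pow_of_pow_eq_one hp hp5 hn hμ
  obtain ⟨c, -, hc⟩ := Nat.exists_mul_mod_eq_one_of_coprime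
    ((Nat.Prime.coprime_iff_not_dvd hp).2 hm).symm hp.one_lt
  refine ⟨i * c, (μ ^ (m * c / p))⁻¹, inv_ne_zero (pow_ne_zero _ hμ0), ?_⟩
  rw [pow_mul, hi, ← pow_mul, inv_pow, ← pow_mul, eq_mul_inv_iff_mul_eq₀ (pow_ne_zero _ hμ0),
    ← pow_succ']
  congr 1
  have := Nat.div_add_mod (m * c) p
  rw [hc] at this
  rw [mul_comm (m * c / p)]
  omega

/-- An element of relative norm one over the maximal real subfield whose divisor is a `p`-th power
is, up to a power of `ζ`, a `p`-th power. -/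
theorem exists_eq_zeta_pow_mul_pow (H : IsFermatField p k ζ τ) (hp : p.Prime)
    (hp5 : 5 ≤ p) {x : L} (hx : x * τ x = 1) (h : ∀ v : HeightOneSpectrum (𝓞 L), (p : ℤ) ∣ v.ord x) :
    ∃ (j : ℕ) (β : L), j < p ∧ x = ζ ^ j * β ^ p := by
  have hx0 : x ≠ 0 := left_ne_zero_of_mul_eq_one hx
  have hcl : p.Coprime (Fintype.card (ClassGroup (𝓞 L))) :=
    (Nat.Prime.coprime_iff_not_dvd hp).2 H.not_dvd_classNumber
  obtain ⟨u, s, hs0, hxs⟩ := exists_unit_mul_pow hp.ne_zero hcl hx0 h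
  set e : L := algebraMap (𝓞 L) L u with he
  have he0 : e ≠ 0 := by simp [he]
  have hτe0 : τ e ≠ 0 := by simpa using he0
  have hτs0 : τ s ≠ 0 := by simpa using hs0
  have hei : IsIntegral ℤ (e / τ e) := by
    rw [div_eq_mul_inv, ← map_inv₀]
    have h1 : IsIntegral ℤ e⁻¹ := by
      have : e⁻¹ = algebraMap (𝓞 L) L ((u⁻¹ : (𝓞 L)ˣ) : 𝓞 L) := by
        refine inv_eq_of_mul_eq_one_right ?_
        rw [he, ← map_mul, Units.mul_inv, map_one]
      rw [this]
      exact RingOfIntegers.isIntegral_coe _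
    exact (RingOfIntegers.isIntegral_coe (u : 𝓞 L)).mul (map_isIntegral_int τ h1)
  obtain ⟨n, hn, hen⟩ := NumberField.Embeddings.pow_eq_one_of_norm_eq_one L ℂ hei (by
    intro φ
    rw [map_div₀, H.embed_conj, norm_div, Complex.norm_conj, div_self]
    simpa using he0)
  obtain ⟨j, ν, hν0, hj⟩ := H.exists_eq_zeta_pow_mul_pow_of_pow_eq_one hp hp5 hn.ne' hen
  have hodd : Odd p := hp.odd_of_ne_two (by omega)
  obtain ⟨q, hq⟩ := hodd
  have hx2 : x ^ 2 = ζ ^ j * (ν * (s / τ s)) ^ p := by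
    have h1 : x ^ 2 = x / τ x := by
      rw [eq_div_iff (right_ne_zero_of_mul_eq_one hx)]
      linear_combination x * hx
    have h2 : τ x = τ e * τ s ^ p := by rw [hxs, map_mul, map_pow]
    rw [h1, h2, hxs, mul_pow, div_pow, ← mul_assoc, ← hj]
    field_simp
  have hxx : x = ζ ^ (j * (q + 1)) * ((ν * (s / τ s)) ^ (q + 1) / x) ^ p := by
    have h1 : x ^ (p + 1) = (ζ ^ j * (ν * (s / τ s)) ^ p) ^ (q + 1) := by
      rw [← hx2, ← pow_mul]
      congr 1
      omega
    rw [div_pow, ← mul_div_assoc, eq_div_iff (pow_ne_zero _ hx0), ← pow_succ', h1, mul_pow,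
      ← pow_mul, ← pow_mul, ← pow_mul, mul_comm p]
  refine ⟨j * (q + 1) % p, (ν * (s / τ s)) ^ (q + 1) / x, Nat.mod_lt _ hp.pos, hxx.trans ?_⟩
  congr 1
  conv_lhs => rw [← Nat.div_add_mod (j * (q + 1)) p, pow_add, pow_mul, H.primitive.pow_eq_one,
    one_pow, one_mul]

end IsFermatField

end Factorization

section Residue

open Module NumberField IsDedekindDomain HeightOneSpectrum Polynomial

theorem exists_residue_hom {L : Type} [Field L] [NumberField L] (v : HeightOneSpectrum (𝓞 L)) :
    ∃ (κ : Type) (_ : Field κ) (O : Subring L) (ρ : O →+* κ), (∀ x, x ∈ O ↔ v.LeOrd 0 x) ∧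
      ∀ x : O, ρ x = 0 ↔ v.LeOrd 1 (x : L) := by
  refine ⟨IsLocalRing.ResidueField (v.valuation L).valuationSubring, inferInstance,
    (v.valuation L).valuationSubring.toSubring,
    IsLocalRing.residue (v.valuation L).valuationSubring, fun x => ?_, fun x => ?_⟩
  · change v.valuation L x ≤ 1 ↔ _
    simp [LeOrd]
  · refine (IsLocalRing.residue_eq_zero_iff (R := (v.valuation L).valuationSubring) x).trans ?_
    refine (Valuation.mem_maximalIdeal_iff L (v.valuation L)).trans ?_
    rw [LeOrd]
    constructor
    · intro h
      by_cases h0 : (x : L) = 0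
      · rw [h0]; simp
      · rw [valuation_eq_exp_neg_ord v h0] at h ⊢
        rw [← WithZero.exp_zero, WithZero.exp_lt_exp] at h
        rw [WithZero.exp_le_exp]
        omega
    · intro h
      refine h.trans_lt ?_
      rw [← WithZero.exp_zero, WithZero.exp_lt_exp]
      omega

/-- The residue field computation in the first case of Fermat's equation. -/
theorem first_case_residue {κ : Type} [Field κ] {p : ℕ} [CharP κ p] (hp5 : 5 ≤ p) {x y c : κ}
    (hc : c ≠ 0) (hxy : ¬ (x = 0 ∧ y = 0)) {j : ℕ} (hj : j < p) (h0 : (1 - c) * (x + y) = 0)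
    (h1 : x + 2 * y = c * ((j + 1) * x + j * y))
    (h2 : 2 * y = c * ((j + 1) * j * x + j * (j - 1) * y))
    (h3 : (j + 1 : κ) * j * (j - 1) * x + j * (j - 1) * (j - 2) * y = 0) :
    (j = 0 ∧ y = 0) ∨ (j = 2 ∧ x = 0) ∨ (j = 1 ∧ (x = y ∨ x = -y)) := by
  have hcast : ∀ i : ℕ, i < p → (j : κ) = (i : κ) → j = i := by
    intro i hi h
    rw [CharP.natCast_eq_natCast κ p] at h
    rwa [Nat.ModEq, Nat.mod_eq_of_lt hj, Nat.mod_eq_of_lt hi] at h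
  have h2' : (2 : κ) ≠ 0 := by
    intro h
    have h2 : ((2 : ℕ) : κ) = 0 := by exact_mod_cast h
    rw [CharP.cast_eq_zero_iff κ p] at h2
    have := Nat.le_of_dvd two_pos h2
    omega
  rcases mul_eq_zero.1 h0 with hc1 | hs
  · have hc1 : c = 1 := (sub_eq_zero.1 hc1).symm
    subst hc1
    have e1 : (j : κ) * x + (j - 2) * y = 0 := by linear_combination -h1
    have e2 : ((j : κ) - 1) * ((j - 2) * y) = 0 := by
      linear_combination ((j : κ) + 1) * (j - 1) * e1 - h3
    by_cases hy : y = 0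
    · left
      refine ⟨hcast 0 (by omega) ?_, hy⟩
      rw [hy, mul_zero, add_zero] at e1
      have hx : x ≠ 0 := fun h => hxy ⟨h, hy⟩
      simpa using (mul_eq_zero.1 e1).resolve_right hx
    · right
      rcases mul_eq_zero.1 e2 with h | h
      · right
        have hj1 : (j : κ) = 1 := sub_eq_zero.1 h
        refine ⟨hcast 1 (by omega) (by simpa using hj1), Or.inl ?_⟩
        rw [hj1] at e1
        linear_combination e1
      · left
        have hj2 : (j : κ) = 2 := sub_eq_zero.1 ((mul_eq_zero.1 h).resolve_right hy)
        refine ⟨hcast 2 (by omega) (by simpa using hj2), ?_⟩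
        rw [hj2] at e1
        refine (mul_eq_zero.1 (?_ : (2 : κ) * x = 0)).resolve_left h2'
        linear_combination e1
  · right; right
    have hyx : y = -x := by linear_combination hs
    subst hyx
    have hx : x ≠ 0 := fun h => hxy ⟨h, by simp [h]⟩
    have e1 : c = -1 := by
      apply mul_right_cancel₀ hx
      linear_combination -h1
    subst e1
    refine ⟨hcast 1 (by omega) ?_, Or.inr (by ring)⟩
    apply mul_right_cancel₀ (mul_ne_zero h2' hx)
    push_cast
    linear_combination h2

namespace IsFermatField

variable {L : Type} [Field L] [NumberField L] {p : ℕ} {k : Subfield L} {ζ : L} {τ : L →+* L}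

theorem exists_zeta_pow_eq (H : IsFermatField p k ζ τ)
    {v : HeightOneSpectrum (𝓞 L)} (hv : v.LeOrd 1 (p : L)) (n : ℕ) :
    ∃ r : L, v.LeOrd 0 r ∧ ζ ^ n = 1 + n * (ζ - 1) + n.choose 2 * (ζ - 1) ^ 2 +
      n.choose 3 * (ζ - 1) ^ 3 + (ζ - 1) ^ 4 * r := by
  have hl : v.LeOrd 1 (ζ - 1) := leOrd_of_le_ord (H.ord_zeta_sub_one v hv).ge
  induction n with
  | zero => exact ⟨0, v.leOrd_zero 0, by simp⟩
  | succ n ih =>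
    obtain ⟨r, hr, h⟩ := ih
    refine ⟨n.choose 3 + r + (ζ - 1) * r, ((leOrd_natCast v _).add hr).add
      (by simpa using (hl.mono (by omega : (0 : ℤ) ≤ 1)).mul hr), ?_⟩
    rw [pow_succ, h, Nat.choose_succ_succ' n 1, Nat.choose_succ_succ' n 2, Nat.choose_one_right]
    push_cast
    ring

/-- The coefficients in `k` of a cubic polynomial in `ζ - 1` divisible by `(ζ - 1) ^ 4`. -/
theorem leOrd_coeff (H : IsFermatField p k ζ τ) (hp : p.Prime) (hp5 : 5 ≤ p)
    {v : HeightOneSpectrum (𝓞 L)} (hv : v.LeOrd 1 (p : L)) {a b c d : L} (ha : a ∈ k) (hb : b ∈ k)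
    (hc : c ∈ k) (hb0 : v.LeOrd 0 b) (hc0 : v.LeOrd 0 c) (hd0 : v.LeOrd 0 d)
    (h : v.LeOrd 4 (a + b * (ζ - 1) + c * (ζ - 1) ^ 2 + d * (ζ - 1) ^ 3)) :
    v.LeOrd 1 a ∧ v.LeOrd 1 b ∧ v.LeOrd 1 c ∧ v.LeOrd 1 d := by
  have hl := H.ord_zeta_sub_one v hv
  have hl0 : ζ - 1 ≠ 0 := sub_ne_zero.2 (H.primitive.ne_one hp.one_lt)
  set l := ζ - 1 with hldef
  have hlo : ∀ n : ℕ, v.LeOrd n (l ^ n) := fun n => leOrd_of_le_ord (by rw [ord_pow, hl, mul_one])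
  have hcancel : ∀ (n : ℕ) (t : L), v.LeOrd (n + 1) (t * l ^ n) → v.LeOrd 1 t := by
    intro n t ht
    by_cases ht0 : t = 0
    · rw [ht0]
      exact v.leOrd_zero 1
    rw [leOrd_iff v (mul_ne_zero ht0 (pow_ne_zero _ hl0)), ord_mul v ht0 (pow_ne_zero _ hl0),
      ord_pow, hl] at ht
    rw [leOrd_iff v ht0]
    omega
  have hterm : ∀ {t : L} (n : ℕ), v.LeOrd 0 t → v.LeOrd n (t * l ^ n) := by
    intro t n ht
    simpa using ht.mul (hlo n)
  have hk4 : ∀ {t : L} (n : ℕ), t ∈ k → v.LeOrd 1 t → v.LeOrd 4 (t * l ^ n) := by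
    intro t n ht ht1
    have h4 := (H.leOrd_of_mem hv ht ht1).mono (by omega : (4 : ℤ) ≤ _)
    exact (h4.mul (hlo n)).mono (by omega)
  have h1 : v.LeOrd 1 a := by
    have := (((h.mono (by omega : (1 : ℤ) ≤ 4)).sub ((hterm 3 hd0).mono (by norm_num))).sub
      ((hterm 2 hc0).mono (by norm_num))).sub (hterm 1 hb0)
    convert this using 1
    ring
  have ha4 := hk4 0 ha h1
  have h2 : v.LeOrd 1 b := by
    refine hcancel 1 b (LeOrd.mono (n := 2) ?_ (by norm_num))
    have := (((h.mono (by omega : (2 : ℤ) ≤ 4)).sub ((hterm 3 hd0).mono (by norm_num))).sub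
      ((hterm 2 hc0).mono (by norm_num))).sub (ha4.mono (by norm_num))
    convert this using 1
    ring
  have hb4 := hk4 1 hb h2
  have h3 : v.LeOrd 1 c := by
    refine hcancel 2 c (LeOrd.mono (n := 3) ?_ (by norm_num))
    have := (((h.mono (by omega : (3 : ℤ) ≤ 4)).sub ((hterm 3 hd0).mono (by norm_num))).sub
      (hb4.mono (by norm_num))).sub (ha4.mono (by norm_num))
    convert this using 1
    ring
  have hc4 := hk4 2 hc h3
  refine ⟨h1, h2, h3, hcancel 3 d (LeOrd.mono (n := 4) ?_ (by norm_num))⟩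
  have := ((h.sub hc4).sub hb4).sub ha4
  convert this using 1
  ring

theorem first_case_local_of_leOrd (H : IsFermatField p k ζ τ) (hp : p.Prime) (hp5 : 5 ≤ p)
    {v : HeightOneSpectrum (𝓞 L)} (hv : v.LeOrd 1 (p : L)) {x y β : L} (hx : x ∈ k) (hy : y ∈ k)
    (hx0 : v.LeOrd 0 x) (hy0 : v.LeOrd 0 y) (hxy : ¬ (v.LeOrd 1 x ∧ v.LeOrd 1 y))
    (hβ : v.LeOrd 0 β) (hβ1 : ¬ v.LeOrd 1 β) {j : ℕ} (hj : j < p)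
    (h : x + ζ * y = ζ ^ j * β ^ p * (x + ζ⁻¹ * y)) :
    (j = 0 ∧ v.LeOrd 1 y) ∨ (j = 2 ∧ v.LeOrd 1 x) ∨
      (j = 1 ∧ (v.LeOrd 1 (x - y) ∨ v.LeOrd 1 (x + y))) := by
  obtain ⟨b, hb, hb0, hb1, hbp⟩ := H.exists_leOrd_pow_sub_pow hp hv hβ
  have hb1' : ¬ v.LeOrd 1 b := fun h => hβ1 (by simpa using hb1.add h)
  have hζ0 := H.zeta_ne_zero hp
  have hl : v.LeOrd 1 (ζ - 1) := leOrd_of_le_ord (H.ord_zeta_sub_one v hv).ge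
  set c := b ^ p with hc
  have hck : c ∈ k := pow_mem hb p
  have hc0 : v.LeOrd 0 c := by simpa using hb0.pow p
  have hζi : ∀ n : ℕ, v.LeOrd 0 (ζ ^ n) := fun n =>
    leOrd_of_le_ord (by rw [ord_pow, H.ord_zeta hp, mul_zero])
  obtain ⟨r, hr, hrj⟩ := H.exists_zeta_pow_eq hv j
  obtain ⟨r', hr', hrj'⟩ := H.exists_zeta_pow_eq hv (j + 1)
  set l := ζ - 1 with hldef
  have hζl : ζ = 1 + l := by rw [hldef]; ring
  have hl4 : v.LeOrd 4 (l ^ 4) := by simpa using hl.pow 4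
  have hsum : v.LeOrd 4 (((1 - c) * (x + y)) + (x + 2 * y - c * ((j + 1) * x + j * y)) * l +
      (y - c * ((j + 1).choose 2 * x + j.choose 2 * y)) * l ^ 2 +
      (-(c * ((j + 1).choose 3 * x + j.choose 3 * y))) * l ^ 3) := by
    have h1 : v.LeOrd 4 ((β ^ p - c) * (ζ ^ j * (ζ * x + y))) := by
      have h2 : v.LeOrd 0 (ζ ^ j * (ζ * x + y)) := by
        have := (hζi j).mul ((show v.LeOrd 0 (ζ * x) by
          simpa using (hζi 1).mul hx0).add hy0)
        simpa using this
      have := (hbp.mono (by omega : (4 : ℤ) ≤ p)).mul h2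
      simpa using this
    have h2 : v.LeOrd 4 (l ^ 4 * (c * x * r' + c * y * r)) := by
      have h3 : v.LeOrd 0 (c * x * r' + c * y * r) := by
        have e1 := (hc0.mul hx0).mul hr'
        have e2 := (hc0.mul hy0).mul hr
        simpa using e1.add e2
      simpa using hl4.mul h3
    have h3 : ζ * x + ζ ^ 2 * y = ζ ^ j * β ^ p * (ζ * x + y) := by
      have := congrArg (ζ * ·) h
      field_simp at this
      linear_combination this
    have := h1.add h2
    convert this using 1
    have e1 : ζ ^ j * (ζ * x + y) = x * ζ ^ (j + 1) + y * ζ ^ j := by ring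
    have e2 : (β ^ p - c) * (ζ ^ j * (ζ * x + y)) = ζ * x + ζ ^ 2 * y -
        c * (x * ζ ^ (j + 1) + y * ζ ^ j) := by
      rw [h3, ← e1]; ring
    rw [e2, hrj, hrj', hζl]
    push_cast
    ring
  have hjk : ∀ n : ℕ, (n : L) ∈ k := fun n => natCast_mem k n
  have hn0 := leOrd_natCast v
  obtain ⟨κ, _, O, ρ, hO, hρ⟩ := exists_residue_hom v
  obtain ⟨X, rfl⟩ : ∃ X : O, (X : L) = x := ⟨⟨x, (hO x).2 hx0⟩, rfl⟩
  obtain ⟨Y, rfl⟩ : ∃ Y : O, (Y : L) = y := ⟨⟨y, (hO y).2 hy0⟩, rfl⟩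
  obtain ⟨B, rfl⟩ : ∃ B : O, (B : L) = b := ⟨⟨b, (hO b).2 hb0⟩, rfl⟩
  have hOx : ∀ t : O, v.LeOrd 0 (t : L) := fun t => (hO t).1 t.2
  obtain ⟨h0, h1, h2, h3⟩ := H.leOrd_coeff hp hp5 hv
    (mul_mem (sub_mem (one_mem k) hck) (add_mem hx hy))
    (sub_mem (add_mem hx (mul_mem (by exact_mod_cast hjk 2) hy))
      (mul_mem hck (add_mem (mul_mem (by exact_mod_cast hjk (j + 1)) hx) (mul_mem (hjk j) hy))))
    (sub_mem hy (mul_mem hck (add_mem (mul_mem (hjk _) hx) (mul_mem (hjk _) hy))))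
    (hOx (X + 2 * Y - B ^ p * ((j + 1) * X + j * Y)))
    (by simpa using hOx (Y - B ^ p * ((j + 1).choose 2 * X + j.choose 2 * Y)))
    (by simpa using hOx (-(B ^ p * ((j + 1).choose 3 * X + j.choose 3 * Y)))) hsum
  have : CharP κ p := by
    have hp0 : (p : κ) = 0 := by
      rw [← map_natCast ρ, hρ]
      simpa using hv
    exact (CharP.ringChar_of_prime_eq_zero hp hp0) ▸ ringChar.charP κ
  have hcast : ∀ (n m : ℕ), (((n.choose m : ℕ) : O) : L) = (n.choose m : L) := fun n m => by simp
  have e0 : ρ ((1 - B ^ p) * (X + Y)) = 0 := (hρ _).2 (by simpa using h0)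
  have e1 : ρ (X + 2 * Y - B ^ p * ((j + 1) * X + j * Y)) = 0 := (hρ _).2 (by simpa using h1)
  have e2 : ρ (Y - B ^ p * (((j + 1).choose 2 : ℕ) * X + (j.choose 2 : ℕ) * Y)) = 0 :=
    (hρ _).2 (by simpa using h2)
  have e3 : ρ (-(B ^ p * (((j + 1).choose 3 : ℕ) * X + (j.choose 3 : ℕ) * Y))) = 0 :=
    (hρ _).2 (by simpa using h3)
  simp only [map_mul, map_sub, map_add, map_one, map_pow, map_natCast, map_neg, map_ofNat]
    at e0 e1 e2 e3
  have hB : ρ B ^ p ≠ 0 := pow_ne_zero _ fun h => hb1' ((hρ B).1 h)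
  have c2 : ∀ n : ℕ, (2 : κ) * (n.choose 2 : κ) = n * (n - 1) := by
    intro n
    induction n with
    | zero => simp
    | succ n ih =>
      rw [Nat.choose_succ_succ' n 1, Nat.choose_one_right]
      push_cast
      linear_combination ih
  have c3 : ∀ n : ℕ, (6 : κ) * (n.choose 3 : κ) = n * (n - 1) * (n - 2) := by
    intro n
    induction n with
    | zero => simp
    | succ n ih =>
      rw [Nat.choose_succ_succ' n 2]
      push_cast
      linear_combination ih + 3 * c2 n
  have e3' : ((j + 1).choose 3 : κ) * ρ X + (j.choose 3 : κ) * ρ Y = 0 :=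
    (mul_eq_zero.1 (neg_eq_zero.1 e3)).resolve_left hB
  have hc2 := c2 (j + 1)
  have hc3 := c3 (j + 1)
  push_cast at hc2 hc3
  rcases first_case_residue (p := p) hp5 hB (x := ρ X) (y := ρ Y)
    (fun h => hxy ⟨(hρ _).1 h.1, (hρ _).1 h.2⟩) hj e0 (by linear_combination e1)
    (by linear_combination 2 * e2 + ρ B ^ p * ρ X * hc2 + ρ B ^ p * ρ Y * c2 j)
    (by linear_combination 6 * e3' - ρ X * hc3 - ρ Y * c3 j) with h | h | ⟨h, h' | h'⟩
  · exact Or.inl ⟨h.1, (hρ _).1 h.2⟩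
  · exact Or.inr (Or.inl ⟨h.1, (hρ _).1 h.2⟩)
  · refine Or.inr (Or.inr ⟨h, Or.inl ?_⟩)
    simpa using (hρ (X - Y)).1 (by rw [map_sub, h', sub_self])
  · refine Or.inr (Or.inr ⟨h, Or.inr ?_⟩)
    simpa using (hρ (X + Y)).1 (by rw [map_add, h', neg_add_cancel])

end IsFermatField

end Residue

section FirstCase

open Module NumberField IsDedekindDomain HeightOneSpectrum Polynomial

section

variable {L : Type} [Field L] [NumberField L] {p : ℕ}

theorem isPrimitiveRoot_of_pow_eq_one {K : Type} [Field K] (hp : p.Prime) {ξ : K} (h : ξ ^ p = 1)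
    (h1 : ξ ≠ 1) : IsPrimitiveRoot ξ p := by
  have : Fact p.Prime := ⟨hp⟩
  rw [← orderOf_eq_prime h h1]
  exact IsPrimitiveRoot.orderOf ξ

theorem isPrimitiveRoot_div_of_pow_eq_one {K : Type} [Field K] (hp : p.Prime) {ξ ξ' : K}
    (h : ξ ^ p = 1) (h' : ξ' ^ p = 1) (hne : ξ ≠ ξ') : IsPrimitiveRoot (ξ / ξ') p := by
  have h0 : ξ' ≠ 0 := by
    rintro rfl
    rw [zero_pow hp.ne_zero] at h'
    exact zero_ne_one h'
  refine isPrimitiveRoot_of_pow_eq_one hp (by rw [div_pow, h, h', div_one]) fun hc => hne ?_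
  rwa [div_eq_one_iff_eq h0] at hc

theorem ord_sub_of_pow_eq_one (hp : p.Prime) {v : HeightOneSpectrum (𝓞 L)} {ξ ξ' : L}
    (h' : ξ' ^ p = 1) (hne : ξ ≠ ξ') : v.ord (ξ - ξ') = v.ord (ξ / ξ' - 1) := by
  have h0 : ξ' ≠ 0 := by
    rintro rfl
    rw [zero_pow hp.ne_zero] at h'
    exact zero_ne_one h'
  have e : ξ - ξ' = (ξ / ξ' - 1) * ξ' := by field_simp
  rw [e, ord_mul v _ h0, ord_eq_zero_of_pow_eq_one hp.ne_zero h', add_zero]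
  rw [sub_ne_zero, Ne, div_eq_one_iff_eq h0]
  exact hne

/-- The factors `x + ξ y` of `x ^ p + y ^ p`. -/
theorem add_mul_ne_zero_of_pow_eq_one {K : Type} [Field K] (hp : p.Prime) (hp2 : p ≠ 2)
    {x y w ξ : K} (hw : w ≠ 0)
    (h : x ^ p + y ^ p = w) (hξ : ξ ^ p = 1) : x + ξ * y ≠ 0 := by
  intro hc
  apply hw
  rw [← h, eq_neg_of_add_eq_zero_left hc, (hp.odd_of_ne_two hp2).neg_pow, mul_pow, hξ]
  ring

theorem ord_eq_sum_ord_add_mul (hp : p.Prime) (hp2 : p ≠ 2) {ζ : L} (hζ : IsPrimitiveRoot ζ p)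
    {x y w : L} (hw : w ≠ 0) (h : x ^ p + y ^ p = w) (v : HeightOneSpectrum (𝓞 L)) :
    v.ord w = ∑ ξ ∈ nthRootsFinset p (1 : L), v.ord (x + ξ * y) := by
  rw [← h, hζ.pow_add_pow_eq_prod_add_mul x y (hp.odd_of_ne_two hp2), ord_prod]
  intro ξ hξ
  exact add_mul_ne_zero_of_pow_eq_one hp hp2 hw h ((mem_nthRootsFinset hp.pos _).1 hξ)

/-- If all but one of the factors have order `n` then the order of the remaining one is
determined. -/
theorem ord_eq_add_of_forall_ne (hp : p.Prime) (hp2 : p ≠ 2) {ζ : L} (hζ : IsPrimitiveRoot ζ p)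
    {x y w : L} (hw : w ≠ 0) (h : x ^ p + y ^ p = w) {v : HeightOneSpectrum (𝓞 L)} {ξ : L}
    (hξ : ξ ^ p = 1) {n : ℤ} (hn : ∀ ξ' : L, ξ' ^ p = 1 → ξ' ≠ ξ → v.ord (x + ξ' * y) = n) :
    v.ord w = v.ord (x + ξ * y) + (p - 1) * n := by
  classical
  rw [ord_eq_sum_ord_add_mul hp hp2 hζ hw h v,
    ← Finset.add_sum_erase _ _ ((mem_nthRootsFinset hp.pos _).2 hξ)]
  congr 1
  rw [Finset.sum_congr rfl (g := fun _ => n), Finset.sum_const, Finset.card_erase_of_mem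
    ((mem_nthRootsFinset hp.pos _).2 hξ), hζ.card_nthRootsFinset, nsmul_eq_mul,
    Nat.cast_sub hp.pos, Nat.cast_one]
  intro ξ' hξ'
  rw [Finset.mem_erase] at hξ'
  exact hn ξ' ((mem_nthRootsFinset hp.pos _).1 hξ'.2) hξ'.1

/-- Away from `p`, at most one of the factors `x + ξ y` has order larger than the minimum of the
orders of `x` and `y`. -/
theorem ord_add_mul_of_not_leOrd (hp : p.Prime) (hp2 : p ≠ 2) {ζ : L} (hζ : IsPrimitiveRoot ζ p)
    {x y w : L} (hx : x ≠ 0) (hy : y ≠ 0) (hw : w ≠ 0) (h : x ^ p + y ^ p = w)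
    {v : HeightOneSpectrum (𝓞 L)} (hv : ¬ v.LeOrd 1 (p : L)) {ξ : L} (hξ : ξ ^ p = 1) :
    v.ord (x + ξ * y) = min (v.ord x) (v.ord y) ∨
    (min (v.ord x) (v.ord y) < v.ord (x + ξ * y) ∧
      v.ord (x + ξ * y) - min (v.ord x) (v.ord y) = v.ord w - p * min (v.ord x) (v.ord y) ∧
      ∀ ξ' : L, ξ' ^ p = 1 → ξ' ≠ ξ → v.ord (x + ξ' * y) = min (v.ord x) (v.ord y)) := by
  set m := min (v.ord x) (v.ord y) with hm
  have hord : ∀ ξ : L, ξ ^ p = 1 → v.ord ξ = 0 := fun ξ hξ =>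
    ord_eq_zero_of_pow_eq_one hp.ne_zero hξ v
  have hne : ∀ ξ : L, ξ ^ p = 1 → ξ ≠ 0 := by
    rintro ξ h' rfl
    rw [zero_pow hp.ne_zero] at h'
    exact zero_ne_one h'
  have hge : ∀ ξ : L, ξ ^ p = 1 → v.LeOrd m (x + ξ * y) := by
    intro ξ hξ
    refine LeOrd.add (leOrd_of_le_ord (min_le_left _ _)) (leOrd_of_le_ord ?_)
    rw [ord_mul v (hne ξ hξ) hy, hord ξ hξ, zero_add]
    exact min_le_right _ _
  by_cases h1 : v.LeOrd (m + 1) (x + ξ * y)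
  swap
  · exact Or.inl (ord_eq_of_leOrd_of_not (hge ξ hξ) h1)
  right
  have hoth : ∀ ξ' : L, ξ' ^ p = 1 → ξ' ≠ ξ → v.ord (x + ξ' * y) = m := by
    intro ξ' hξ' hξξ'
    refine ord_eq_of_leOrd_of_not (hge ξ' hξ') fun h2 => ?_
    have hd : v.ord (ξ' - ξ) = 0 := by
      rw [ord_sub_of_pow_eq_one hp hξ hξξ']
      exact ord_primitive_sub_one_of_not hp hv
        (isPrimitiveRoot_div_of_pow_eq_one hp hξ' hξ hξξ')
    have hd0 : ξ' - ξ ≠ 0 := sub_ne_zero.2 hξξ'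
    have e1 : v.LeOrd (m + 1) ((ξ' - ξ) * y) := by
      have := h2.sub h1
      convert this using 1
      ring
    have e2 : v.LeOrd (m + 1) ((ξ' - ξ) * x) := by
      have f1 : v.LeOrd 0 ξ := leOrd_of_le_ord (hord ξ hξ).ge
      have f2 : v.LeOrd 0 ξ' := leOrd_of_le_ord (hord ξ' hξ').ge
      have := (f2.mul h1).sub (f1.mul h2)
      rw [zero_add] at this
      convert this using 1
      ring
    rw [leOrd_iff v (mul_ne_zero hd0 hy), ord_mul v hd0 hy, hd] at e1
    rw [leOrd_iff v (mul_ne_zero hd0 hx), ord_mul v hd0 hx, hd] at e2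
    omega
  refine ⟨?_, ?_, hoth⟩
  · rw [leOrd_iff v (add_mul_ne_zero_of_pow_eq_one hp hp2 hw h hξ)] at h1
    omega
  · rw [ord_eq_add_of_forall_ne hp hp2 hζ hw h hξ hoth]
    ring

theorem dvd_ord_add_mul_sub (hp : p.Prime) (hp2 : p ≠ 2) {ζ : L} (hζ : IsPrimitiveRoot ζ p)
    {x y w : L} (hx : x ≠ 0) (hy : y ≠ 0) (hw : w ≠ 0) (h : x ^ p + y ^ p = w)
    {v : HeightOneSpectrum (𝓞 L)} (hv : ¬ v.LeOrd 1 (p : L)) (hdvd : (p : ℤ) ∣ v.ord w) {ξ : L}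
    (hξ : ξ ^ p = 1) : (p : ℤ) ∣ v.ord (x + ξ * y) - min (v.ord x) (v.ord y) := by
  rcases ord_add_mul_of_not_leOrd hp hp2 hζ hx hy hw h hv hξ with h1 | ⟨-, h1, -⟩
  · rw [h1, sub_self]
    exact dvd_zero _
  · rw [h1]
    exact dvd_sub hdvd (dvd_mul_right _ _)

end

namespace IsFermatField

variable {L : Type} [Field L] [NumberField L] {p : ℕ} {k : Subfield L} {ζ : L} {τ : L →+* L}

/-- Comparison of `x` and `y` at the primes above `p`, for a solution in `k`. -/
theorem first_case_local (H : IsFermatField p k ζ τ) (hp : p.Prime) (hp5 : 5 ≤ p)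
    {x y z : L} (hx : x ∈ k) (hy : y ∈ k) (hx0 : x ≠ 0) (hy0 : y ≠ 0) (hz0 : z ≠ 0)
    (h : x ^ p + y ^ p + z ^ p = 0) : ∃ j : ℕ, ∀ v : HeightOneSpectrum (𝓞 L), v.LeOrd 1 (p : L) →
      (j = 0 ∧ v.ord x < v.ord y) ∨ (j = 2 ∧ v.ord y < v.ord x) ∨
      (j = 1 ∧ v.ord x = v.ord y ∧
        (v.LeOrd (v.ord x + 1) (x - y) ∨ v.LeOrd (v.ord x + 1) (x + y))) := by
  have hp2 : p ≠ 2 := by omega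
  have hζ := H.primitive
  have hζ0 := H.zeta_ne_zero hp
  have hw : -z ^ p ≠ 0 := neg_ne_zero.2 (pow_ne_zero _ hz0)
  have hxyw : x ^ p + y ^ p = -z ^ p := by linear_combination h
  have hζi : (ζ⁻¹) ^ p = 1 := by rw [inv_pow, hζ.pow_eq_one, inv_one]
  have hn1 := add_mul_ne_zero_of_pow_eq_one hp hp2 hw hxyw hζ.pow_eq_one
  have hn2 := add_mul_ne_zero_of_pow_eq_one hp hp2 hw hxyw hζi
  have hτ1 : τ (x + ζ * y) = x + ζ⁻¹ * y := by
    rw [map_add, map_mul, H.conj_zeta, H.conj_of_mem x hx, H.conj_of_mem y hy]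
  have hτ2 : τ (x + ζ⁻¹ * y) = x + ζ * y := by rw [← hτ1, H.conj_conj]
  set R := (x + ζ * y) / (x + ζ⁻¹ * y) with hR
  have hR0 : R ≠ 0 := div_ne_zero hn1 hn2
  have hRτ : R * τ R = 1 := by
    rw [hR, map_div₀, hτ1, hτ2, div_mul_div_cancel₀ hn2, div_self hn1]
  have hRP : ∀ v : HeightOneSpectrum (𝓞 L), v.LeOrd 1 (p : L) → v.ord R = 0 := by
    intro v hv
    rw [hR, ord_div v hn1 hn2, ← hτ1, H.ord_conj v hv, sub_self]
  obtain ⟨j, β, hj, hβ⟩ := H.exists_eq_zeta_pow_mul_pow hp hp5 hRτ (by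
    intro v
    by_cases hv : v.LeOrd 1 (p : L)
    · rw [hRP v hv]
      exact dvd_zero _
    · have hdvd : (p : ℤ) ∣ v.ord (-z ^ p) := by
        rw [ord_neg, ord_pow]
        exact dvd_mul_right _ _
      rw [hR, ord_div v hn1 hn2]
      have := dvd_sub (dvd_ord_add_mul_sub hp hp2 hζ hx0 hy0 hw hxyw hv hdvd hζ.pow_eq_one)
        (dvd_ord_add_mul_sub hp hp2 hζ hx0 hy0 hw hxyw hv hdvd hζi)
      rwa [sub_sub_sub_cancel_right] at this)
  refine ⟨j, fun v hv => ?_⟩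
  have hβ0 : β ≠ 0 := by
    rintro rfl
    rw [zero_pow hp.ne_zero, mul_zero] at hβ
    exact hR0 hβ
  have hβo : v.ord β = 0 := by
    have h1 := hRP v hv
    rw [hβ, ord_mul v (pow_ne_zero _ hζ0) (pow_ne_zero _ hβ0), ord_pow, ord_pow,
      H.ord_zeta hp, mul_zero, zero_add] at h1
    rcases mul_eq_zero.1 h1 with h2 | h2
    · exact absurd (by exact_mod_cast h2) hp.ne_zero
    · exact h2
  have heq : x + ζ * y = ζ ^ j * β ^ p * (x + ζ⁻¹ * y) := by
    rw [← hβ, hR, div_mul_cancel₀ _ hn2]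
  obtain ⟨u, huk, hu0, hux, huy, hxy⟩ : ∃ u ∈ k, u ≠ 0 ∧ v.ord u ≤ v.ord x ∧ v.ord u ≤ v.ord y ∧
      (v.ord u = v.ord x ∨ v.ord u = v.ord y) := by
    rcases le_total (v.ord x) (v.ord y) with h1 | h1
    · exact ⟨x, hx, hx0, le_rfl, h1, Or.inl rfl⟩
    · exact ⟨y, hy, hy0, h1, le_rfl, Or.inr rfl⟩
  have hdiv : ∀ {t : L} {n : ℤ}, v.LeOrd n (t / u) ↔ v.LeOrd (v.ord u + n) t := by
    intro t n
    by_cases ht : t = 0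
    · rw [ht, zero_div]
      exact iff_of_true (v.leOrd_zero _) (v.leOrd_zero _)
    · rw [leOrd_iff v (div_ne_zero ht hu0), leOrd_iff v ht, ord_div v ht hu0]
      omega
  rcases H.first_case_local_of_leOrd hp hp5 hv (div_mem hx huk) (div_mem hy huk)
    (hdiv.2 (leOrd_of_le_ord (by omega))) (hdiv.2 (leOrd_of_le_ord (by omega)))
    (by
      rw [hdiv, hdiv, leOrd_iff v hx0, leOrd_iff v hy0]
      omega)
    (leOrd_of_le_ord hβo.ge) (not_leOrd_of_ord_lt hβ0 (by omega)) hj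
    (by rw [← mul_div_assoc, ← mul_div_assoc, ← add_div, ← add_div, heq, mul_div_assoc])
    with ⟨h1, h2⟩ | ⟨h1, h2⟩ | ⟨h1, h2⟩
  · rw [hdiv, leOrd_iff v hy0] at h2
    exact Or.inl ⟨h1, by omega⟩
  · rw [hdiv, leOrd_iff v hx0] at h2
    exact Or.inr (Or.inl ⟨h1, by omega⟩)
  · rw [← sub_div, ← add_div, hdiv, hdiv] at h2
    have hxy' : v.ord x = v.ord y := by
      by_contra hne
      have hlt : ∀ {a b : L}, a ≠ 0 → v.ord u = v.ord a → v.ord a < v.ord b →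
          ¬ v.LeOrd (v.ord u + 1) (a + b) := by
        intro a b ha hua hab
        exact not_leOrd_add (not_leOrd_of_ord_lt ha (by omega)) (leOrd_of_le_ord (by omega))
      rcases lt_or_gt_of_ne hne with h3 | h3
      · rcases h2 with h2 | h2
        · rw [sub_eq_add_neg] at h2
          exact hlt hx0 (by omega) (by rwa [ord_neg]) h2
        · exact hlt hx0 (by omega) h3 h2
      · rcases h2 with h2 | h2
        · have := h2.neg
          rw [neg_sub, sub_eq_add_neg] at this
          exact hlt hy0 (by omega) (by rwa [ord_neg]) this
        · rw [add_comm x y] at h2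
          exact hlt hy0 (by omega) h3 h2
    have hux' : v.ord u = v.ord x := by omega
    rw [hux'] at h2
    exact Or.inr (Or.inr ⟨h1, hxy', h2⟩)

/-- Congruent elements of the same order have congruent `p`-th powers. -/
theorem _root_.leOrd_pow_sub_pow_of_leOrd {v : HeightOneSpectrum (𝓞 L)} {a b : L} {m : ℤ}
    (hb : v.LeOrd m b) (h : v.LeOrd (m + 1) (a - b)) (n : ℕ) (hn : n ≠ 0) :
    v.LeOrd (n * m + 1) (a ^ n - b ^ n) := by
  have ha : v.LeOrd m a := by simpa using (h.mono (by omega : m ≤ m + 1)).add hb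
  rw [← geom_sum₂_mul]
  have h1 : v.LeOrd ((n - 1 : ℕ) * m) (∑ i ∈ Finset.range n, a ^ i * b ^ (n - 1 - i)) := by
    refine LeOrd.sum fun i hi => ((ha.pow i).mul (hb.pow (n - 1 - i))).mono (le_of_eq ?_)
    rw [Finset.mem_range] at hi
    rw [← add_mul]
    congr 1
    omega
  refine (h1.mul h).mono (le_of_eq ?_)
  rw [Nat.cast_sub (by omega)]
  push_cast
  ring

/-- For a solution of Fermat's equation in `k`, the same variable is divisible by
all the primes above `p`. -/
theorem first_case (H : IsFermatField p k ζ τ) (hp : p.Prime) (hp5 : 5 ≤ p)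
    {x y z : L} (hx : x ∈ k) (hy : y ∈ k) (hz : z ∈ k) (hx0 : x ≠ 0) (hy0 : y ≠ 0) (hz0 : z ≠ 0)
    (h : x ^ p + y ^ p + z ^ p = 0) :
    (∀ v : HeightOneSpectrum (𝓞 L), v.LeOrd 1 (p : L) → v.ord x = v.ord z ∧ v.ord x < v.ord y) ∨
    (∀ v : HeightOneSpectrum (𝓞 L), v.LeOrd 1 (p : L) → v.ord y = v.ord z ∧ v.ord y < v.ord x) ∨
    (∀ v : HeightOneSpectrum (𝓞 L), v.LeOrd 1 (p : L) → v.ord x = v.ord y ∧ v.ord x < v.ord z) := by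
  have hodd := hp.odd_of_ne_two (by omega)
  have hp0 : (0 : ℤ) < p := by exact_mod_cast hp.pos
  -- if `a` has the smallest order then `z` has the same one
  have hz_of_lt : ∀ (v : HeightOneSpectrum (𝓞 L)) {a b : L}, a ≠ 0 → a ^ p + b ^ p + z ^ p = 0 →
      v.ord a < v.ord b → v.ord a = v.ord z := by
    intro v a b ha hab hlt
    have h1 : v.ord (a ^ p + b ^ p) = v.ord (a ^ p) := by
      refine ord_add_eq_of_leOrd (pow_ne_zero _ ha) (leOrd_of_le_ord ?_)
      rw [ord_pow, ord_pow]
      nlinarith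
    rw [eq_neg_of_add_eq_zero_left hab, ord_neg, ord_pow, ord_pow] at h1
    exact (mul_left_cancel₀ hp0.ne' h1).symm
  obtain ⟨j, hj⟩ := H.first_case_local hp hp5 hx hy hx0 hy0 hz0 h
  obtain ⟨j', hj'⟩ := H.first_case_local hp hp5 hx hz hx0 hz0 hy0 (by linear_combination h)
  have key : ∀ v : HeightOneSpectrum (𝓞 L), v.LeOrd 1 (p : L) →
      (j = 0 ∧ v.ord x = v.ord z ∧ v.ord x < v.ord y) ∨
      (j = 2 ∧ v.ord y = v.ord z ∧ v.ord y < v.ord x) ∨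
      (j = 1 ∧ v.ord x = v.ord y ∧ v.ord x < v.ord z) := by
    intro v hv
    rcases hj v hv with ⟨h1, h2⟩ | ⟨h1, h2⟩ | ⟨h1, h2, h3⟩
    · exact Or.inl ⟨h1, hz_of_lt v hx0 h h2, h2⟩
    · exact Or.inr (Or.inl ⟨h1, hz_of_lt v hy0 (by linear_combination h) h2, h2⟩)
    · refine Or.inr (Or.inr ⟨h1, h2, ?_⟩)
      have hxp : v.ord (x ^ p) = p * v.ord x := ord_pow v x p
      have hsame : ∀ {a : L}, a ≠ 0 → v.ord x = v.ord a →
          (v.LeOrd (v.ord x + 1) (x - a) ∨ v.LeOrd (v.ord x + 1) (x + a)) →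
          v.LeOrd (v.ord (x ^ p) + 1) (x ^ p - a ^ p) ∨
          v.LeOrd (v.ord (x ^ p) + 1) (x ^ p + a ^ p) := by
        intro a ha hxa h4
        rw [hxp]
        rcases h4 with h4 | h4
        · exact Or.inl (leOrd_pow_sub_pow_of_leOrd (leOrd_of_le_ord hxa.le) h4 p hp.ne_zero)
        · right
          have := leOrd_pow_sub_pow_of_leOrd (a := x) (b := -a) (v := v) (m := v.ord x)
            (leOrd_of_le_ord (by rw [ord_neg]; exact hxa.le)) (by rwa [sub_neg_eq_add]) p hp.ne_zero
          rwa [hodd.neg_pow, sub_neg_eq_add] at this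
      have hzgt : v.LeOrd (v.ord (x ^ p) + 1) (z ^ p) → v.ord x < v.ord z := by
        intro h4
        rw [leOrd_iff v (pow_ne_zero _ hz0), hxp, ord_pow] at h4
        by_contra hc
        push Not at hc
        nlinarith
      have hnat : ∀ n : ℕ, ¬ p ∣ n → n ≠ 0 → ¬ v.LeOrd (v.ord (x ^ p) + 1) (n * x ^ p) := by
        intro n hn hn0
        have : (n : L) ≠ 0 := by exact_mod_cast hn0
        refine not_leOrd_of_ord_lt (mul_ne_zero this (pow_ne_zero _ hx0)) ?_
        rw [ord_mul v this (pow_ne_zero _ hx0), ord_natCast_eq_zero hp hv hn]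
        omega
      have hsmall : ∀ n : ℕ, 0 < n → n < 5 → ¬ p ∣ n := fun n hn hn5 hd => by
        have := Nat.le_of_dvd hn hd
        omega
      rcases hsame hy0 h2 h3 with h4 | h4
      · by_contra hc
        have hnz : ¬ v.LeOrd (v.ord (x ^ p) + 1) (z ^ p) := fun h5 => hc (hzgt h5)
        rcases hj' v hv with ⟨-, h5⟩ | ⟨-, h5⟩ | ⟨-, h5, h6⟩
        · exact hc h5
        · have h6 : v.LeOrd (v.ord (z ^ p) + 1) (z ^ p) := by
            have e1 : v.ord (z ^ p) + 1 ≤ v.ord (x ^ p) := by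
              rw [ord_pow, hxp]
              nlinarith
            have e2 : v.ord (z ^ p) + 1 ≤ v.ord (y ^ p) := by
              rw [ord_pow v y, ← h2, ← hxp]
              exact e1
            have := ((leOrd_of_le_ord e1).add (leOrd_of_le_ord e2)).neg
            rwa [← eq_neg_of_add_eq_zero_right h] at this
          exact not_leOrd_of_ord_lt (pow_ne_zero _ hz0) (by omega) h6
        · rcases hsame hz0 h5 h6 with h7 | h7
          · refine hnat 3 (hsmall 3 (by omega) (by omega)) (by omega) ?_
            have := h4.add h7
            convert this using 1
            push_cast
            linear_combination h
          · refine hnat 1 (hsmall 1 (by omega) (by omega)) (by omega) ?_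
            have := h4.sub h7
            convert this using 1
            push_cast
            linear_combination h
      · apply hzgt
        have := h4.neg
        rwa [← eq_neg_of_add_eq_zero_right h] at this
  obtain ⟨v₀, hv₀⟩ := exists_leOrd_one_prime L hp
  rcases key v₀ hv₀ with ⟨h1, -⟩ | ⟨h1, -⟩ | ⟨h1, -⟩
  · exact Or.inl fun v hv => by have := key v hv; omega
  · exact Or.inr (Or.inl fun v hv => by have := key v hv; omega)
  · exact Or.inr (Or.inr fun v hv => by have := key v hv; omega)

end IsFermatField

end FirstCase

section PowerLemmas

open Module NumberField IsDedekindDomain HeightOneSpectrum Polynomial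

section

variable {L : Type} [Field L] [NumberField L] {p : ℕ}

theorem leOrd_one_sub_of_pow_sub_pow (hp : p.Prime) {v : HeightOneSpectrum (𝓞 L)}
    (hv : v.LeOrd 1 (p : L)) {x y : L} (hx : v.LeOrd 0 x) (hy : v.LeOrd 0 y)
    (h : v.LeOrd 1 (x ^ p - y ^ p)) : v.LeOrd 1 (x - y) := by
  obtain ⟨κ, _, O, ρ, hO, hρ⟩ := exists_residue_hom v
  have hchar : CharP κ p := by
    have h1 : (p : κ) = 0 := by
      rw [← map_natCast ρ p, hρ]
      simpa using hv
    exact (CharP.ringChar_of_prime_eq_zero hp h1) ▸ ringChar.charP κ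
  have : Fact p.Prime := ⟨hp⟩
  let x' : O := ⟨x, (hO x).2 hx⟩
  let y' : O := ⟨y, (hO y).2 hy⟩
  have h1 : ρ (x' ^ p - y' ^ p) = 0 := (hρ _).2 h
  have h2 : ρ (x' - y') = 0 := by
    rw [map_sub, map_pow, map_pow, ← sub_pow_char] at h1
    rw [map_sub]
    exact pow_eq_zero_iff hp.ne_zero |>.1 h1
  exact (hρ _).1 h2

/-- An integer is a `p`-th power modulo all the primes above `p`. -/
theorem exists_leOrd_one_pow_sub (hp : p.Prime) (x : 𝓞 L) :
    ∃ a : 𝓞 L, ∀ v : HeightOneSpectrum (𝓞 L), v.LeOrd 1 (p : L) →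
      v.LeOrd 1 ((a : L) ^ p - (x : L)) := by
  have hp0 : (Ideal.span {(p : 𝓞 L)}) ≠ ⊥ := by
    rw [Ne, Ideal.span_singleton_eq_bot]
    exact_mod_cast hp.ne_zero
  have : Finite (𝓞 L ⧸ Ideal.span {(p : 𝓞 L)}) := Ideal.finiteQuotientOfFreeOfNeBot _ hp0
  obtain ⟨i, j, hij, h⟩ : ∃ i j : ℕ, i < j ∧ (p : 𝓞 L) ∣ x ^ p ^ j - x ^ p ^ i := by
    obtain ⟨i, j, hij, h⟩ := Finite.exists_ne_map_eq_of_infinite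
      (fun n : ℕ => Ideal.Quotient.mk (Ideal.span {(p : 𝓞 L)}) (x ^ p ^ n))
    rw [Ideal.Quotient.eq, Ideal.mem_span_singleton] at h
    rcases lt_or_gt_of_ne hij with h1 | h1
    · exact ⟨i, j, h1, (dvd_sub_comm).1 h⟩
    · exact ⟨j, i, h1, h⟩
  refine ⟨x ^ p ^ (j - i - 1), fun v hv => ?_⟩
  have hx : v.LeOrd 0 (x : L) := v.leOrd_algebraMap x
  have hxn : ∀ n : ℕ, v.LeOrd 0 ((x : L) ^ n) := fun n => by simpa using hx.pow n
  have key : ∀ a : ℕ, v.LeOrd 1 ((x : L) ^ p ^ (a + (j - i)) - (x : L) ^ p ^ a) →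
      v.LeOrd 1 ((x : L) ^ p ^ (j - i) - (x : L)) := by
    intro a
    induction a with
    | zero => simp
    | succ a ih =>
      intro h1
      refine ih (leOrd_one_sub_of_pow_sub_pow hp hv (hxn _) (hxn _) ?_)
      rwa [← pow_mul, ← pow_mul, ← pow_succ, ← pow_succ, add_right_comm]
  have h1 : v.LeOrd 1 ((x : L) ^ p ^ (j - i) - (x : L)) := by
    refine key i ?_
    obtain ⟨c, hc⟩ := h
    have h2 : (x : L) ^ p ^ (i + (j - i)) - (x : L) ^ p ^ i = (p : L) * (c : L) := by
      rw [Nat.add_sub_cancel' hij.le]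
      simpa using congrArg (algebraMap (𝓞 L) L) hc
    rw [h2]
    simpa using hv.mul (v.leOrd_algebraMap (K := L) c)
  have h3 : ((x ^ p ^ (j - i - 1) : 𝓞 L) : L) ^ p = (x : L) ^ p ^ (j - i) := by
    rw [RingOfIntegers.coe_eq_algebraMap, map_pow, ← pow_mul, ← pow_succ]
    congr 2
    omega
  rwa [h3]

end

namespace IsFermatField

variable {L : Type} [Field L] [NumberField L] {p : ℕ} {k : Subfield L} {ζ : L} {τ : L →+* L}

theorem exists_pow_eq_of_leOrd (H : IsFermatField p k ζ τ) (hp : p.Prime) (hp2 : p ≠ 2)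
    {ε s : L} (hε0 : ε ≠ 0) (hε : ∀ v : HeightOneSpectrum (𝓞 L), v.ord ε = 0)
    (h : ∀ v : HeightOneSpectrum (𝓞 L), v.LeOrd 1 (p : L) → v.LeOrd 0 s ∧ v.LeOrd p (ε - s ^ p)) :
    ∃ b : L, b ^ p = ε := by
  have : Fact p.Prime := ⟨hp⟩
  obtain ⟨u, hu⟩ := exists_unit_eq_of_ord_eq_zero (R := 𝓞 L) hε0 hε
  obtain ⟨a, ha⟩ := exists_leOrd_one_pow_sub hp (u : 𝓞 L)
  have hp1 : (1 : ℤ) ≤ p := by exact_mod_cast hp.one_le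
  have hap : ∀ v : HeightOneSpectrum (𝓞 L), v.LeOrd 1 (p : L) → v.LeOrd p ((a : L) ^ p - ε) := by
    intro v hv
    obtain ⟨h1, h2⟩ := h v hv
    have h3 := ha v hv
    rw [RingOfIntegers.coe_eq_algebraMap (u : 𝓞 L), hu] at h3
    have h4 := h3.add (h2.mono hp1)
    rw [sub_add_sub_cancel] at h4
    have h5 := leOrd_one_sub_of_pow_sub_pow hp hv (v.leOrd_algebraMap a) h1 h4
    have h6 := leOrd_pow_sub_pow hp (leOrd_of_le_ord (H.ord_prime v hv).ge) h1 h5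
    have := h6.sub h2
    rwa [sub_sub_sub_cancel_right] at this
  have hζ1 : ζ - 1 ≠ 0 := sub_ne_zero.2 (H.primitive.ne_one hp.one_lt)
  obtain ⟨q, hq⟩ := exists_algebraMap_eq_of_leOrd (R := 𝓞 L)
    (x := ((a : L) ^ p - ε) / (ζ - 1) ^ p) fun v => by
      by_cases h0 : (a : L) ^ p - ε = 0
      · rw [h0, zero_div]
        exact v.leOrd_zero _
      have h1 := pow_ne_zero p hζ1
      rw [leOrd_iff v (div_ne_zero h0 h1), ord_div v h0 h1, ord_pow]
      by_cases hv : v.LeOrd 1 (p : L)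
      · have h2 := (leOrd_iff v h0).1 (hap v hv)
        rw [H.ord_zeta_sub_one v hv]
        omega
      · rw [ord_primitive_sub_one_of_not hp hv H.primitive]
        have h2 : v.LeOrd 0 ((a : L) ^ p - ε) := by
          refine LeOrd.sub ?_ (leOrd_of_le_ord (hε v).ge)
          simpa using (v.leOrd_algebraMap (K := L) a).pow p
        have := (leOrd_iff v h0).1 h2
        omega
  rw [← hu]
  refine exists_pow_eq_of_unit_congr hp2 H.not_dvd_classNumber H.primitive u a ⟨q, ?_⟩
  apply FaithfulSMul.algebraMap_injective (𝓞 L) L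
  rw [map_sub, map_mul, map_pow, map_pow, hq, hu, map_sub, map_one]
  change _ = (ζ - 1) ^ p * _
  rw [mul_div_cancel₀ _ (pow_ne_zero _ hζ1)]

/-- A real unit that is a `p`-th power modulo `P ^ p` for all `P` above `p` is the `p`-th power of a
real unit. -/
theorem exists_conj_eq_pow_eq (H : IsFermatField p k ζ τ) (hp : p.Prime) (hp2 : p ≠ 2)
    {ε s : L} (hε0 : ε ≠ 0) (hετ : τ ε = ε) (hε : ∀ v : HeightOneSpectrum (𝓞 L), v.ord ε = 0)
    (h : ∀ v : HeightOneSpectrum (𝓞 L), v.LeOrd 1 (p : L) → v.LeOrd 0 s ∧ v.LeOrd p (ε - s ^ p)) :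
    ∃ b : L, τ b = b ∧ b ^ p = ε := by
  obtain ⟨b, hb⟩ := H.exists_pow_eq_of_leOrd hp hp2 hε0 hε h
  obtain ⟨n, hn⟩ := hp.odd_of_ne_two hp2
  refine ⟨(b * τ b) ^ (n + 1) / ε, ?_, ?_⟩
  · rw [map_div₀, map_pow, map_mul, H.conj_conj, hετ, mul_comm]
  · have h1 : (b * τ b) ^ p = ε ^ 2 := by rw [mul_pow, ← map_pow, hb, hετ, sq]
    rw [div_pow, ← pow_mul, mul_comm (n + 1) p, pow_mul, h1, ← pow_mul,
      div_eq_iff (pow_ne_zero _ hε0), ← pow_succ']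
    congr 1
    omega

/-- A real element whose divisor is a `p`-th power is a real unit times the `p`-th power of a real
element. -/
theorem exists_conj_eq_mul_pow (H : IsFermatField p k ζ τ) (hp : p.Prime) (hp2 : p ≠ 2)
    {t : L} (ht0 : t ≠ 0) (htτ : τ t = t) (h : ∀ v : HeightOneSpectrum (𝓞 L), (p : ℤ) ∣ v.ord t) :
    ∃ ε s : L, ε ≠ 0 ∧ s ≠ 0 ∧ τ ε = ε ∧ τ s = s ∧ (∀ v : HeightOneSpectrum (𝓞 L), v.ord ε = 0) ∧
      t = ε * s ^ p := by
  have hcl : p.Coprime (Fintype.card (ClassGroup (𝓞 L))) :=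
    (Nat.Prime.coprime_iff_not_dvd hp).2 H.not_dvd_classNumber
  obtain ⟨u, s, hs0, hts⟩ := exists_unit_mul_pow hp.ne_zero hcl ht0 h
  obtain ⟨n, hn⟩ := hp.odd_of_ne_two hp2
  set e := algebraMap (𝓞 L) L u with he
  have he0 : e ≠ 0 := by
    intro h0
    rw [h0, zero_mul] at hts
    exact ht0 hts
  have hτ0 : ∀ {x : L}, x ≠ 0 → τ x ≠ 0 := fun hx => (map_ne_zero τ).2 hx
  have hε0 : (e * τ e) ^ (n + 1) ≠ 0 := pow_ne_zero _ (mul_ne_zero he0 (hτ0 he0))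
  have hr0 : (s * τ s) ^ (n + 1) / t ≠ 0 :=
    div_ne_zero (pow_ne_zero _ (mul_ne_zero hs0 (hτ0 hs0))) ht0
  have hunit : ∀ v : HeightOneSpectrum (𝓞 L), v.ord (τ e) = 0 := by
    intro v
    have : τ e = algebraMap (𝓞 L) L (Units.map (RingOfIntegers.mapRingHom τ).toMonoidHom u) := rfl
    rw [this]
    exact v.ord_algebraMap_unit _
  refine ⟨(e * τ e) ^ (n + 1), (s * τ s) ^ (n + 1) / t, hε0, hr0, ?_, ?_, fun v => ?_, ?_⟩
  · rw [map_pow, map_mul, H.conj_conj, mul_comm]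
  · rw [map_div₀, map_pow, map_mul, H.conj_conj, htτ, mul_comm]
  · rw [ord_pow, ord_mul v he0 (hτ0 he0), hunit, he, ord_algebraMap_unit, add_zero, mul_zero]
  · have h1 : e * τ e * (s * τ s) ^ p = t ^ 2 := by
      have : τ e * (τ s) ^ p = t := by rw [← map_pow, ← map_mul, ← hts, htτ]
      rw [mul_pow]
      linear_combination τ e * (τ s) ^ p * (-hts) + t * this
    rw [div_pow, ← mul_div_assoc, eq_div_iff (pow_ne_zero _ ht0), ← pow_mul, mul_comm (n + 1) p,
      pow_mul, ← mul_pow, h1, ← pow_mul, ← pow_succ']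
    congr 1
    omega

end IsFermatField

end PowerLemmas

section DescentData

open Module NumberField IsDedekindDomain HeightOneSpectrum Polynomial

/-- A real solution of `x ^ p + y ^ p = η z ^ p`, with `η` a unit, in which `z` is more divisible
by the primes above `p` than `x` and `y` are. -/
structure IsDescentSolution {L : Type} [Field L] [NumberField L] (p : ℕ) (τ : L →+* L)
    (x y z η : L) : Prop where
  x_ne_zero : x ≠ 0
  y_ne_zero : y ≠ 0
  z_ne_zero : z ≠ 0
  unit_ne_zero : η ≠ 0
  conj_x : τ x = x
  conj_y : τ y = y
  conj_z : τ z = z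
  conj_unit : τ η = η
  ord_unit : ∀ v : HeightOneSpectrum (𝓞 L), v.ord η = 0
  equation : x ^ p + y ^ p = η * z ^ p
  ord_eq : ∀ v : HeightOneSpectrum (𝓞 L), v.LeOrd 1 (p : L) → v.ord x = v.ord y
  ord_lt : ∀ v : HeightOneSpectrum (𝓞 L), v.LeOrd 1 (p : L) → v.ord x < v.ord z

namespace IsDescentSolution

variable {L : Type} [Field L] [NumberField L] {p : ℕ} {τ : L →+* L} {x y z η : L}

theorem rhs_ne_zero (S : IsDescentSolution p τ x y z η) : η * z ^ p ≠ 0 :=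
  mul_ne_zero S.unit_ne_zero (pow_ne_zero _ S.z_ne_zero)

theorem ord_rhs (S : IsDescentSolution p τ x y z η) (v : HeightOneSpectrum (𝓞 L)) :
    v.ord (η * z ^ p) = p * v.ord z := by
  rw [ord_mul v S.unit_ne_zero (pow_ne_zero _ S.z_ne_zero), S.ord_unit, ord_pow, zero_add]

theorem factor_ne_zero (S : IsDescentSolution p τ x y z η) (hp : p.Prime) (hp2 : p ≠ 2) {ξ : L}
    (hξ : ξ ^ p = 1) : x + ξ * y ≠ 0 :=
  add_mul_ne_zero_of_pow_eq_one hp hp2 S.rhs_ne_zero S.equation hξ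

theorem add_ne_zero (S : IsDescentSolution p τ x y z η) (hp : p.Prime) (hp2 : p ≠ 2) :
    x + y ≠ 0 := by
  simpa using S.factor_ne_zero hp hp2 (one_pow p)

/-- The primes dividing `z` to a higher power than they divide `x` and `y`. -/
def support {L : Type} [Field L] [NumberField L] (x y z : L) : Set (HeightOneSpectrum (𝓞 L)) :=
  {v | min (v.ord x) (v.ord y) < v.ord z}

theorem finite_support (S : IsDescentSolution p τ x y z η) : (support x y z).Finite := by
  refine (((finite_ord_ne_zero (R := 𝓞 L) S.x_ne_zero).union
    (finite_ord_ne_zero (R := 𝓞 L) S.y_ne_zero)).union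
    (finite_ord_ne_zero (R := 𝓞 L) S.z_ne_zero)).subset fun v hv => ?_
  by_contra hc
  simp only [Set.mem_union, Set.mem_ofPred_eq, not_or, not_not] at hc
  have : min (v.ord x) (v.ord y) < v.ord z := hv
  omega

end IsDescentSolution

namespace IsFermatField

variable {L : Type} [Field L] [NumberField L] {p : ℕ} {k : Subfield L} {ζ : L} {τ : L →+* L}
  {x y z η : L}

theorem exists_pow_eq_one_of_mul_conj (H : IsFermatField p k ζ τ) {x : L} (hx : x * τ x = 1)
    (h : ∀ v : HeightOneSpectrum (𝓞 L), v.ord x = 0) : ∃ n ≠ 0, x ^ n = 1 := by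
  obtain ⟨a, ha⟩ := exists_algebraMap_eq_of_leOrd (R := 𝓞 L) (x := x)
    fun v => leOrd_of_le_ord (h v).ge
  obtain ⟨n, hn, hxn⟩ := NumberField.Embeddings.pow_eq_one_of_norm_eq_one L ℂ
    (x := x) (ha ▸ RingOfIntegers.isIntegral_coe a) (by
      intro φ
      have h1 := congrArg (fun t => ‖φ t‖) hx
      simp only [map_mul, map_one, norm_mul, norm_one, H.embed_conj, Complex.norm_conj] at h1
      nlinarith [norm_nonneg (φ x)])
  exact ⟨n, hn.ne', hxn⟩

/-- A root of unity congruent to `1` modulo `P ^ 2` is trivial. -/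
theorem eq_one_of_leOrd_two (H : IsFermatField p k ζ τ) (hp : p.Prime) (hp5 : 5 ≤ p)
    {v : HeightOneSpectrum (𝓞 L)} (hv : v.LeOrd 1 (p : L)) {μ : L} {n : ℕ} (hn : n ≠ 0)
    (hμ : μ ^ n = 1) (h : v.LeOrd 2 (μ - 1)) : μ = 1 := by
  obtain ⟨m, i, hm, hi, him⟩ := H.exists_pow_eq_zeta_pow_of_pow_eq_one hp hp5 hn hμ
  have hμi : ∀ j : ℕ, v.LeOrd 0 (μ ^ j) := fun j =>
    leOrd_of_le_ord (by rw [ord_pow, ord_eq_zero_of_pow_eq_one hn hμ, mul_zero])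
  have hsum : ∀ m : ℕ, v.LeOrd 0 (∑ j ∈ Finset.range m, μ ^ j) := fun m =>
    LeOrd.sum fun j _ => hμi j
  have hpow : ∀ m : ℕ, v.LeOrd 2 (μ ^ m - 1) := by
    intro m
    have := (hsum m).mul h
    rwa [geom_sum_mul, zero_add] at this
  have hμm : μ ^ m = 1 := by
    rw [← him]
    by_contra hc
    have h1 := H.ord_primitive_sub_one hp hv (isPrimitiveRoot_of_pow_eq_one hp
      (by rw [← pow_mul, mul_comm, pow_mul, H.primitive.pow_eq_one, one_pow]) hc)
    have h2 := (leOrd_iff v (sub_ne_zero.2 hc)).1 (him ▸ hpow m)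
    omega
  have h1 : (∑ j ∈ Finset.range m, μ ^ j) * (μ - 1) = 0 := by rw [geom_sum_mul, hμm, sub_self]
  rcases mul_eq_zero.1 h1 with h2 | h2
  · exfalso
    have h3 : v.LeOrd 1 (∑ j ∈ Finset.range m, (μ ^ j - 1)) :=
      LeOrd.sum fun j _ => (hpow j).mono (by norm_num)
    rw [Finset.sum_sub_distrib, h2] at h3
    have h4 : v.LeOrd 1 (m : L) := by simpa using h3.neg
    have hm0 : (m : L) ≠ 0 := by
      intro h0
      exact hm (by rw [Nat.cast_eq_zero.1 h0]; exact dvd_zero p)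
    rw [leOrd_iff v hm0, ord_natCast_eq_zero hp hv hm] at h4
    omega
  · exact sub_eq_zero.1 h2

/-- The orders of the factors `x + ξ y` at the primes above `p`. -/
theorem ord_factor (H : IsFermatField p k ζ τ) (hp : p.Prime) (hp5 : 5 ≤ p)
    (S : IsDescentSolution p τ x y z η) {v : HeightOneSpectrum (𝓞 L)} (hv : v.LeOrd 1 (p : L)) :
    (∀ ξ : L, ξ ^ p = 1 → ξ ≠ 1 → v.ord (x + ξ * y) = v.ord x + 1) ∧
      v.ord (x + y) = p * v.ord z - (p - 1) * (v.ord x + 1) ∧ v.ord x + 2 ≤ v.ord z := by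
  have hp2 : p ≠ 2 := by omega
  have hp0 : (0 : ℤ) < p := by exact_mod_cast hp.pos
  have hxy := S.ord_eq v hv
  have hlt := S.ord_lt v hv
  have hxe := H.even_ord_of_conj_eq hp hp2 hv S.x_ne_zero S.conj_x
  have hze := H.even_ord_of_conj_eq hp hp2 hv S.z_ne_zero S.conj_z
  have hse := H.even_ord_of_conj_eq hp hp2 hv (S.add_ne_zero hp hp2)
    (by rw [map_add, S.conj_x, S.conj_y])
  have hlt2 : v.ord x + 2 ≤ v.ord z := by
    obtain ⟨a, ha⟩ := hxe
    obtain ⟨b, hb⟩ := hze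
    omega
  have hξy : ∀ ξ : L, ξ ^ p = 1 → ξ ≠ 1 → v.ord ((ξ - 1) * y) = v.ord x + 1 := by
    intro ξ hξ hξ1
    rw [ord_mul v (sub_ne_zero.2 hξ1) S.y_ne_zero,
      H.ord_primitive_sub_one hp hv (isPrimitiveRoot_of_pow_eq_one hp hξ hξ1), hxy, add_comm]
  have hw := S.ord_rhs v
  have hsum1 : v.LeOrd (v.ord x + 1) (x + y) := by
    by_contra hc
    have h0 : v.LeOrd (v.ord x) (x + y) := (v.leOrd_ord x).add (leOrd_of_le_ord hxy.le)
    have h1 : v.ord (x + y) = v.ord x := ord_eq_of_leOrd_of_not h0 hc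
    have h2 := ord_eq_add_of_forall_ne hp hp2 H.primitive S.rhs_ne_zero S.equation (v := v)
      (one_pow p) (n := v.ord x) fun ξ hξ hξ1 => by
        have e : x + ξ * y = x + y + (ξ - 1) * y := by ring
        rw [e, ord_add_eq_of_leOrd (S.add_ne_zero hp hp2) (leOrd_of_le_ord (by
          rw [hξy ξ hξ hξ1, h1])), h1]
    rw [one_mul, h1, hw] at h2
    nlinarith
  have hsum2 : v.ord x + 2 ≤ v.ord (x + y) := by
    rw [leOrd_iff v (S.add_ne_zero hp hp2)] at hsum1
    obtain ⟨a, ha⟩ := hxe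
    obtain ⟨b, hb⟩ := hse
    omega
  have hfac : ∀ ξ : L, ξ ^ p = 1 → ξ ≠ 1 → v.ord (x + ξ * y) = v.ord x + 1 := by
    intro ξ hξ hξ1
    have e : x + ξ * y = (ξ - 1) * y + (x + y) := by ring
    have h1 := hξy ξ hξ hξ1
    rw [e, ord_add_eq_of_leOrd (mul_ne_zero (sub_ne_zero.2 hξ1) S.y_ne_zero)
      (leOrd_of_le_ord (by rw [h1]; omega)), h1]
  refine ⟨hfac, ?_, hlt2⟩
  have h2 := ord_eq_add_of_forall_ne hp hp2 H.primitive S.rhs_ne_zero S.equation (v := v)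
    (one_pow p) hfac
  rw [one_mul, hw] at h2
  linarith

/-- Some factor `x + ξ y` with `ξ ≠ 1` is not a unit away from `p`, relatively to `x` and `y`. -/
theorem exists_ord_factor_ne (H : IsFermatField p k ζ τ) (hp : p.Prime) (hp5 : 5 ≤ p)
    (S : IsDescentSolution p τ x y z η) : ∃ v : HeightOneSpectrum (𝓞 L), ¬ v.LeOrd 1 (p : L) ∧
      ∃ ξ : L, ξ ^ p = 1 ∧ ξ ≠ 1 ∧ v.ord (x + ξ * y) ≠ min (v.ord x) (v.ord y) := by
  by_contra hc
  push Not at hc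
  have hp2 : p ≠ 2 := by omega
  have hζ := H.primitive
  have hζ0 := H.zeta_ne_zero hp
  have hζ1 : ζ ≠ 1 := hζ.ne_one hp.one_lt
  have hζi : ζ⁻¹ ^ p = 1 := by rw [inv_pow, hζ.pow_eq_one, inv_one]
  have hζi1 : ζ⁻¹ ≠ 1 := fun h => hζ1 (inv_eq_one.1 h)
  have hn1 := S.factor_ne_zero hp hp2 hζ.pow_eq_one
  have hn2 := S.factor_ne_zero hp hp2 hζi
  have hd1 : 1 - ζ ≠ 0 := sub_ne_zero.2 hζ1.symm
  have hd2 : 1 - ζ⁻¹ ≠ 0 := sub_ne_zero.2 hζi1.symm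
  set U := (x + ζ * y) / (1 - ζ) with hU
  set V := (x + ζ⁻¹ * y) / (1 - ζ⁻¹) with hV
  have hU0 : U ≠ 0 := div_ne_zero hn1 hd1
  have hV0 : V ≠ 0 := div_ne_zero hn2 hd2
  have hτU : τ U = V := by
    rw [hU, hV, map_div₀, map_add, map_mul, map_sub, map_one, H.conj_zeta, S.conj_x, S.conj_y]
  have hτV : τ V = U := by rw [← hτU, H.conj_conj]
  have hd : ∀ v : HeightOneSpectrum (𝓞 L), v.ord (1 - ζ⁻¹) = v.ord (1 - ζ) := by
    intro v
    have e : 1 - ζ⁻¹ = -(ζ⁻¹ * (1 - ζ)) := by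
      field_simp
      ring
    rw [e, ord_neg, ord_mul v (inv_ne_zero hζ0) hd1, ord_inv, H.ord_zeta hp, neg_zero, zero_add]
  have hUV : ∀ v : HeightOneSpectrum (𝓞 L), v.ord (U / V) = 0 := by
    intro v
    rw [ord_div v hU0 hV0, hU, hV, ord_div v hn1 hd1, ord_div v hn2 hd2, hd v]
    by_cases hv : v.LeOrd 1 (p : L)
    · obtain ⟨h1, -⟩ := H.ord_factor hp hp5 S hv
      rw [h1 ζ hζ.pow_eq_one hζ1, h1 ζ⁻¹ hζi hζi1, sub_self]
    · rw [hc v hv ζ hζ.pow_eq_one hζ1, hc v hv ζ⁻¹ hζi hζi1, sub_self]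
  obtain ⟨n, hn, hUVn⟩ := H.exists_pow_eq_one_of_mul_conj (x := U / V) (by
    rw [map_div₀, hτU, hτV]
    field_simp) hUV
  obtain ⟨v, hv⟩ := exists_leOrd_one_prime L hp
  obtain ⟨h1, h2, h3⟩ := H.ord_factor hp hp5 S hv
  have ho1 : v.ord (1 - ζ) = 1 := by
    rw [← ord_neg, neg_sub, H.ord_zeta_sub_one v hv]
  have hoV : v.ord V = v.ord x := by
    rw [hV, ord_div v hn2 hd2, hd, ho1, h1 ζ⁻¹ hζi hζi1]
    ring
  have hs0 := S.add_ne_zero hp hp2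
  have hone : U / V = 1 := by
    refine H.eq_one_of_leOrd_two hp hp5 hv hn hUVn ?_
    have e : U / V - 1 = ((x + y) / (1 - ζ) - (x + y) / (1 - ζ⁻¹)) / V := by
      rw [eq_div_iff hV0, sub_mul, div_mul_cancel₀ _ hV0, one_mul, hU, hV]
      field_simp
      ring
    have hbig : v.ord x + 3 ≤ v.ord (x + y) := by
      rw [h2]
      have : (5 : ℤ) ≤ p := by exact_mod_cast hp5
      nlinarith
    have h4 : v.LeOrd (v.ord x + 2) ((x + y) / (1 - ζ) - (x + y) / (1 - ζ⁻¹)) := by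
      refine LeOrd.sub (leOrd_of_le_ord ?_) (leOrd_of_le_ord ?_)
      · rw [ord_div v hs0 hd1, ho1]
        omega
      · rw [ord_div v hs0 hd2, hd, ho1]
        omega
    have h5 := h4.mul (leOrd_of_le_ord (n := -v.ord x) (x := V⁻¹) (by rw [ord_inv, hoV]))
    rw [e, div_eq_mul_inv _ V]
    exact h5.mono (by omega)
  rw [div_eq_one_iff_eq hV0, hU, hV, div_eq_div_iff hd1 hd2] at hone
  have h6 : (x + y) * (ζ - ζ⁻¹) = 0 := by
    linear_combination hone
  rcases mul_eq_zero.1 h6 with h7 | h7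
  · exact hs0 h7
  · have h8 : ζ ^ 2 = 1 := by
      rw [sub_eq_zero] at h7
      rw [sq]
      nth_rewrite 1 [h7]
      exact inv_mul_cancel₀ hζ0
    have := Nat.le_of_dvd two_pos ((hζ.pow_eq_one_iff_dvd 2).1 h8)
    omega

end IsFermatField

end DescentData

section Descent

open Module NumberField IsDedekindDomain HeightOneSpectrum Polynomial

namespace IsFermatField

variable {L : Type} [Field L] [NumberField L] {p : ℕ} {k : Subfield L} {ζ : L} {τ : L →+* L}
  {x y z η : L}

theorem mem_support_of_ord_factor_ne (H : IsFermatField p k ζ τ) (hp : p.Prime) (hp2 : p ≠ 2)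
    (S : IsDescentSolution p τ x y z η) {v : HeightOneSpectrum (𝓞 L)} (hv : ¬ v.LeOrd 1 (p : L))
    {ξ : L} (hξ : ξ ^ p = 1) (h : v.ord (x + ξ * y) ≠ min (v.ord x) (v.ord y)) :
    v ∈ IsDescentSolution.support x y z ∧
      ∀ ξ' : L, ξ' ^ p = 1 → ξ' ≠ ξ → v.ord (x + ξ' * y) = min (v.ord x) (v.ord y) := by
  rcases ord_add_mul_of_not_leOrd hp hp2 H.primitive S.x_ne_zero S.y_ne_zero S.rhs_ne_zero
    S.equation hv hξ with h1 | ⟨h1, h2, h3⟩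
  · exact absurd h1 h
  · refine ⟨?_, h3⟩
    rw [S.ord_rhs v] at h2
    have hp0 : (0 : ℤ) < p := by exact_mod_cast hp.pos
    change min (v.ord x) (v.ord y) < v.ord z
    nlinarith

theorem min_le_ord_factor (H : IsFermatField p k ζ τ) (hp : p.Prime) (hp2 : p ≠ 2)
    (S : IsDescentSolution p τ x y z η) {v : HeightOneSpectrum (𝓞 L)} (hv : ¬ v.LeOrd 1 (p : L))
    {ξ : L} (hξ : ξ ^ p = 1) : min (v.ord x) (v.ord y) ≤ v.ord (x + ξ * y) := by
  rcases ord_add_mul_of_not_leOrd hp hp2 H.primitive S.x_ne_zero S.y_ne_zero S.rhs_ne_zero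
    S.equation hv hξ with h1 | ⟨h1, -⟩
  · exact h1.ge
  · exact h1.le

theorem exists_descent (H : IsFermatField p k ζ τ) (hp : p.Prime) (hp5 : 5 ≤ p)
    (S : IsDescentSolution p τ x y z η) : ∃ x' y' z' η' : L, IsDescentSolution p τ x' y' z' η' ∧
      IsDescentSolution.support x' y' z' ⊂ IsDescentSolution.support x y z := by
  have hp2 : p ≠ 2 := by omega
  have hp0 : (0 : ℤ) < p := by exact_mod_cast hp.pos
  have hζ := H.primitive
  have hζ0 := H.zeta_ne_zero hp
  have hpow : ∀ n : ℕ, 0 < n → n < 5 → ζ ^ n ≠ 1 := fun n hn hn5 h => by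
    have := Nat.le_of_dvd hn ((hζ.pow_eq_one_iff_dvd n).1 h)
    omega
  obtain ⟨ξ, hξdef⟩ : ∃ ξ, ξ = ζ ^ 2 := ⟨_, rfl⟩
  have hξ0 : ξ ≠ 0 := by rw [hξdef]; exact pow_ne_zero _ hζ0
  have r1 := hζ.pow_eq_one
  have r1' : ζ⁻¹ ^ p = 1 := by rw [inv_pow, r1, inv_one]
  have r2 : ξ ^ p = 1 := by rw [hξdef, ← pow_mul, mul_comm, pow_mul, r1, one_pow]
  have r2' : ξ⁻¹ ^ p = 1 := by rw [inv_pow, r2, inv_one]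
  have r3 : (ζ ^ 3) ^ p = 1 := by rw [← pow_mul, mul_comm, pow_mul, r1, one_pow]
  have n1 : ζ ≠ 1 := hζ.ne_one hp.one_lt
  have n1' : ζ⁻¹ ≠ 1 := fun h => n1 (inv_eq_one.1 h)
  have n2 : ξ ≠ 1 := by rw [hξdef]; exact hpow 2 (by omega) (by omega)
  have n2' : ξ⁻¹ ≠ 1 := fun h => n2 (inv_eq_one.1 h)
  have n3 : ζ ^ 3 ≠ 1 := hpow 3 (by omega) (by omega)
  have f0 := S.add_ne_zero hp hp2
  have f1 := S.factor_ne_zero hp hp2 r1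
  have f1' := S.factor_ne_zero hp hp2 r1'
  have f2 := S.factor_ne_zero hp hp2 r2
  have f2' := S.factor_ne_zero hp hp2 r2'
  have d1 : 1 - ζ ≠ 0 := sub_ne_zero.2 n1.symm
  have d1' : 1 - ζ⁻¹ ≠ 0 := sub_ne_zero.2 n1'.symm
  have d2 : 1 - ξ ≠ 0 := sub_ne_zero.2 n2.symm
  have d2' : 1 - ξ⁻¹ ≠ 0 := sub_ne_zero.2 n2'.symm
  have d3 : 1 - ζ ^ 3 ≠ 0 := sub_ne_zero.2 n3.symm
  have ho : ∀ (v : HeightOneSpectrum (𝓞 L)) (ω : L), ω ^ p = 1 → ω ≠ 1 →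
      v.ord (1 - ω) = v.ord (1 - ζ) := by
    intro v ω hω hω1
    have hω' := isPrimitiveRoot_of_pow_eq_one hp hω hω1
    rw [← ord_neg, neg_sub, ← ord_neg v (1 - ζ), neg_sub]
    by_cases hv : v.LeOrd 1 (p : L)
    · rw [H.ord_primitive_sub_one hp hv hω', H.ord_primitive_sub_one hp hv hζ]
    · rw [ord_primitive_sub_one_of_not hp hv hω', ord_primitive_sub_one_of_not hp hv hζ]
  have hτξ : τ ξ = ξ⁻¹ := by rw [hξdef, map_pow, H.conj_zeta, inv_pow]
  have hτζ' : τ ζ⁻¹ = ζ := by rw [map_inv₀, H.conj_zeta, inv_inv]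
  have hτξ' : τ ξ⁻¹ = ξ := by rw [map_inv₀, hτξ, inv_inv]
  obtain ⟨l₁, hl₁⟩ : ∃ l, l = (1 - ζ) * (1 - ζ⁻¹) := ⟨_, rfl⟩
  obtain ⟨l₂, hl₂⟩ : ∃ l, l = (1 - ξ) * (1 - ξ⁻¹) := ⟨_, rfl⟩
  obtain ⟨a₁, ha₁⟩ : ∃ a, a = (x + ζ * y) * (x + ζ⁻¹ * y) := ⟨_, rfl⟩
  obtain ⟨a₂, ha₂⟩ : ∃ a, a = (x + ξ * y) * (x + ξ⁻¹ * y) := ⟨_, rfl⟩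
  have hl₁0 : l₁ ≠ 0 := hl₁ ▸ mul_ne_zero d1 d1'
  have hl₂0 : l₂ ≠ 0 := hl₂ ▸ mul_ne_zero d2 d2'
  have ha₁0 : a₁ ≠ 0 := ha₁ ▸ mul_ne_zero f1 f1'
  have ha₂0 : a₂ ≠ 0 := ha₂ ▸ mul_ne_zero f2 f2'
  have hτl₁ : τ l₁ = l₁ := by
    rw [hl₁, map_mul, map_sub, map_sub, map_one, H.conj_zeta, hτζ', mul_comm]
  have hτl₂ : τ l₂ = l₂ := by
    rw [hl₂, map_mul, map_sub, map_sub, map_one, hτξ, hτξ', mul_comm]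
  have hτa₁ : τ a₁ = a₁ := by
    rw [ha₁, map_mul, map_add, map_add, map_mul, map_mul, H.conj_zeta, hτζ', S.conj_x, S.conj_y,
      mul_comm]
  have hτa₂ : τ a₂ = a₂ := by
    rw [ha₂, map_mul, map_add, map_add, map_mul, map_mul, hτξ, hτξ', S.conj_x, S.conj_y, mul_comm]
  have ol₁ : ∀ v : HeightOneSpectrum (𝓞 L), v.ord l₁ = 2 * v.ord (1 - ζ) := by
    intro v
    rw [hl₁, ord_mul v d1 d1', ho v _ r1' n1', two_mul]
  have ol₂ : ∀ v : HeightOneSpectrum (𝓞 L), v.ord l₂ = 2 * v.ord (1 - ζ) := by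
    intro v
    rw [hl₂, ord_mul v d2 d2', ho v _ r2' n2', ho v _ r2 n2, two_mul]
  have oa₁ : ∀ v : HeightOneSpectrum (𝓞 L), v.ord a₁ = v.ord (x + ζ * y) + v.ord (x + ζ⁻¹ * y) :=
    fun v => by rw [ha₁, ord_mul v f1 f1']
  have oa₂ : ∀ v : HeightOneSpectrum (𝓞 L), v.ord a₂ = v.ord (x + ξ * y) + v.ord (x + ξ⁻¹ * y) :=
    fun v => by rw [ha₂, ord_mul v f2 f2']
  have ea₁ : a₁ = (x + y) ^ 2 - l₁ * (x * y) := by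
    rw [ha₁, hl₁]
    linear_combination (y ^ 2 + x * y) * (mul_inv_cancel₀ hζ0)
  have ea₂ : a₂ = (x + y) ^ 2 - l₂ * (x * y) := by
    rw [ha₂, hl₂]
    linear_combination (y ^ 2 + x * y) * (mul_inv_cancel₀ hξ0)
  have el : l₂ - l₁ = -(ξ⁻¹ * ((1 - ζ ^ 3) * (1 - ζ))) := by
    rw [hl₁, hl₂, hξdef]
    field_simp
    ring
  have hll0 : l₂ - l₁ ≠ 0 := by
    rw [el]
    exact neg_ne_zero.2 (mul_ne_zero (inv_ne_zero hξ0) (mul_ne_zero d3 d1))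
  obtain ⟨u, hu⟩ : ∃ u, u = (l₂ - l₁) / l₂ := ⟨_, rfl⟩
  have hu0 : u ≠ 0 := hu ▸ div_ne_zero hll0 hl₂0
  have hτu : τ u = u := by rw [hu, map_div₀, map_sub, hτl₁, hτl₂]
  have ou : ∀ v : HeightOneSpectrum (𝓞 L), v.ord u = 0 := by
    intro v
    rw [hu, ord_div v hll0 hl₂0, el, ord_neg, ord_mul v (inv_ne_zero hξ0) (mul_ne_zero d3 d1),
      ord_mul v d3 d1, ord_eq_zero_of_pow_eq_one hp.ne_zero r2', ho v _ r3 n3, ol₂ v]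
    ring
  obtain ⟨t₁, ht₁⟩ : ∃ t, t = (a₁ / l₁) / (a₂ / l₂) := ⟨_, rfl⟩
  obtain ⟨t₂, ht₂⟩ : ∃ t, t = ((x + y) ^ 2 / l₁) / (a₂ / l₂) := ⟨_, rfl⟩
  have hb₁0 : a₁ / l₁ ≠ 0 := div_ne_zero ha₁0 hl₁0
  have hb₂0 : a₂ / l₂ ≠ 0 := div_ne_zero ha₂0 hl₂0
  have hc0 : (x + y) ^ 2 / l₁ ≠ 0 := div_ne_zero (pow_ne_zero _ f0) hl₁0
  have ht₁0 : t₁ ≠ 0 := ht₁ ▸ div_ne_zero hb₁0 hb₂0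
  have ht₂0 : t₂ ≠ 0 := ht₂ ▸ div_ne_zero hc0 hb₂0
  have hτt₁ : τ t₁ = t₁ := by
    rw [ht₁, map_div₀, map_div₀, map_div₀, hτa₁, hτa₂, hτl₁, hτl₂]
  have hτt₂ : τ t₂ = t₂ := by
    rw [ht₂, map_div₀, map_div₀, map_div₀, map_pow, map_add, S.conj_x, S.conj_y, hτa₂, hτl₁, hτl₂]
  have htt : t₁ - 1 = u * t₂ := by
    have : a₁ / l₁ - a₂ / l₂ = u * ((x + y) ^ 2 / l₁) := by
      rw [hu, ea₁, ea₂]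
      field_simp
      ring
    rw [ht₁, ht₂, ← mul_div_assoc, ← this, sub_div, div_self hb₂0]
  have ot₁ : ∀ v : HeightOneSpectrum (𝓞 L), v.ord t₁ =
      v.ord (x + ζ * y) + v.ord (x + ζ⁻¹ * y) - v.ord (x + ξ * y) - v.ord (x + ξ⁻¹ * y) := by
    intro v
    rw [ht₁, ord_div v hb₁0 hb₂0, ord_div v ha₁0 hl₁0, ord_div v ha₂0 hl₂0, oa₁, oa₂, ol₁, ol₂]
    ring
  have ot₂ : ∀ v : HeightOneSpectrum (𝓞 L), v.ord t₂ =
      2 * v.ord (x + y) - v.ord (x + ξ * y) - v.ord (x + ξ⁻¹ * y) := by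
    intro v
    rw [ht₂, ord_div v hc0 hb₂0, ord_div v (pow_ne_zero _ f0) hl₁0, ord_div v ha₂0 hl₂0, oa₂, ol₁,
      ol₂, ord_pow]
    push_cast
    ring
  have ot₁P : ∀ v : HeightOneSpectrum (𝓞 L), v.LeOrd 1 (p : L) → v.ord t₁ = 0 := by
    intro v hv
    obtain ⟨h1, -⟩ := H.ord_factor hp hp5 S hv
    rw [ot₁, h1 _ r1 n1, h1 _ r1' n1', h1 _ r2 n2, h1 _ r2' n2']
    ring
  have ot₂P : ∀ v : HeightOneSpectrum (𝓞 L), v.LeOrd 1 (p : L) →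
      v.ord t₂ = p * (2 * (v.ord z - v.ord x - 1)) := by
    intro v hv
    obtain ⟨h1, h2, -⟩ := H.ord_factor hp hp5 S hv
    rw [ot₂, h1 _ r2 n2, h1 _ r2' n2', h2]
    ring
  have hdvd : ∀ v : HeightOneSpectrum (𝓞 L), ¬ v.LeOrd 1 (p : L) → ∀ ω : L, ω ^ p = 1 →
      (p : ℤ) ∣ v.ord (x + ω * y) - min (v.ord x) (v.ord y) := fun v hv ω hω =>
    dvd_ord_add_mul_sub hp hp2 hζ S.x_ne_zero S.y_ne_zero S.rhs_ne_zero S.equation hv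
      (by rw [S.ord_rhs v]; exact dvd_mul_right _ _) hω
  obtain ⟨ε₁, X, hε₁0, hX0, hτε₁, hτX, oε₁, hX⟩ := H.exists_conj_eq_mul_pow hp hp2 ht₁0 hτt₁ (by
    intro v
    by_cases hv : v.LeOrd 1 (p : L)
    · rw [ot₁P v hv]
      exact dvd_zero _
    · rw [ot₁ v]
      have := dvd_sub (dvd_add (hdvd v hv _ r1) (hdvd v hv _ r1'))
        (dvd_add (hdvd v hv _ r2) (hdvd v hv _ r2'))
      exact this.trans (dvd_of_eq (by ring)))
  obtain ⟨ε₂, Z, hε₂0, hZ0, hτε₂, hτZ, oε₂, hZ⟩ := H.exists_conj_eq_mul_pow hp hp2 ht₂0 hτt₂ (by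
    intro v
    by_cases hv : v.LeOrd 1 (p : L)
    · rw [ot₂P v hv]
      exact dvd_mul_right _ _
    · rw [ot₂ v]
      have h1 := hdvd v hv 1 (one_pow p)
      rw [one_mul] at h1
      have := dvd_sub (dvd_mul_of_dvd_right h1 2)
        (dvd_add (hdvd v hv _ r2) (hdvd v hv _ r2'))
      exact this.trans (dvd_of_eq (by ring)))
  have oX : ∀ v : HeightOneSpectrum (𝓞 L), p * v.ord X = v.ord t₁ := fun v => by
    rw [hX, ord_mul v hε₁0 (pow_ne_zero _ hX0), oε₁, ord_pow, zero_add]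
  have oZ : ∀ v : HeightOneSpectrum (𝓞 L), p * v.ord Z = v.ord t₂ := fun v => by
    rw [hZ, ord_mul v hε₂0 (pow_ne_zero _ hZ0), oε₂, ord_pow, zero_add]
  have oXP : ∀ v : HeightOneSpectrum (𝓞 L), v.LeOrd 1 (p : L) → v.ord X = 0 := fun v hv => by
    have := oX v
    rw [ot₁P v hv] at this
    exact (mul_eq_zero.1 this).resolve_left hp0.ne'
  have oZP : ∀ v : HeightOneSpectrum (𝓞 L), v.LeOrd 1 (p : L) → 1 ≤ v.ord Z := fun v hv => by
    have h1 := oZ v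
    rw [ot₂P v hv] at h1
    have h2 := mul_left_cancel₀ hp0.ne' h1
    obtain ⟨-, -, h3⟩ := H.ord_factor hp hp5 S hv
    omega
  have hXZ : ε₁ * X ^ p - 1 = u * ε₂ * Z ^ p := by rw [← hX, htt, hZ, mul_assoc]
  obtain ⟨e, hτe, he⟩ := H.exists_conj_eq_pow_eq hp hp2 (s := X⁻¹) hε₁0 hτε₁ oε₁ (by
    intro v hv
    refine ⟨leOrd_of_le_ord (by rw [ord_inv, oXP v hv, neg_zero]), ?_⟩
    have h1 : ε₁ - X⁻¹ ^ p = (X⁻¹ ^ p) * (u * ε₂) * Z ^ p := by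
      rw [mul_assoc, ← hXZ, inv_pow]
      field_simp
    have hXi := pow_ne_zero p (inv_ne_zero hX0)
    refine leOrd_of_le_ord ?_
    rw [h1, ord_mul v (mul_ne_zero hXi (mul_ne_zero hu0 hε₂0)) (pow_ne_zero _ hZ0),
      ord_mul v hXi (mul_ne_zero hu0 hε₂0), ord_mul v hu0 hε₂0, ou, oε₂, ord_pow, ord_pow, ord_inv,
      oXP v hv]
    have := oZP v hv
    nlinarith)
  have he0 : e ≠ 0 := by
    rintro rfl
    rw [zero_pow hp.ne_zero] at he
    exact hε₁0 he.symm
  have oe : ∀ v : HeightOneSpectrum (𝓞 L), v.ord e = 0 := fun v => by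
    have := oε₁ v
    rw [← he, ord_pow] at this
    exact (mul_eq_zero.1 this).resolve_left hp0.ne'
  have oeX : ∀ v : HeightOneSpectrum (𝓞 L), v.ord (e * X) = v.ord X := fun v => by
    rw [ord_mul v he0 hX0, oe, zero_add]
  have o1 : ∀ v : HeightOneSpectrum (𝓞 L), v.ord (-1 : L) = 0 := fun v => by
    rw [ord_neg, ord_one]
  -- a prime away from `p` in the new support divides `x + y`
  have key : ∀ v : HeightOneSpectrum (𝓞 L), ¬ v.LeOrd 1 (p : L) →
      v ∈ IsDescentSolution.support (e * X) (-1) Z →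
      v.ord (x + 1 * y) ≠ min (v.ord x) (v.ord y) := by
    intro v hv hvs hc
    change min (v.ord (e * X)) (v.ord (-1 : L)) < v.ord Z at hvs
    rw [oeX, o1] at hvs
    rw [one_mul] at hc
    have g1 := H.min_le_ord_factor hp hp2 S hv r1
    have g1' := H.min_le_ord_factor hp hp2 S hv r1'
    have g2 := H.min_le_ord_factor hp hp2 S hv r2
    have g2' := H.min_le_ord_factor hp hp2 S hv r2'
    have h1 := oX v
    have h2 := oZ v
    rw [ot₁] at h1
    rw [ot₂, hc] at h2
    have h3 : v.ord Z ≤ 0 := by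
      by_contra h4
      push Not at h4
      nlinarith
    have h4 : v.ord Z ≤ v.ord X := by
      by_contra h4
      push Not at h4
      nlinarith
    omega
  refine ⟨e * X, -1, Z, u * ε₂, ⟨mul_ne_zero he0 hX0, by simp, hZ0, mul_ne_zero hu0 hε₂0,
    by rw [map_mul, hτe, hτX], by simp, hτZ, by rw [map_mul, hτu, hτε₂],
    fun v => by rw [ord_mul v hu0 hε₂0, ou, oε₂, add_zero], ?_, ?_, ?_⟩, ?_⟩
  · rw [mul_pow, he, (hp.odd_of_ne_two hp2).neg_one_pow, ← hXZ, sub_eq_add_neg]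
  · intro v hv
    rw [oeX, o1, oXP v hv]
  · intro v hv
    have := oZP v hv
    rw [oeX, oXP v hv]
    omega
  · rw [Set.ssubset_iff_exists]
    refine ⟨fun v hvs => ?_, ?_⟩
    · by_cases hv : v.LeOrd 1 (p : L)
      · have := S.ord_lt v hv
        exact (min_le_left _ _).trans_lt this
      · exact (H.mem_support_of_ord_factor_ne hp hp2 S hv (one_pow p) (key v hv hvs)).1
    · obtain ⟨v, hv, ω, hω, hω1, hne⟩ := H.exists_ord_factor_ne hp hp5 S
      obtain ⟨h1, h2⟩ := H.mem_support_of_ord_factor_ne hp hp2 S hv hω hne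
      exact ⟨v, h1, fun hvs => key v hv hvs (h2 1 (one_pow p) hω1.symm)⟩

theorem not_isDescentSolution (H : IsFermatField p k ζ τ) (hp : p.Prime) (hp5 : 5 ≤ p) :
    ¬ IsDescentSolution p τ x y z η := by
  intro S
  induction hn : (IsDescentSolution.support x y z).ncard using Nat.strong_induction_on
    generalizing x y z η with
  | _ n ih =>
    obtain ⟨x', y', z', η', S', hlt⟩ := H.exists_descent hp hp5 S
    exact ih _ (hn ▸ Set.ncard_lt_ncard hlt S.finite_support) S' rfl

/-- Fermat's equation has no non-trivial solution in `k`. -/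
theorem fermat (H : IsFermatField p k ζ τ) (hp : p.Prime) (hp5 : 5 ≤ p) (hx : x ∈ k) (hy : y ∈ k)
    (hz : z ∈ k) (h : x ^ p + y ^ p = z ^ p) : x * y * z = 0 := by
  by_contra hne
  have hz0 : z ≠ 0 := right_ne_zero_of_mul hne
  have hx0 : x ≠ 0 := left_ne_zero_of_mul (left_ne_zero_of_mul hne)
  have hy0 : y ≠ 0 := right_ne_zero_of_mul (left_ne_zero_of_mul hne)
  have hneg : ∀ a : L, (-a) ^ p = -a ^ p := (hp.odd_of_ne_two (by omega)).neg_pow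
  -- the solution of the symmetric equation that the descent applies to
  have main : ∀ {a b c : L}, a ∈ k → b ∈ k → c ∈ k → a ≠ 0 → b ≠ 0 → c ≠ 0 →
      a ^ p + b ^ p + c ^ p = 0 →
      ¬ ∀ v : HeightOneSpectrum (𝓞 L), v.LeOrd 1 (p : L) → v.ord a = v.ord b ∧ v.ord a < v.ord c := by
    intro a b c ha hb hc ha0 hb0 hc0 habc hord
    refine H.not_isDescentSolution hp hp5 (x := a) (y := b) (z := -c) (η := 1)
      ⟨ha0, hb0, neg_ne_zero.2 hc0, one_ne_zero, H.conj_of_mem a ha, H.conj_of_mem b hb,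
        H.conj_of_mem _ (neg_mem hc), map_one τ, fun v => v.ord_one, ?_, fun v hv => (hord v hv).1,
        fun v hv => ?_⟩
    · rw [hneg]
      linear_combination habc
    · rw [ord_neg]
      exact (hord v hv).2
  have hxyz : x ^ p + y ^ p + (-z) ^ p = 0 := by
    rw [hneg]
    linear_combination h
  have hz' := neg_mem hz
  have hz0' := neg_ne_zero.2 hz0
  rcases H.first_case hp hp5 hx hy hz' hx0 hy0 hz0' hxyz with h1 | h1 | h1
  · exact main hx hz' hy hx0 hz0' hy0 (by linear_combination hxyz) h1
  · exact main hy hz' hx hy0 hz0' hx0 (by linear_combination hxyz) h1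
  · exact main hx hy hz' hx0 hy0 hz0' hxyz h1

end IsFermatField

end Descent

/-- For a squarefree integer `d > 1` and a `d`-regular prime `p ≥ 5` with `p ∤ d`, the Fermat
equation `x^p + y^p = z^p` has no non-trivial solutions over `ℚ(√d)`. -/
theorem fermat_quad_of_regular
    (d : ℤ) (hd : 1 < d) (hsf : Squarefree d)
    (p : ℕ) (hp : p.Prime) (hp5 : 5 ≤ p)
    (hndvd : ¬ ((p : ℤ) ∣ d))
    (hreg : IsRegularFor d p)
    (x y z : ℚ⟮Real.sqrt (d : ℝ)⟯)
    (h : x ^ p + y ^ p = z ^ p) :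
    x * y * z = 0 := by
  have hd0 : (0 : ℝ) ≤ d := by exact_mod_cast (by omega : (0 : ℤ) ≤ d)
  obtain ⟨ω, hω⟩ : ∃ ω : ℂ, IsPrimitiveRoot ω p := ⟨_, Complex.isPrimitiveRoot_exp p hp.ne_zero⟩
  have hsq : (Real.sqrt d) ^ 2 = d := Real.sq_sqrt hd0
  have hsqC : ((Real.sqrt d : ℝ) : ℂ) ^ 2 = d := by exact_mod_cast congrArg Complex.ofReal hsq
  let F : IntermediateField ℚ ℂ := adjoin ℚ {((Real.sqrt d : ℝ) : ℂ), ω}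
  have hinteg : ∀ t ∈ ({((Real.sqrt d : ℝ) : ℂ), ω} : Set ℂ), IsIntegral ℚ t := by
    rintro t (rfl | rfl)
    · refine IsIntegral.of_pow two_pos ?_
      rw [hsqC]
      exact_mod_cast isIntegral_algebraMap (R := ℚ) (A := ℂ) (x := (d : ℚ))
    · exact (hω.isIntegral hp.pos).tower_top
  have : FiniteDimensional ℚ F := finiteDimensional_adjoin hinteg
  have : NumberField F := ⟨⟩
  let s : F := ⟨_, subset_adjoin ℚ _ (Set.mem_insert _ _)⟩
  let ζ : F := ⟨ω, subset_adjoin ℚ _ (Set.mem_insert_of_mem _ rfl)⟩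
  have hs : s ^ 2 = (d : F) := Subtype.ext (by simpa [s] using hsqC)
  have hζ : IsPrimitiveRoot ζ p := IsPrimitiveRoot.of_map_of_injective (f := F.val)
    (by exact hω) F.val.injective
  have htop : adjoin ℚ ({s, ζ} : Set F) = ⊤ := by
    have key : @adjoin ℚ _ F _ F.algebra' {s, ζ} = ⊤ := by
      apply IntermediateField.map_injective F.val
      rw [adjoin_map, Set.image_pair, ← AlgHom.fieldRange_eq_map, fieldRange_val]
      rfl
    convert key <;> exact Subsingleton.elim _ _
  let conj : ℂ →ₐ[ℚ] ℂ := Complex.conjAe.toAlgHom.restrictScalars ℚ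
  have hωconj : conj ω = ω⁻¹ := by
    change starRingEnd ℂ ω = _
    rw [Complex.inv_def, Complex.normSq_eq_norm_sq, hω.norm'_eq_one hp.ne_zero]
    simp
  have hsconj : conj ((Real.sqrt d : ℝ) : ℂ) = (Real.sqrt d : ℝ) := Complex.conj_ofReal _
  have hFconj : F.map conj ≤ F := by
    rw [adjoin_map, Set.image_pair, adjoin_le_iff, hωconj, hsconj]
    rintro t (rfl | rfl)
    · exact s.2
    · exact inv_mem ζ.2
  let τ : F →ₐ[ℚ] F := RingHom.toRatAlgHom ((conj.comp F.val).codRestrict F.toSubalgebra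
    fun t => hFconj ⟨t, t.2, rfl⟩ : F →+* F)
  have hτs : τ s = s := Subtype.ext hsconj
  have hτζ : τ ζ = ζ⁻¹ := Subtype.ext hωconj
  have H := isFermatField_of_adjoin_eq_top (by omega : 0 < d) hs hp (by omega : p ≠ 2) hndvd hζ htop
    (hreg F s ζ hs hζ htop) τ hτs hτζ
  have hlift : ∀ t : ℚ⟮Real.sqrt (d : ℝ)⟯, ∃ T : F, T ∈ ℚ⟮s⟯ ∧ (T : ℂ) = ((t : ℝ) : ℂ) := by
    intro t
    obtain ⟨a, b, hab⟩ := exists_rat_of_mem_adjoin_sqrt hsq t.2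
    refine ⟨a + b * s, ?_, ?_⟩
    · exact add_mem (SubfieldClass.ratCast_mem _ a) (mul_mem (SubfieldClass.ratCast_mem _ b) (mem_adjoin_simple_self ℚ s))
    · rw [hab]
      push_cast
      rfl
  obtain ⟨X, hXk, hX⟩ := hlift x
  obtain ⟨Y, hYk, hY⟩ := hlift y
  obtain ⟨Z, hZk, hZ⟩ := hlift z
  have h1 : X * Y * Z = 0 := by
    refine H.fermat hp hp5 hXk hYk hZk (Subtype.ext ?_)
    push_cast
    rw [hX, hY, hZ]
    exact_mod_cast congrArg (fun t : ℚ⟮Real.sqrt (d : ℝ)⟯ => (((t : ℝ)) : ℂ)) h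
  have h2 := congrArg (fun t : F => (t : ℂ)) h1
  push_cast at h2
  rw [hX, hY, hZ] at h2
  exact_mod_cast h2
end

section
/- Let p ≥ 5 be a prime and let n be a positive integer such that q := np + 1 is prime. Suppose there is no element ζ ∈ 𝔽_q with ζ^n = 1 and (ζ + 1)^n = 1 (equivalently, q does not divide the resultant Res(X^n − 1, (X+1)^n − 1)). Then every triple a, b, c ∈ 𝔽_q with a^p + b^p + c^p = 0 satisfies abc = 0. (This is the arithmetic core of Kraus's criterion producing primes of multiplicative reduction for the Frey curve.) -/
/-- Kraus's criterion (arithmetic core): let `p ≥ 5` be prime and `n > 0` with `q = np + 1`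
prime. If there is no `ζ ∈ 𝔽_q` with `ζⁿ = 1` and `(ζ + 1)ⁿ = 1`, then every solution of
`aᵖ + bᵖ + cᵖ = 0` in `𝔽_q` satisfies `abc = 0`. -/
theorem kraus_criterion
    (p n : ℕ) (hp : p.Prime) (hp5 : 5 ≤ p) (hn : 0 < n)
    (hq : (n * p + 1).Prime)
    (hres : ¬ ∃ ζ : ZMod (n * p + 1), ζ ^ n = 1 ∧ (ζ + 1) ^ n = 1)
    (a b c : ZMod (n * p + 1)) (h : a ^ p + b ^ p + c ^ p = 0) :
    a * b * c = 0 := by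
  have : Fact (n * p + 1).Prime := ⟨hq⟩
  by_contra habc
  have ha : a ≠ 0 := by rintro rfl; simp at habc
  have hb : b ≠ 0 := by rintro rfl; simp at habc
  have hc : c ≠ 0 := by rintro rfl; simp at habc
  have hodd : Odd p := hp.odd_of_ne_two (by omega)
  have pow_pow_eq_one {x : ZMod (n * p + 1)} (hx : x ≠ 0) : (x ^ p) ^ n = 1 := by
    rw [← pow_mul']
    simpa using ZMod.pow_card_sub_one_eq_one hx
  refine hres ⟨(a / b) ^ p, pow_pow_eq_one (div_ne_zero ha hb), ?_⟩
  have hsum : (a / b) ^ p + 1 = (-c / b) ^ p := by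
    rw [div_pow, div_pow, hodd.neg_pow]
    field_simp
    linear_combination h
  rw [hsum]
  exact pow_pow_eq_one (div_ne_zero (neg_ne_zero.mpr hc) hb)
end

section
/- Let f(x) = x^6 − 8x^5 + 6x^4 + 18x^3 − 11x^2 − 14x − 3 (a hyperelliptic model of the modular curve X₀(31) is y² = f(x)). Then there are no x, y ∈ ℚ₅ (the field of 5-adic numbers) with 95·y² = f(x); moreover 95 is not a square in ℚ₅. (Consequently the quadratic twist X₀^{95}(31) of X₀(31) by 95 has no ℚ₅-points, and hence no rational points.) -/
instance : Fact (Nat.Prime 5) := ⟨by norm_num⟩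

theorem Padic.norm_ninetyFive : ‖(95 : ℚ_[5])‖ = 5⁻¹ := by
  have h5 : ‖(5 : ℚ_[5])‖ = 5⁻¹ := by simpa using Padic.norm_p (p := 5)
  have h19 : ‖(19 : ℚ_[5])‖ = 1 := by
    simpa using (Padic.norm_natCast_eq_one_iff (p := 5) (n := 19)).2 (by norm_num)
  rw [show (95 : ℚ_[5]) = 5 * 19 by norm_num, norm_mul, h5, h19, mul_one]

/-- If `95 * y ^ 2` is a `5`-adic integer, then its reduction modulo `5` vanishes. -/
theorem PadicInt.toZMod_eq_zero_of_eq_ninetyFive_mul_sq {u : ℤ_[5]} {y : ℚ_[5]}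
    (h : 95 * y ^ 2 = (u : ℚ_[5])) : PadicInt.toZMod u = 0 := by
  have hy : ‖y‖ ≤ 1 := by
    have hu := u.norm_le_one
    rw [PadicInt.norm_def, ← h, norm_mul, norm_pow, Padic.norm_ninetyFive] at hu
    have hlt : ‖y‖ < 5 := by nlinarith [norm_nonneg y]
    simpa using (Padic.norm_le_pow_iff_norm_lt_pow_add_one y 0).2 (by simpa using hlt)
  obtain ⟨y, rfl⟩ : ∃ z : ℤ_[5], (z : ℚ_[5]) = y := ⟨⟨y, hy⟩, rfl⟩
  have hu : 95 * y ^ 2 = u := PadicInt.ext h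
  rw [← hu, map_mul, map_ofNat, show (OfNat.ofNat 95 : ZMod 5) = 0 from rfl, zero_mul]

/-- The quadratic twist by `95` of the hyperelliptic model
`y² = x⁶ − 8x⁵ + 6x⁴ + 18x³ − 11x² − 14x − 3` of the modular curve `X₀(31)` has no affine
`ℚ₅`-points, and `95` is not a square in `ℚ₅`. -/
theorem X0_31_twist_95_no_Q5_points :
    (¬ ∃ x y : ℚ_[5], 95 * y ^ 2 =
      x ^ 6 - 8 * x ^ 5 + 6 * x ^ 4 + 18 * x ^ 3 - 11 * x ^ 2 - 14 * x - 3) ∧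
    ¬ ∃ t : ℚ_[5], t ^ 2 = 95 := by
  refine ⟨?_, ?_⟩
  · rintro ⟨x, y, h⟩
    rcases le_total ‖x‖ 1 with hx | hx
    · obtain ⟨x, rfl⟩ : ∃ z : ℤ_[5], (z : ℚ_[5]) = x := ⟨⟨x, hx⟩, rfl⟩
      have hred := PadicInt.toZMod_eq_zero_of_eq_ninetyFive_mul_sq
        (u := x ^ 6 - 8 * x ^ 5 + 6 * x ^ 4 + 18 * x ^ 3 - 11 * x ^ 2 - 14 * x - 3)
        (by rw [h]; push_cast; rfl)
      simp only [map_sub, map_add, map_mul, map_pow, map_ofNat] at hred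
      generalize PadicInt.toZMod x = a at hred
      revert a
      decide
    · have hx0 : x ≠ 0 := norm_pos_iff.1 (by linarith)
      obtain ⟨w, hw⟩ : ∃ w : ℤ_[5], (w : ℚ_[5]) = x⁻¹ :=
        ⟨⟨x⁻¹, by rw [norm_inv]; exact inv_le_one_of_one_le₀ hx⟩, rfl⟩
      have hred := PadicInt.toZMod_eq_zero_of_eq_ninetyFive_mul_sq
        (u := 1 - 8 * w + 6 * w ^ 2 + 18 * w ^ 3 - 11 * w ^ 4 - 14 * w ^ 5 - 3 * w ^ 6)
        (y := y / x ^ 3) (by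
          rw [div_pow, ← mul_div_assoc, h]
          push_cast
          rw [hw]
          field_simp
          rfl)
      simp only [map_sub, map_add, map_mul, map_pow, map_ofNat, map_one] at hred
      generalize PadicInt.toZMod w = a at hred
      revert a
      decide
  · rintro ⟨t, ht⟩
    have ht1 : ‖t‖ ≤ 1 := by
      have hn := congrArg norm ht
      rw [norm_pow, Padic.norm_ninetyFive] at hn
      nlinarith [norm_nonneg t]
    obtain ⟨t, rfl⟩ : ∃ z : ℤ_[5], (z : ℚ_[5]) = t := ⟨⟨t, ht1⟩, rfl⟩
    have ht2 : t ^ 2 = 95 := PadicInt.ext ht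
    have hred := congrArg (PadicInt.toZModPow 2) ht2
    rw [map_pow, map_ofNat] at hred
    generalize PadicInt.toZModPow 2 t = a at hred
    change ZMod 25 at a
    revert a
    decide
end

section
/- Let d ∈ {37, 79} and let K = ℚ(√d). Then no elliptic curve E over K with j-invariant j(E) = −9317 has full two-torsion over K; that is, for every such E, the 2-torsion subgroup {P ∈ E(K) : 2·P = O} has fewer than 4 elements. -/
namespace WeierstrassCurve

variable {K : Type*} [Field K]

/-- The coordinates of a nonzero point killed by two satisfy the two-torsion equations. -/
lemma exists_coords_of_two_nsmul_eq_zero [DecidableEq K] (W : WeierstrassCurve K)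
    {P : W.toAffine.Point} (hP : P ≠ 0) (h2 : 2 • P = 0) :
    ∃ (x y : K) (h : W.toAffine.Nonsingular x y),
      P = Affine.Point.some x y h ∧ 2 * y + W.a₁ * x + W.a₃ = 0 ∧
        4 * x ^ 3 + W.b₂ * x ^ 2 + 2 * W.b₄ * x + W.b₆ = 0 := by
  cases P with
  | zero => exact absurd rfl hP
  | some x y h =>
    have hneg := add_eq_zero_iff_eq_neg.mp (two_nsmul (Affine.Point.some x y h) ▸ h2)
    rw [Affine.Point.neg_some, Affine.Point.some.injEq] at hneg
    have hy : 2 * y + W.a₁ * x + W.a₃ = 0 := by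
      have := hneg.2
      rw [Affine.negY] at this
      linear_combination this
    have heq := (W.toAffine.equation_iff x y).mp h.1
    refine ⟨x, y, h, rfl, hy, ?_⟩
    rw [b₂, b₄, b₆]
    linear_combination (2 * y + W.a₁ * x + W.a₃) * hy - 4 * heq

/-- The discriminant in terms of three distinct roots of the two-torsion polynomial. -/
lemma Δ_eq_of_roots (W : WeierstrassCurve K) (h2 : (2 : K) ≠ 0) {x₁ x₂ x₃ : K}
    (h₁₂ : x₁ ≠ x₂) (h₁₃ : x₁ ≠ x₃) (h₂₃ : x₂ ≠ x₃)
    (h₁ : 4 * x₁ ^ 3 + W.b₂ * x₁ ^ 2 + 2 * W.b₄ * x₁ + W.b₆ = 0)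
    (h₂ : 4 * x₂ ^ 3 + W.b₂ * x₂ ^ 2 + 2 * W.b₄ * x₂ + W.b₆ = 0)
    (h₃ : 4 * x₃ ^ 3 + W.b₂ * x₃ ^ 2 + 2 * W.b₄ * x₃ + W.b₆ = 0) :
    W.Δ = (4 * ((x₁ - x₂) * (x₁ - x₃) * (x₂ - x₃))) ^ 2 := by
  have q₁₂ : 4 * (x₁ ^ 2 + x₁ * x₂ + x₂ ^ 2) + W.b₂ * (x₁ + x₂) + 2 * W.b₄ = 0 :=
    mul_left_cancel₀ (sub_ne_zero.mpr h₁₂) (by linear_combination h₁ - h₂)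
  have q₁₃ : 4 * (x₁ ^ 2 + x₁ * x₃ + x₃ ^ 2) + W.b₂ * (x₁ + x₃) + 2 * W.b₄ = 0 :=
    mul_left_cancel₀ (sub_ne_zero.mpr h₁₃) (by linear_combination h₁ - h₃)
  have hb₂ : W.b₂ = -4 * (x₁ + x₂ + x₃) :=
    mul_left_cancel₀ (sub_ne_zero.mpr h₂₃) (by linear_combination q₁₂ - q₁₃)
  have hb₄ : W.b₄ = 2 * (x₁ * x₂ + x₁ * x₃ + x₂ * x₃) :=
    mul_left_cancel₀ h2 (by linear_combination q₁₂ - (x₁ + x₂) * hb₂)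
  have hb₆ : W.b₆ = -4 * (x₁ * x₂ * x₃) := by
    linear_combination h₁ - x₁ ^ 2 * hb₂ - 2 * x₁ * hb₄
  have hb₈ : W.b₈ = 4 * (x₁ + x₂ + x₃) * (x₁ * x₂ * x₃)
      - (x₁ * x₂ + x₁ * x₃ + x₂ * x₃) ^ 2 := by
    have hrel := W.b_relation
    rw [hb₂, hb₄, hb₆] at hrel
    exact mul_left_cancel₀ (mul_ne_zero h2 h2) (by linear_combination hrel)
  rw [Δ, hb₂, hb₄, hb₆, hb₈]
  ring

/-- Three distinct nonzero two-torsion points force the discriminant to be a square. -/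
lemma isSquare_Δ_of_two_torsion [DecidableEq K] (W : WeierstrassCurve K) (h2 : (2 : K) ≠ 0)
    {P Q R : W.toAffine.Point} (hP : P ≠ 0) (hQ : Q ≠ 0) (hR : R ≠ 0)
    (hPQ : P ≠ Q) (hPR : P ≠ R) (hQR : Q ≠ R)
    (tP : 2 • P = 0) (tQ : 2 • Q = 0) (tR : 2 • R = 0) : IsSquare W.Δ := by
  obtain ⟨x₁, y₁, n₁, rfl, e₁, f₁⟩ := W.exists_coords_of_two_nsmul_eq_zero hP tP
  obtain ⟨x₂, y₂, n₂, rfl, e₂, f₂⟩ := W.exists_coords_of_two_nsmul_eq_zero hQ tQ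
  obtain ⟨x₃, y₃, n₃, rfl, e₃, f₃⟩ := W.exists_coords_of_two_nsmul_eq_zero hR tR
  have key {x y x' y' : K} (e : 2 * y + W.a₁ * x + W.a₃ = 0)
      (e' : 2 * y' + W.a₁ * x' + W.a₃ = 0) (hx : x = x') : y = y' :=
    mul_left_cancel₀ h2 (by linear_combination e - e' - W.a₁ * hx)
  rw [Ne, Affine.Point.some.injEq] at hPQ hPR hQR
  rw [W.Δ_eq_of_roots h2 (fun h ↦ hPQ ⟨h, key e₁ e₂ h⟩) (fun h ↦ hPR ⟨h, key e₁ e₃ h⟩)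
    (fun h ↦ hQR ⟨h, key e₂ e₃ h⟩) f₁ f₂ f₃]
  exact IsSquare.sq _

/-- `c₆² = (j - 1728) Δ`. -/
lemma c₆_sq_eq (W : WeierstrassCurve K) [W.IsElliptic] : W.c₆ ^ 2 = (W.j - 1728) * W.Δ := by
  have hj : W.j * W.Δ = W.c₄ ^ 3 := by
    rw [j, ← coe_Δ', mul_right_comm, Units.inv_mul, one_mul]
  linear_combination W.c_relation - hj

/-- An elliptic curve over an ordered field with `j < 1728` has nonsquare discriminant. -/
lemma not_isSquare_Δ_of_j_lt [LinearOrder K] [IsStrictOrderedRing K] (W : WeierstrassCurve K)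
    [W.IsElliptic] (hj : W.j < 1728) : ¬ IsSquare W.Δ := fun h ↦ by
  have hΔ : 0 < W.Δ := h.nonneg.lt_of_ne' W.isUnit_Δ.ne_zero
  nlinarith [W.c₆_sq_eq, sq_nonneg W.c₆, mul_pos (sub_pos.mpr hj) hΔ]

end WeierstrassCurve

open IntermediateField

/-- For `d ∈ {37, 79}`, no elliptic curve over `ℚ(√d)` with j-invariant `−9317` has full
two-torsion over `ℚ(√d)`: its 2-torsion subgroup has fewer than 4 elements. -/
theorem no_full_two_torsion_j_neg9317
    (d : ℕ) (hd : d ∈ ({37, 79} : Finset ℕ))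
    (E : WeierstrassCurve ℚ⟮Real.sqrt (d : ℝ)⟯) [E.IsElliptic]
    (hj : E.j = -9317) :
    ¬ ∃ P₁ P₂ P₃ P₄ : E.toAffine.Point,
      P₁ ≠ P₂ ∧ P₁ ≠ P₃ ∧ P₁ ≠ P₄ ∧ P₂ ≠ P₃ ∧ P₂ ≠ P₄ ∧ P₃ ≠ P₄ ∧
      2 • P₁ = 0 ∧ 2 • P₂ = 0 ∧ 2 • P₃ = 0 ∧ 2 • P₄ = 0 := by
  rintro ⟨P₁, P₂, P₃, P₄, h₁₂, h₁₃, h₁₄, h₂₃, h₂₄, h₃₄, t₁, t₂, t₃, t₄⟩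
  refine E.not_isSquare_Δ_of_j_lt (by rw [hj]; norm_num) ?_
  by_cases z₁ : P₁ = 0
  · subst z₁
    exact E.isSquare_Δ_of_two_torsion two_ne_zero h₁₂.symm h₁₃.symm h₁₄.symm h₂₃ h₂₄ h₃₄ t₂ t₃ t₄
  by_cases z₂ : P₂ = 0
  · subst z₂
    exact E.isSquare_Δ_of_two_torsion two_ne_zero z₁ h₂₃.symm h₂₄.symm h₁₃ h₁₄ h₃₄ t₁ t₃ t₄
  by_cases z₃ : P₃ = 0
  · subst z₃
    exact E.isSquare_Δ_of_two_torsion two_ne_zero z₁ z₂ h₃₄.symm h₁₂ h₁₄ h₂₄ t₁ t₂ t₄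
  exact E.isSquare_Δ_of_two_torsion two_ne_zero z₁ z₂ z₃ h₁₂ h₁₃ h₂₃ t₁ t₂ t₃
end
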